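/- arXiv:1708.07078 — 5 statements merged into one kernel-verified Lean document; each statement's English description precedes it below -/
import Mathlib

section
/- Let ℓ and m be axiomatic length functions on a group G. Then s·ℓ + t·m is an axiomatic length function on G for every pair of real numbers s, t > 0 if and only if ℓ and m have compatible combinatorics and are coherently oriented. -/
/-- An axiomatic length function on a group `G` (Culler–Morgan / Parry axioms I–VI). -/
def IsLengthFunction {G : Type*} [Group G] (ℓ : G → ℝ) : Prop :=
  (∀ g : G, 0 ≤ ℓ g) ∧
  -- (I)
  ℓ 1 = 0 ∧
  -- (II)
  (∀ g : G, ℓ g = ℓ g⁻¹) ∧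
  -- (III)
  (∀ g h : G, ℓ (h * g * h⁻¹) = ℓ g) ∧
  -- (IV)
  (∀ g h : G, ℓ (g * h) = ℓ (g * h⁻¹) ∨
    max (ℓ (g * h)) (ℓ (g * h⁻¹)) ≤ ℓ g + ℓ h) ∧
  -- (V)
  (∀ g h : G, 0 < ℓ g → 0 < ℓ h →
    (ℓ (g * h) = ℓ (g * h⁻¹) ∧ ℓ g + ℓ h < ℓ (g * h)) ∨
    max (ℓ (g * h)) (ℓ (g * h⁻¹)) = ℓ g + ℓ h) ∧
  -- (VI)
  (∃ g h : G, 0 < ℓ g + ℓ h - ℓ (g * h⁻¹) ∧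
    ℓ g + ℓ h - ℓ (g * h⁻¹) < 2 * min (ℓ g) (ℓ h))

/-- The overlap set `O^ℓ`: pairs of distinct elements with `ℓ(gh) ≠ ℓ(gh⁻¹)`. -/
def OverlapSet {G : Type*} [Group G] (ℓ : G → ℝ) : Set (G × G) :=
  {p : G × G | p.1 ≠ p.2 ∧ ℓ (p.1 * p.2) ≠ ℓ (p.1 * p.2⁻¹)}

/-- The disjoint set `D^ℓ`: pairs of distinct elements with
`ℓ(gh) = ℓ(gh⁻¹) > ℓ(g) + ℓ(h)`. -/
def DisjointSet {G : Type*} [Group G] (ℓ : G → ℝ) : Set (G × G) :=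
  {p : G × G | p.1 ≠ p.2 ∧ ℓ (p.1 * p.2) = ℓ (p.1 * p.2⁻¹) ∧
    ℓ p.1 + ℓ p.2 < ℓ (p.1 * p.2)}

/-- `ℓ` and `m` have compatible combinatorics if `O^ℓ ∩ D^m = ∅ = D^ℓ ∩ O^m`. -/
def CompatibleCombinatorics {G : Type*} [Group G] (ℓ m : G → ℝ) : Prop :=
  OverlapSet ℓ ∩ DisjointSet m = ∅ ∧ DisjointSet ℓ ∩ OverlapSet m = ∅

/-- `ℓ` and `m` are coherently oriented if on `O^ℓ ∩ O^m` the strict inequalities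
`ℓ(gh⁻¹) < ℓ(gh)` and `m(gh⁻¹) < m(gh)` are equivalent. -/
def CoherentlyOriented {G : Type*} [Group G] (ℓ m : G → ℝ) : Prop :=
  ∀ p ∈ OverlapSet ℓ ∩ OverlapSet m,
    (ℓ (p.1 * p.2⁻¹) < ℓ (p.1 * p.2) ↔ m (p.1 * p.2⁻¹) < m (p.1 * p.2))

/-- `(g,h)` is a good pair for `ℓ` if `0 < ℓ(g)+ℓ(h)−ℓ(gh⁻¹) < 2·min{ℓ(g),ℓ(h)}`. -/
def GoodPair {G : Type*} [Group G] (ℓ : G → ℝ) (g h : G) : Prop :=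
  0 < ℓ g + ℓ h - ℓ (g * h⁻¹) ∧
  ℓ g + ℓ h - ℓ (g * h⁻¹) < 2 * min (ℓ g) (ℓ h)

namespace LF

variable {G : Type*} [Group G] {ℓ m : G → ℝ}

theorem conj (L : IsLengthFunction ℓ) {x y : G} (k : G) (h : k * y * k⁻¹ = x) : ℓ x = ℓ y := by
  rw [← h]; exact L.2.2.2.1 y k

theorem inv (L : IsLengthFunction ℓ) (x : G) : ℓ x⁻¹ = ℓ x := (L.2.2.1 x).symm

/-- axiom IV, in terms of named products -/
theorem four (L : IsLengthFunction ℓ) {x y p q : G} (hp : x * y = p) (hq : x * y⁻¹ = q) :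
    ℓ p = ℓ q ∨ (ℓ p ≤ ℓ x + ℓ y ∧ ℓ q ≤ ℓ x + ℓ y) := by
  subst hp hq
  rcases L.2.2.2.2.1 x y with h | h
  · exact Or.inl h
  · exact Or.inr (max_le_iff.1 h)

/-- axiom V, in terms of named products -/
theorem five (L : IsLengthFunction ℓ) {x y p q : G} (hp : x * y = p) (hq : x * y⁻¹ = q)
    (hx : 0 < ℓ x) (hy : 0 < ℓ y) :
    (ℓ p = ℓ q ∧ ℓ x + ℓ y < ℓ p) ∨ (ℓ p = ℓ x + ℓ y ∧ ℓ q ≤ ℓ x + ℓ y) ∨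
      (ℓ q = ℓ x + ℓ y ∧ ℓ p ≤ ℓ x + ℓ y) := by
  subst hp hq
  rcases L.2.2.2.2.2.1 x y hx hy with h | h
  · exact Or.inl h
  · right
    rcases le_total (ℓ (x * y)) (ℓ (x * y⁻¹)) with h' | h'
    · rw [max_eq_right h'] at h
      right; exact ⟨h, h ▸ h'⟩
    · rw [max_eq_left h'] at h
      left; exact ⟨h, h ▸ h'⟩

theorem five_left (L : IsLengthFunction ℓ) {x y p q : G} (hp : x * y = p) (hq : x * y⁻¹ = q)
    (hx : 0 < ℓ x) (hy : 0 < ℓ y) (h : ℓ q < ℓ x + ℓ y) : ℓ p = ℓ x + ℓ y := by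
  rcases five L hp hq hx hy with h1 | h1 | h1 <;> linarith [h1.1, h1.2]

theorem five_right (L : IsLengthFunction ℓ) {x y p q : G} (hp : x * y = p) (hq : x * y⁻¹ = q)
    (hx : 0 < ℓ x) (hy : 0 < ℓ y) (h : ℓ p < ℓ x + ℓ y) : ℓ q = ℓ x + ℓ y := by
  rcases five L hp hq hx hy with h1 | h1 | h1 <;> linarith [h1.1, h1.2]

theorem sq (L : IsLengthFunction ℓ) (x : G) : ℓ (x * x) = 2 * ℓ x := by
  have h1 : ℓ 1 = 0 := L.2.1
  have h0 := L.1 x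
  have h2 := L.1 (x * x)
  rcases h0.eq_or_lt with h | h
  · rcases four L (x := x) (y := x) rfl (mul_inv_cancel x) with h3 | h3 <;> linarith
  · have := five_left L (x := x) (y := x) rfl (mul_inv_cancel x) h h (by linarith)
    linarith

/-- `ℓ (gh⁻¹) = ℓ (g⁻¹h)`. -/
theorem flip (L : IsLengthFunction ℓ) (g h : G) : ℓ (g⁻¹ * h) = ℓ (g * h⁻¹) := by
  rw [← inv L (g * h⁻¹)]
  exact conj L g⁻¹ (by group)

/-- the sum bound for `hg³hg⁻¹` -/
theorem cube_bound (L : IsLengthFunction ℓ) {g h : G} (hg : ℓ g = 0) {a b : ℝ}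
    (ha : ℓ (g * h) = a) (hb : ℓ (g * h⁻¹) = b) (hba : b ≤ a) :
    ℓ (h * g * (g * g) * (h * g) * (g * g)⁻¹) ≤ a + b := by
  have g2 : ℓ (g * g) = 0 := by rw [sq L, hg]; ring
  have g4 : ℓ (g * g * (g * g)) = 0 := by rw [sq L, g2]; ring
  have hb' : ℓ (h * g⁻¹) = b := by
    rw [← hb, ← flip L g h]; exact conj L h (by group)
  have ha' : ℓ (h * g) = a := by
    rw [← ha]; exact conj L h (by group)
  have h3 : ℓ (h * g * (g * g)) ≤ a := by
    rcases four L (x := h * g) (y := g * g) (p := h * g * (g * g)) (q := h * g⁻¹) rfl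
      (by group) with h | h
    · linarith
    · linarith [h.1]
  have e : ℓ (h * g * (g * g) * (h * g) * (g * g)⁻¹) =
      ℓ (h * g * (g * g) * (h * g⁻¹)) := by
    congr 1; group
  have e4 : ℓ (h * (g * g * (g * g)) * h⁻¹) = 0 := by rw [← g4]; exact L.2.2.2.1 _ _
  have p1 := L.1 (h * g * (g * g))
  have p2 := L.1 (h * g⁻¹)
  rw [e]
  rcases four L (x := h * g * (g * g)) (y := h * g⁻¹) rfl
      (q := h * (g * g * (g * g)) * h⁻¹) (by group) with h | h
  · linarith
  · linarith [h.1]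

/-- `ℓ [h,g²] ≤ 2 max`, with equality if the two lengths differ. -/
theorem comm_sq (L : IsLengthFunction ℓ) {g h : G} (hg : ℓ g = 0) {a b : ℝ}
    (ha : ℓ (g * h) = a) (hb : ℓ (g * h⁻¹) = b) (hba : b ≤ a) :
    ℓ (h * (g * g) * h⁻¹ * (g * g)⁻¹) ≤ 2 * a ∧
      (b < a → ℓ (h * (g * g) * h⁻¹ * (g * g)⁻¹) = 2 * a) := by
  have hQ := cube_bound L hg ha hb hba
  have ha' : ℓ (h * g) = a := by
    rw [← ha]; exact conj L h (by group)
  have hc : ℓ (g * g * (h * g) * (g * g)⁻¹) = a := by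
    rw [← ha']; exact L.2.2.2.1 _ _
  have e1 : h * g * (g * g * (h * g) * (g * g)⁻¹) =
    h * g * (g * g) * (h * g) * (g * g)⁻¹ := by group
  have e2 : h * g * (g * g * (h * g) * (g * g)⁻¹)⁻¹ = h * (g * g) * h⁻¹ * (g * g)⁻¹ := by simp [mul_assoc]
  have b0 : 0 ≤ b := hb ▸ L.1 _
  rcases (b0.trans hba).eq_or_lt with h0 | h0
  · refine ⟨?_, fun h => by linarith⟩
    rcases four L e1 e2 with h | h
    · linarith
    · linarith [h.2]
  · rcases five L e1 e2 (ha'.symm ▸ h0) (hc.symm ▸ h0) with h | h | h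
    · exact ⟨by linarith [h.1, h.2], fun h' => by linarith [h.1, h.2]⟩
    · exact ⟨by linarith [h.1, h.2], fun h' => by linarith [h.1, h.2]⟩
    · exact ⟨by linarith [h.1, h.2], fun h' => by linarith [h.1, h.2]⟩

theorem comm_sq_inv (L : IsLengthFunction ℓ) (g h : G) :
    ℓ (h⁻¹ * (g * g) * h⁻¹⁻¹ * (g * g)⁻¹) = ℓ (h * (g * g) * h⁻¹ * (g * g)⁻¹) := by
  rw [← inv L (h * (g * g) * h⁻¹ * (g * g)⁻¹)]
  exact conj L h⁻¹ (by simp [mul_assoc])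

theorem comm_sq_max (L : IsLengthFunction ℓ) {g h : G} (hg : ℓ g = 0) :
    ℓ (h * (g * g) * h⁻¹ * (g * g)⁻¹) ≤ 2 * max (ℓ (g * h)) (ℓ (g * h⁻¹)) ∧
      (ℓ (g * h) ≠ ℓ (g * h⁻¹) → ℓ (h * (g * g) * h⁻¹ * (g * g)⁻¹) =
        2 * max (ℓ (g * h)) (ℓ (g * h⁻¹))) := by
  rcases le_total (ℓ (g * h)) (ℓ (g * h⁻¹)) with h1 | h1
  · rw [max_eq_right h1, ← comm_sq_inv L]
    have := comm_sq L hg (h := h⁻¹) rfl rfl (by simpa using h1)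
    exact ⟨this.1, fun h2 => this.2 (by simpa using lt_of_le_of_ne h1 h2)⟩
  · rw [max_eq_left h1]
    have := comm_sq L hg (h := h) rfl rfl h1
    exact ⟨this.1, fun h2 => this.2 (lt_of_le_of_ne h1 h2.symm)⟩

/-- If `[h,g]` and `g` are hyperbolic then `ℓ [h,g²] = 2 ℓ g + ℓ [h,g]`. -/
theorem comm_grow (L : IsLengthFunction ℓ) {g h : G} (hg : 0 < ℓ g)
    (hK : 0 < ℓ (h * g * h⁻¹ * g⁻¹)) :
    ℓ (h * (g * g) * h⁻¹ * (g * g)⁻¹) = 2 * ℓ g + ℓ (h * g * h⁻¹ * g⁻¹) := by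
  have hp : ℓ (h * g * h⁻¹) = ℓ g := L.2.2.2.1 _ _
  have hq : ℓ (h * g * h⁻¹ * g * (h * g * h⁻¹)⁻¹) = ℓ g := L.2.2.2.1 _ _
  have h1 : ℓ (h * (g * g) * h⁻¹ * g⁻¹) = ℓ (h * g * h⁻¹) + ℓ (h * g * h⁻¹ * g⁻¹) :=
    five_left L (x := h * g * h⁻¹) (y := h * g * h⁻¹ * g⁻¹) (by group)
      (q := h * g * h⁻¹ * g * (h * g * h⁻¹)⁻¹) (by group) (by linarith) hK (by linarith)
  have hp2 : ℓ (h * (g * g) * h⁻¹) = 2 * ℓ g := by rw [L.2.2.2.1, sq L]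
  have hi := inv L g
  have h2 : ℓ (h * (g * g) * h⁻¹ * (g * g)⁻¹) = ℓ (h * (g * g) * h⁻¹ * g⁻¹) + ℓ g⁻¹ :=
    five_left L (x := h * (g * g) * h⁻¹ * g⁻¹) (y := g⁻¹) (by group)
      (q := h * (g * g) * h⁻¹) (by group) (by linarith) (by linarith) (by linarith)
  linarith

/-- The combined consequences of compatibility, oriented from `ℓ` to `m`. -/
def Bd (ℓ m : G → ℝ) : Prop := ∀ x y : G, ℓ (x * y) ≠ ℓ (x * y⁻¹) →
  m (x * y) ≤ m x + m y ∧ m (x * y⁻¹) ≤ m x + m y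

def Co (ℓ m : G → ℝ) : Prop := ∀ x y : G, ℓ (x * y) ≠ ℓ (x * y⁻¹) → m (x * y) ≠ m (x * y⁻¹) →
  (ℓ (x * y⁻¹) < ℓ (x * y) ↔ m (x * y⁻¹) < m (x * y))

/-- Key lemma: an elliptic `g` in `ℓ` which is hyperbolic in `m` does not fold the axis of `h`. -/
theorem no_fold (L : IsLengthFunction ℓ) (M : IsLengthFunction m) (B : Bd ℓ m) (B' : Bd m ℓ)
    (C : Co ℓ m) {g h : G} (hg : ℓ g = 0) (hg' : 0 < m g) :
    ℓ h ≤ max (ℓ (g * h)) (ℓ (g * h⁻¹)) := by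
  by_contra hlt
  push Not at hlt
  have hh : 0 < ℓ h := lt_of_le_of_lt (le_max_of_le_left (L.1 _)) hlt
  obtain ⟨ha, hb⟩ := max_lt_iff.1 hlt
  have g2 : ℓ (g * g) = 0 := by rw [sq L, hg]; ring
  have hcj : ℓ (g * h * g⁻¹) = ℓ h := L.2.2.2.1 _ _
  have hcj' : m (g * h * g⁻¹) = m h := M.2.2.2.1 _ _
  -- `ℓ (ghg⁻¹h) < 2 ℓ h`
  have hL1 : ℓ (g * h * g⁻¹ * h) < ℓ (g * h * g⁻¹) + ℓ h := by
    have hf := flip L g h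
    have := L.1 (g * h)
    have := L.1 (g * h⁻¹)
    rcases four L (x := g * h) (y := g⁻¹ * h) (p := g * h * g⁻¹ * h) (q := g * g) (by group)
      (by group) with h | h
    · linarith
    · linarith [h.1]
  have hL2 : ℓ (g * h * g⁻¹ * h⁻¹) = ℓ (g * h * g⁻¹) + ℓ h :=
    five_right L rfl rfl (by linarith) hh hL1
  have hne : ℓ (g * h * g⁻¹ * h) ≠ ℓ (g * h * g⁻¹ * h⁻¹) := by
    intro h; linarith
  obtain ⟨b1, b2⟩ := B _ _ hne
  -- orientation
  have hM : m (g * h * g⁻¹ * h) ≤ m (g * h * g⁻¹ * h⁻¹) := by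
    by_contra hc
    push Not at hc
    have := (C _ _ hne hc.ne').2 hc
    linarith
  have hK : ∀ {f : G → ℝ}, IsLengthFunction f →
      f (h * g * h⁻¹ * g⁻¹) = f (g * h * g⁻¹ * h⁻¹) := by
    intro f F
    rw [← inv F (g * h * g⁻¹ * h⁻¹)]
    congr 1; group
  -- `(g, hgh⁻¹)` is disjoint in `ℓ`
  have hc1 : ℓ (h * g * h⁻¹) = 0 := by rw [L.2.2.2.1, hg]
  have hc2 : m (h * g * h⁻¹) = m g := M.2.2.2.1 _ _
  have eq1 : g * (h * g * h⁻¹)⁻¹ = g * h * g⁻¹ * h⁻¹ := by group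
  have hnm : m (g * (h * g * h⁻¹)) = m (g * h * g⁻¹ * h⁻¹) := by
    by_contra hc
    rw [← eq1] at hc
    have := (B' _ _ hc).2
    rw [eq1] at this
    linarith
  have hM2 : 0 < m (g * h * g⁻¹ * h⁻¹) := by
    rcases five M (x := g) (y := h * g * h⁻¹) rfl eq1 hg' (by linarith) with h | h | h <;>
      linarith [h.1, h.2]
  have hH : 0 < m h := by linarith
  have hM2' : m (g * h * g⁻¹ * h⁻¹) = 2 * m h := by
    rcases five M (x := g * h * g⁻¹) (y := h) rfl rfl (by linarith) hH with h | h | h <;>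
      linarith [h.1, h.2]
  have hF := comm_grow M hg' (h := h) (by rw [hK M]; exact hM2)
  rw [hK M, hM2'] at hF
  have hFl := (comm_sq_max L hg (h := h)).1
  have c1 : ℓ (g * g * h * (g * g)⁻¹) = ℓ h := L.2.2.2.1 _ _
  have c2 : m (g * g * h * (g * g)⁻¹) = m h := M.2.2.2.1 _ _
  have e2 : h * (g * g * h * (g * g)⁻¹)⁻¹ = h * (g * g) * h⁻¹ * (g * g)⁻¹ := by simp [mul_assoc]
  have hbig : ℓ (h * (g * g * h * (g * g)⁻¹)) = ℓ h + ℓ (g * g * h * (g * g)⁻¹) := by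
    rcases five L (x := h) (y := g * g * h * (g * g)⁻¹) rfl e2 hh (by linarith) with h | h | h <;>
      linarith [h.1, h.2]
  have := (B h (g * g * h * (g * g)⁻¹) (by rw [e2]; intro h; linarith)).2
  rw [e2] at this
  linarith

theorem max_ge (L : IsLengthFunction ℓ) (M : IsLengthFunction m) (B : Bd ℓ m) (B' : Bd m ℓ)
    (C : Co ℓ m) {g h : G} (hg : 0 < ℓ g + m g) (hh : 0 < ℓ h + m h) :
    ℓ g + ℓ h ≤ max (ℓ (g * h)) (ℓ (g * h⁻¹)) := by
  rcases (L.1 g).eq_or_lt with h1 | h1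
  · rw [← h1, zero_add]
    exact no_fold L M B B' C h1.symm (by linarith)
  rcases (L.1 h).eq_or_lt with h2 | h2
  · rw [← h2, add_zero]
    have := no_fold L M B B' C (g := h) (h := g) h2.symm (by linarith)
    rw [← flip L h g] at this
    rwa [conj L (x := g * h) (y := h * g) h⁻¹ (by group),
      conj L (x := g * h⁻¹) (y := h⁻¹ * g) h (by group)]
  rcases five L (x := g) (y := h) rfl rfl h1 h2 with h | h | h
  · exact le_max_of_le_left h.2.le
  · exact le_max_of_le_left h.1.ge
  · exact le_max_of_le_right h.1.ge

theorem good (L : IsLengthFunction ℓ) : ∃ x y : G, ℓ x = ℓ y ∧ (∀ f : G → ℝ,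
    IsLengthFunction f → f x = f y) ∧ 0 < ℓ (x * y⁻¹) ∧ ℓ (x * y⁻¹) < ℓ x + ℓ y ∧
    ℓ (x * y) ≠ ℓ (x * y⁻¹) := by
  obtain ⟨g, h, h1, h2⟩ := L.2.2.2.2.2.2
  have hA : ℓ g + ℓ h - ℓ (g * h⁻¹) < 2 * ℓ g := by linarith [min_le_left (ℓ g) (ℓ h)]
  have hB : ℓ g + ℓ h - ℓ (g * h⁻¹) < 2 * ℓ h := by linarith [min_le_right (ℓ g) (ℓ h)]
  have pg : 0 < ℓ g := by linarith
  have ph : 0 < ℓ h := by linarith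
  have pe : 0 < ℓ (g * h⁻¹) := by linarith
  have hi := inv L h
  have s1 : ℓ (g * h) = ℓ g + ℓ h := five_left L rfl rfl pg ph (by linarith)
  have s2 : ℓ (h * g) = ℓ g + ℓ h := by rw [← s1]; exact conj L h (by group)
  -- lengths of the other products
  have k0 : ℓ (h⁻¹ * g) = ℓ (g * h⁻¹) := conj L h⁻¹ (by group)
  have k1 : ℓ (g * (g * h⁻¹)) = ℓ g + ℓ (g * h⁻¹) :=
    five_left L rfl (q := g * h * g⁻¹) (by group) pg pe (by rw [L.2.2.2.1]; linarith)
  have k2 : ℓ (g * (g * h⁻¹) * h⁻¹) = ℓ (g * (g * h⁻¹)) + ℓ h⁻¹ :=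
    five_left L rfl (q := g * g) (by group) (by linarith) (by linarith)
      (by rw [sq L]; linarith)
  have k3 : ℓ (g * h⁻¹ * (h⁻¹ * g)) = ℓ (g * (g * h⁻¹) * h⁻¹) := conj L g⁻¹ (by group)
  have k4 : ℓ (g * h⁻¹ * (h⁻¹ * g)⁻¹) = ℓ g + ℓ h + ℓ (g * h⁻¹) := by
    rcases five L (x := g * h⁻¹) (y := h⁻¹ * g) rfl rfl pe (by linarith) with h | h | h <;>
      linarith [h.1, h.2]
  have k5 : ℓ (g * h * (h * g)⁻¹) = ℓ (g * h⁻¹ * (h⁻¹ * g)⁻¹) := by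
    rw [← inv L (g * h⁻¹ * (h⁻¹ * g)⁻¹)]
    exact conj L h (by group)
  have k6 : ℓ (g * h * (h * g)) = ℓ (g * h) + ℓ (h * g) := by
    rcases five L (x := g * h) (y := h * g) rfl rfl (by linarith) (by linarith) with h | h | h <;>
      linarith [h.1, h.2]
  refine ⟨g * h, h * g, by linarith, fun f F => conj F h⁻¹ (by group), by linarith, by linarith,
    fun h => by linarith⟩

theorem add (L : IsLengthFunction ℓ) (M : IsLengthFunction m) (B : Bd ℓ m) (B' : Bd m ℓ)
    (C : Co ℓ m) : IsLengthFunction (fun g => ℓ g + m g) := by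
  have C' : Co m ℓ := fun x y h1 h2 => (C x y h2 h1).symm
  refine ⟨fun g => add_nonneg (L.1 g) (M.1 g), ?_, ?_, ?_, ?_, ?_, ?_⟩
  · simp [L.2.1, M.2.1]
  · intro g; simp only [inv L, inv M]
  · intro g h; simp only [L.2.2.2.1, M.2.2.2.1]
  · intro g h
    dsimp only
    by_cases h1 : ℓ (g * h) = ℓ (g * h⁻¹)
    · by_cases h2 : m (g * h) = m (g * h⁻¹)
      · left; rw [h1, h2]
      · right
        have a := B' g h h2
        rcases four M (x := g) (y := h) rfl rfl with b | b
        · exact absurd b h2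
        · exact max_le (by linarith [a.1, b.1]) (by linarith [a.2, b.2])
    · right
      have a := B g h h1
      rcases four L (x := g) (y := h) rfl rfl with b | b
      · exact absurd b h1
      · exact max_le (by linarith [a.1, b.1]) (by linarith [a.2, b.2])
  · intro g h hg hh
    dsimp only at hg hh ⊢
    have p1 := max_ge L M B B' C hg hh
    have p2 := max_ge M L B' B C' (g := g) (h := h) (by linarith) (by linarith)
    have f1 := four L (x := g) (y := h) rfl rfl
    have f2 := four M (x := g) (y := h) rfl rfl
    have B1 := B g h
    have B2 := B' g h
    have C1 := C g h
    generalize ℓ (g * h) = a at *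
    generalize ℓ (g * h⁻¹) = b at *
    generalize m (g * h) = a' at *
    generalize m (g * h⁻¹) = b' at *
    rw [le_max_iff] at p1 p2
    by_cases h1 : a = b
    · by_cases h2 : a' = b'
      · subst h1 h2
        simp only [or_self, max_self, true_and] at *
        rcases (add_le_add p1 p2).eq_or_lt with h | h
        · right; linarith
        · left; linarith
      · right
        have x1 := B2 h2
        have x2 := f2.resolve_left h2
        subst h1
        simp only [or_self] at p1
        rcases p2 with p2 | p2
        · rw [max_eq_left (by linarith)]; linarith
        · rw [max_eq_right (by linarith)]; linarith
    · right
      have x1 := B1 h1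
      have x2 := f1.resolve_left h1
      by_cases h2 : a' = b'
      · subst h2
        simp only [or_self] at p2
        rcases p1 with p1 | p1
        · rw [max_eq_left (by linarith)]; linarith
        · rw [max_eq_right (by linarith)]; linarith
      · have y := C1 h1 h2
        rcases lt_or_gt_of_ne h1 with h3 | h3
        · have : a' < b' := by
            rcases lt_or_gt_of_ne h2 with h4 | h4
            · exact h4
            · have := y.2 h4; linarith
          rw [max_eq_right (by linarith)]
          rcases p1 with p1 | p1 <;> rcases p2 with p2 | p2 <;> linarith
        · have := y.1 h3
          rw [max_eq_left (by linarith)]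
          rcases p1 with p1 | p1 <;> rcases p2 with p2 | p2 <;> linarith
  · obtain ⟨x, y, h1, h2, h3, h4, h5⟩ := good L
    refine ⟨x, y, ?_, ?_⟩
    · have := (B x y h5).2
      dsimp only; linarith
    · have := M.1 (x * y⁻¹)
      have e := h2 m M
      dsimp only
      rw [h1, e, min_self]
      linarith

theorem smul (L : IsLengthFunction ℓ) {s : ℝ} (hs : 0 < s) :
    IsLengthFunction (fun g => s * ℓ g) := by
  refine ⟨fun g => mul_nonneg hs.le (L.1 g), ?_, ?_, ?_, ?_, ?_, ?_⟩
  · simp [L.2.1]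
  · intro g; simp only [inv L]
  · intro g h; simp only [L.2.2.2.1]
  · intro g h
    dsimp only
    rw [← mul_max_of_nonneg _ _ hs.le, ← mul_add]
    exact (L.2.2.2.2.1 g h).imp (fun h => by rw [h]) (fun h => mul_le_mul_of_nonneg_left h hs.le)
  · intro g h hg hh
    dsimp only at *
    rw [← mul_max_of_nonneg _ _ hs.le, ← mul_add]
    refine (L.2.2.2.2.2.1 g h (pos_of_mul_pos_right hg hs.le) (pos_of_mul_pos_right hh hs.le)).imp
      (fun h => ⟨by rw [h.1], mul_lt_mul_of_pos_left h.2 hs⟩) (fun h => by rw [h])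
  · obtain ⟨g, h, h1, h2⟩ := L.2.2.2.2.2.2
    refine ⟨g, h, ?_, ?_⟩
    · have := mul_pos hs h1
      dsimp only; linarith
    · have := mul_lt_mul_of_pos_left h2 hs
      dsimp only
      rw [← mul_min_of_nonneg _ _ hs.le]; linarith

theorem bd_of (M : IsLengthFunction m) (h : OverlapSet ℓ ∩ DisjointSet m = ∅) : Bd ℓ m := by
  intro x y hne
  by_cases hxy : x = y
  · subst hxy
    have := sq M x
    have h1 := M.2.1
    have := M.1 x
    rw [mul_inv_cancel]
    constructor <;> linarith
  rcases four M (x := x) (y := y) rfl rfl with h1 | h1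
  · have : ¬ (m x + m y < m (x * y)) := by
      intro hl
      have : (x, y) ∈ OverlapSet ℓ ∩ DisjointSet m := ⟨⟨hxy, hne⟩, ⟨hxy, h1, hl⟩⟩
      rw [h] at this
      exact this
    push Not at this
    exact ⟨this, h1 ▸ this⟩
  · exact h1

theorem co_of (L : IsLengthFunction ℓ) (M : IsLengthFunction m) (h : CoherentlyOriented ℓ m) :
    Co ℓ m := by
  intro x y h1 h2
  by_cases hxy : x = y
  · subst hxy
    have a := L.2.1
    have b := M.2.1
    have c := L.1 (x * x)
    have d := M.1 (x * x)
    rw [mul_inv_cancel, a] at h1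
    rw [mul_inv_cancel, b] at h2
    rw [mul_inv_cancel, a, b]
    exact ⟨fun _ => lt_of_le_of_ne d h2.symm, fun _ => lt_of_le_of_ne c h1.symm⟩
  exact h (x, y) ⟨⟨hxy, h1⟩, ⟨hxy, h2⟩⟩

theorem bd_smul (B : Bd ℓ m) {s t : ℝ} (ht : 0 < t) :
    Bd (fun g => s * ℓ g) (fun g => t * m g) := by
  intro x y h
  have := B x y (fun h' => h (by dsimp only; rw [h']))
  dsimp only
  rw [← mul_add]
  exact ⟨mul_le_mul_of_nonneg_left this.1 ht.le, mul_le_mul_of_nonneg_left this.2 ht.le⟩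

theorem co_smul (C : Co ℓ m) {s t : ℝ} (hs : 0 < s) (ht : 0 < t) :
    Co (fun g => s * ℓ g) (fun g => t * m g) := by
  intro x y h1 h2
  dsimp only at *
  rw [mul_lt_mul_iff_right₀ hs, mul_lt_mul_iff_right₀ ht]
  exact C x y (fun h' => h1 (by rw [h'])) (fun h' => h2 (by rw [h']))

/-- forward direction, combinatorics -/
theorem compat_of (L : IsLengthFunction ℓ)
    (H : ∀ s t : ℝ, 0 < s → 0 < t → IsLengthFunction (fun g => s * ℓ g + t * m g)) :
    OverlapSet ℓ ∩ DisjointSet m = ∅ := by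
  rw [Set.eq_empty_iff_forall_notMem]
  rintro ⟨g, h⟩ ⟨⟨-, h1⟩, ⟨-, h2, h3⟩⟩
  dsimp only at *
  have hd : 0 < m (g * h) - (m g + m h) := by linarith
  obtain ⟨t, ht⟩ := exists_nat_gt ((ℓ g + ℓ h) / (m (g * h) - (m g + m h)))
  rw [div_lt_iff₀ hd] at ht
  have t0 : (0 : ℝ) < t := by
    by_contra hc
    have : (t : ℝ) = 0 := le_antisymm (not_lt.1 hc) (Nat.cast_nonneg t)
    rw [this] at ht
    linarith [L.1 g, L.1 h]
  have N := H 1 t one_pos t0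
  have p := L.1 (g * h)
  rcases four N (x := g) (y := h) rfl rfl with f | f
  · rw [h2] at f
    exact h1 (by linarith)
  · have := f.1
    nlinarith

/-- forward direction, orientation, when `g` is elliptic in both -/
theorem no_incoh_ell (L : IsLengthFunction ℓ) (M : IsLengthFunction m)
    (H : ∀ s t : ℝ, 0 < s → 0 < t → IsLengthFunction (fun g => s * ℓ g + t * m g))
    {g h : G} (hg : ℓ g = 0) (hg' : m g = 0) (h1 : ℓ (g * h) < ℓ (g * h⁻¹))
    (h2 : m (g * h⁻¹) < m (g * h)) : False := by
  have key : ∀ s : ℝ, 0 < s → s * ℓ (g * h) + 1 * m (g * h) ≠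
      s * ℓ (g * h⁻¹) + 1 * m (g * h⁻¹) → False := by
    intro s hs hne
    have a := (comm_sq_max L hg (h := h)).2 h1.ne
    have b := (comm_sq_max M hg' (h := h)).2 h2.ne'
    have c := (comm_sq_max (H s 1 hs one_pos) (g := g) (h := h) (by simp [hg, hg'])).2 hne
    rw [a, b, max_eq_right h1.le, max_eq_left h2.le] at c
    have h3 := mul_lt_mul_of_pos_left h1 hs
    rcases max_choice (s * ℓ (g * h) + 1 * m (g * h)) (s * ℓ (g * h⁻¹) + 1 * m (g * h⁻¹))
      with d | d <;> rw [d] at c <;> linarith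
  by_cases h3 : 1 * ℓ (g * h) + 1 * m (g * h) = 1 * ℓ (g * h⁻¹) + 1 * m (g * h⁻¹)
  · exact key 2 two_pos (fun h4 => by linarith)
  · exact key 1 one_pos h3

theorem no_incoh (L : IsLengthFunction ℓ) (M : IsLengthFunction m)
    (H : ∀ s t : ℝ, 0 < s → 0 < t → IsLengthFunction (fun g => s * ℓ g + t * m g))
    {g h : G} (h1 : ℓ (g * h) < ℓ (g * h⁻¹)) (h2 : m (g * h⁻¹) < m (g * h)) : False := by
  by_cases hg : ℓ g = 0 ∧ m g = 0
  · exact no_incoh_ell L M H hg.1 hg.2 h1 h2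
  by_cases hh : ℓ h = 0 ∧ m h = 0
  · refine no_incoh_ell L M H (g := h) (h := g) hh.1 hh.2 ?_ ?_
    · rw [← flip L h g]
      rwa [conj L (x := h * g) (y := g * h) h (by group),
        conj L (x := h⁻¹ * g) (y := g * h⁻¹) h⁻¹ (by group)]
    · rw [← flip M h g]
      rwa [conj M (x := h * g) (y := g * h) h (by group),
        conj M (x := h⁻¹ * g) (y := g * h⁻¹) h⁻¹ (by group)]
  have pos : ∀ x, ¬ (ℓ x = 0 ∧ m x = 0) → 0 < 1 * ℓ x + 1 * m x := by
    intro x hx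
    have a := L.1 x
    have b := M.1 x
    by_contra hc
    exact hx ⟨by linarith, by linarith⟩
  have f1 := (four L (x := g) (y := h) rfl rfl).resolve_left h1.ne
  have f2 := (four M (x := g) (y := h) rfl rfl).resolve_left h2.ne'
  rcases five (H 1 1 one_pos one_pos) (x := g) (y := h) rfl rfl (pos g hg) (pos h hh)
    with f | f | f <;> obtain ⟨a, b⟩ := f <;>
    linarith [f1.1, f1.2, f2.1, f2.2]

end LF

/-- every positive linear combination `s·ℓ + t·m` is an axiomatic
length function iff `ℓ` and `m` have compatible combinatorics and are
coherently oriented. -/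
theorem smul_sum_isLengthFunction_iff {G : Type*} [Group G] (ℓ m : G → ℝ)
    (hℓ : IsLengthFunction ℓ) (hm : IsLengthFunction m) :
    (∀ s t : ℝ, 0 < s → 0 < t →
        IsLengthFunction (fun g => s * ℓ g + t * m g)) ↔
      CompatibleCombinatorics ℓ m ∧ CoherentlyOriented ℓ m := by
  constructor
  · intro H
    have H' : ∀ s t : ℝ, 0 < s → 0 < t → IsLengthFunction (fun g => s * m g + t * ℓ g) := by
      intro s t hs ht
      have := H t s ht hs
      simpa only [add_comm] using this
    refine ⟨⟨LF.compat_of hℓ H, ?_⟩, ?_⟩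
    · rw [Set.inter_comm]; exact LF.compat_of hm H'
    · rintro ⟨g, h⟩ ⟨⟨-, h1⟩, ⟨-, h2⟩⟩
      dsimp only at *
      constructor
      · intro h3
        by_contra hc
        exact LF.no_incoh hm hℓ H' (lt_of_le_of_ne (not_lt.1 hc) h2) h3
      · intro h3
        by_contra hc
        exact LF.no_incoh hℓ hm H (lt_of_le_of_ne (not_lt.1 hc) h1) h3
  · rintro ⟨⟨c1, c2⟩, c3⟩ s t hs ht
    rw [Set.inter_comm] at c2
    exact LF.add (LF.smul hℓ hs) (LF.smul hm ht) (LF.bd_smul (LF.bd_of hm c1) ht)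
      (LF.bd_smul (LF.bd_of hℓ c2) hs) (LF.co_smul (LF.co_of hℓ hm c3) hs ht)
end

section
/- Let ℓ and m be axiomatic length functions on a group G. Then ℓ and m have compatible combinatorics if and only if ℓ and m are coherently oriented. -/
namespace LF

variable {G : Type*} [Group G] {f : G → ℝ}

lemma nn (hf : IsLengthFunction f) (g : G) : 0 ≤ f g := hf.1 g

lemma inv_s2 (hf : IsLengthFunction f) (g : G) : f g⁻¹ = f g := (hf.2.2.1 g).symm

/-- conjugation invariance -/
lemma cj (hf : IsLengthFunction f) {x y : G} (z : G) (h : z * x * z⁻¹ = y) : f y = f x := by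
  rw [← h]; exact hf.2.2.2.1 x z

/-- conjugation and inversion invariance -/
lemma ci (hf : IsLengthFunction f) {x y : G} (z : G) (h : z * x⁻¹ * z⁻¹ = y) : f y = f x := by
  rw [cj hf z h, inv_s2 hf]

lemma iv (hf : IsLengthFunction f) (x y : G) {w1 w2 : G} (h1 : f w1 = f (x * y))
    (h2 : f w2 = f (x * y⁻¹)) :
    f w1 = f w2 ∨ (f w1 ≤ f x + f y ∧ f w2 ≤ f x + f y) := by
  rw [h1, h2]
  rcases hf.2.2.2.2.1 x y with h | h
  · exact Or.inl h
  · exact Or.inr (max_le_iff.mp h)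

lemma v (hf : IsLengthFunction f) (x y : G) {w1 w2 : G} (hx : 0 < f x) (hy : 0 < f y)
    (h1 : f w1 = f (x * y)) (h2 : f w2 = f (x * y⁻¹)) :
    (f w1 = f w2 ∧ f x + f y < f w1) ∨ (f w1 = f x + f y ∧ f w2 ≤ f x + f y) ∨
      (f w2 = f x + f y ∧ f w1 ≤ f x + f y) := by
  rw [h1, h2]
  rcases hf.2.2.2.2.2.1 x y hx hy with h | h
  · exact Or.inl h
  · rcases le_total (f (x * y)) (f (x * y⁻¹)) with h' | h'
    · rw [max_eq_right h'] at h
      exact Or.inr (Or.inr ⟨h, by linarith⟩)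
    · rw [max_eq_left h'] at h
      exact Or.inr (Or.inl ⟨h, by linarith⟩)

lemma sq_s2 (hf : IsLengthFunction f) (g : G) : f (g * g) = 2 * f g := by
  have h1 : f 1 = 0 := hf.2.1
  have h0 := nn hf g
  have h2 := nn hf (g * g)
  rcases h0.eq_or_lt with h | h
  · have := iv hf g g (w1 := g * g) (w2 := 1) rfl (by simp)
    rcases this with h3 | h3 <;> linarith [h3]
  · rcases v hf g g (w1 := g * g) (w2 := 1) h h rfl (by simp) with h3 | h3 | h3 <;>
      linarith [h3.1, h3.2]

/-- growth along powers -/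
lemma powmul (hf : IsLengthFunction f) {g x : G} {c : ℝ} (hg : 0 < f g) (hc : 0 < f g + c)
    (h1 : f (g * x) = f g + c) (hx : f x < 2 * f g + c) (n : ℕ) :
    f (g ^ (n + 1) * x) = (n + 1) * f g + c := by
  have key : ∀ n : ℕ, f (g ^ (n + 1) * x) = (n + 1) * f g + c ∧
      f (g ^ n * x) < (n + 2) * f g + c := by
    intro n
    induction n with
    | zero => simp only [zero_add, pow_one, pow_zero, one_mul]; constructor <;> push_cast <;> linarith
    | succ n ih =>
      obtain ⟨ih1, ih2⟩ := ih
      have hpos : 0 < f (g ^ (n + 1) * x) := by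
        rw [ih1]
        have : 0 ≤ (n : ℝ) * f g := by positivity
        linarith
      refine ⟨?_, by rw [ih1]; push_cast; linarith⟩
      have e1 : f (g ^ (n + 1 + 1) * x) = f (g * (g ^ (n + 1) * x)) := by
        congr 1; rw [pow_succ' g (n + 1), mul_assoc]
      have e2 : f (g ^ n * x) = f (g * (g ^ (n + 1) * x)⁻¹) := by
        rw [← inv_s2 hf (g * (g ^ (n + 1) * x)⁻¹)]
        apply cj hf g⁻¹
        rw [pow_succ' g n]; group
      push_cast
      rcases v hf g (g ^ (n + 1) * x) hg hpos e1 e2 with h3 | h3 | h3 <;>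
        linarith [h3.1, h3.2]
  exact (key n).1

lemma pow (hf : IsLengthFunction f) {g : G} (hg : 0 < f g) (n : ℕ) :
    f (g ^ (n + 1)) = (n + 1) * f g := by
  have h1 : f 1 = 0 := hf.2.1
  have := powmul hf (g := g) (x := 1) (c := 0) hg (by linarith) (by simp) (by linarith) n
  simpa using this

lemma powlt (hf : IsLengthFunction f) {g x : G} (hg : 0 < f g)
    (h1 : f (g * x) < f g + f x) (n : ℕ) :
    f (g ^ (n + 1) * x) < (n + 1) * f g + f x := by
  have key : ∀ n : ℕ, f (g ^ (n + 1) * x) < (n + 1) * f g + f x ∧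
      f (g ^ n * x) < (n + 2) * f g + f x := by
    intro n
    induction n with
    | zero => simp only [zero_add, pow_one, pow_zero, one_mul]; constructor <;> push_cast <;> linarith
    | succ n ih =>
      obtain ⟨ih1, ih2⟩ := ih
      refine ⟨?_, by push_cast; linarith⟩
      have e1 : f (g ^ (n + 1 + 1) * x) = f (g * (g ^ (n + 1) * x)) := by
        congr 1; rw [pow_succ' g (n + 1), mul_assoc]
      have e2 : f (g ^ n * x) = f (g * (g ^ (n + 1) * x)⁻¹) := by
        rw [← inv_s2 hf (g * (g ^ (n + 1) * x)⁻¹)]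
        apply cj hf g⁻¹
        rw [pow_succ' g n]; group
      push_cast
      rcases iv hf g (g ^ (n + 1) * x) e1 e2 with h3 | h3
      · linarith
      · linarith [h3.1, h3.2]
  exact (key n).1

/-- both hyperbolic, coherent overlap -/
def Coh (f : G → ℝ) (g h : G) : Prop := 0 < f g ∧ 0 < f h ∧ f (g * h⁻¹) < f (g * h)

lemma Coh.sum (hf : IsLengthFunction f) {g h : G} (H : Coh f g h) : f (g * h) = f g + f h := by
  obtain ⟨hg, hh, H⟩ := H
  rcases v hf g h hg hh rfl rfl with h3 | h3 | h3 <;> linarith [h3.1, h3.2]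

lemma Coh.symm (hf : IsLengthFunction f) {g h : G} (H : Coh f g h) : Coh f h g := by
  obtain ⟨hg, hh, H⟩ := H
  refine ⟨hh, hg, ?_⟩
  have e1 : f (h * g) = f (g * h) := cj hf h (by group)
  have e2 : f (h * g⁻¹) = f (g * h⁻¹) := ci hf 1 (by group)
  rw [e1, e2]; exact H

lemma Coh.inv_inv (hf : IsLengthFunction f) {g h : G} (H : Coh f g h) : Coh f g⁻¹ h⁻¹ := by
  obtain ⟨hg, hh, H⟩ := H
  refine ⟨by rwa [inv_s2 hf], by rwa [inv_s2 hf], ?_⟩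
  have e1 : f (g⁻¹ * h⁻¹) = f (g * h) := ci hf g⁻¹ (by group)
  have e2 : f (g⁻¹ * h⁻¹⁻¹) = f (g * h⁻¹) := ci hf g⁻¹ (by group)
  rw [e1, e2]; exact H

lemma Coh.pow (hf : IsLengthFunction f) {g h : G} (H : Coh f g h) (n : ℕ) :
    Coh f (g ^ (n + 1)) h := by
  have hs := H.sum hf
  obtain ⟨hg, hh, H⟩ := H
  have h0 := LF.pow hf hg n
  have h1 := powmul hf (x := h) hg (by linarith) hs (by linarith) n
  have h2 := powlt hf (x := h⁻¹) hg (by rw [inv_s2 hf h]; linarith) n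
  rw [inv_s2 hf h] at h2
  refine ⟨by rw [h0]; positivity, hh, by linarith⟩

/-- coherent overlap makes `(gh, hg)` overlap coherently -/
lemma lem1 (hf : IsLengthFunction f) {g h : G} (H : Coh f g h) :
    f (g * h * (h * g)⁻¹) < f (g * h * (h * g)) := by
  have hs := H.sum hf
  obtain ⟨hg, hh, H⟩ := H
  have e1 : f (g * (g * h)) = 2 * f g + f h := by
    rcases v hf g (g * h) (w1 := g * (g * h)) (w2 := h) hg (by linarith) rfl
      (ci hf g⁻¹ (by group)) with h3 | h3 | h3 <;> linarith [h3.1, h3.2]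
  have e2 : f (g * h * (h * g)) = 2 * f g + 2 * f h := by
    rcases v hf (g * (g * h)) h (w1 := g * h * (h * g)) (w2 := g * g) (by linarith) hh
      (cj hf g⁻¹ (by group)) (cj hf 1 (by group)) with h3 | h3 | h3 <;>
      linarith [h3.1, h3.2, sq_s2 hf g]
  have e3 := v hf (g * h) (h * g) (w1 := g * h * (h * g)) (w2 := g * h * (h * g)⁻¹)
    (by linarith) (by rw [cj hf h (x := g * h) (by group)]; linarith) rfl rfl
  have e4 : f (h * g) = f (g * h) := cj hf h (by group)
  by_contra hcon
  have e5 : f (g * h * (h * g)⁻¹) = 2 * f g + 2 * f h := by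
    rcases e3 with h3 | h3 | h3 <;> linarith [h3.1, h3.2]
  have e6 : f (g * h * (g * h⁻¹)) = 2 * f g + 2 * f h := by
    rcases v hf g (h * g * h⁻¹) (w1 := g * h * (g * h⁻¹)) (w2 := g * h * (h * g)⁻¹) hg
      (by rw [cj hf h (x := g) (by group)]; exact hg) (cj hf 1 (by group))
      (cj hf 1 (by group)) with h3 | h3 | h3 <;>
      linarith [h3.1, h3.2, cj hf h (x := g) (y := h * g * h⁻¹) (by group)]
  rcases iv hf (g * h) (g * h⁻¹) (w1 := g * h * (g * h⁻¹)) (w2 := h * h) rfl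
    (cj hf g⁻¹ (by group)) with h3 | h3
  · linarith [sq_s2 hf h]
  · linarith [h3.1, h3.2]

/-- short opposite overlap makes `(gh, hg)` disjoint -/
lemma lem2 (hf : IsLengthFunction f) {g h : G} (hg : 0 < f g) (hh : 0 < f h)
    (h1 : |f g - f h| < f (g * h)) (h2 : f (g * h) < f g + f h) :
    f (g * h) + f (h * g) < f (g * h * (h * g)) := by
  rw [abs_lt] at h1
  have e4 : f (h * g) = f (g * h) := cj hf h (by group)
  have hp : 0 < f (g * h) := by linarith
  have e1 : f (g * (g * h)) = f g + f (g * h) := by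
    rcases v hf g (g * h) (w1 := g * (g * h)) (w2 := h) hg hp rfl
      (ci hf g⁻¹ (by group)) with h3 | h3 | h3 <;> linarith [h3.1, h3.2]
  have e2 : f (g * h * (h * g)) = f g + f h + f (g * h) := by
    rcases v hf (g * (g * h)) h (w1 := g * h * (h * g)) (w2 := g * g) (by linarith) hh
      (cj hf g⁻¹ (by group)) (cj hf 1 (by group)) with h3 | h3 | h3 <;>
      linarith [h3.1, h3.2, sq_s2 hf g]
  linarith

/-- `(g,h)` disjoint implies `(h, ghg⁻¹)` disjoint, with exact value -/
lemma lemA (hf : IsLengthFunction f) {g h : G} (h1 : f (g * h) = f (g * h⁻¹))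
    (h2 : f g + f h < f (g * h)) :
    f (h * (g * h * g⁻¹)) = 2 * f (g * h) ∧ f (h * (g * h * g⁻¹)⁻¹) = 2 * f (g * h) := by
  have hp : 0 < f (g * h) := by linarith [nn hf g, nn hf h]
  have e1 : f (h * (g * h * g⁻¹)) = 2 * f (g * h) := by
    have a1 : f (h * g) = f (g * h) := cj hf h (by group)
    have a2 : f (h * g⁻¹) = f (g * h⁻¹) := ci hf 1 (by group)
    rcases v hf (h * g) (h * g⁻¹) (w1 := h * (g * h * g⁻¹)) (w2 := g * g) (by linarith)
      (by linarith) (cj hf 1 (by group)) (cj hf h⁻¹ (by group)) with h3 | h3 | h3 <;>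
      linarith [h3.1, h3.2, sq_s2 hf g, nn hf g, nn hf h]
  refine ⟨e1, ?_⟩
  have a3 : f (g * h * g⁻¹) = f h := cj hf g rfl
  rcases iv hf h (g * h * g⁻¹) rfl rfl with h3 | h3
  · linarith
  · linarith [h3.1, nn hf g]

lemma lemB (hf : IsLengthFunction f) {g h : G} (h1 : f (g * h) = f (g * h⁻¹))
    (h2 : f g + f h < f (g * h)) :
    f (g * h * (h * g)) < f (g * h * (h * g)⁻¹) := by
  have e0 : f (g * h * (h * g)⁻¹) = 2 * f (g * h) := by
    rw [← (lemA hf h1 h2).2]; exact ci hf 1 (by group)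
  have e1 : f (g * (g * h)) ≤ f g + f (g * h) := by
    rcases iv hf g (g * h) (w1 := g * (g * h)) (w2 := h) rfl
      (ci hf g⁻¹ (by group)) with h3 | h3
    · linarith [nn hf g]
    · exact h3.1
  rcases iv hf (g * (g * h)) h (w1 := g * h * (h * g)) (w2 := g * g)
      (cj hf g⁻¹ (by group)) (cj hf 1 (by group)) with h3 | h3
  · linarith [sq_s2 hf g, nn hf h]
  · linarith [h3.1]

/-- elliptic `g` overlapping with `h` -/
lemma lemD (hf : IsLengthFunction f) {g h : G} (hg : f g = 0)
    (h1 : f (g * h) ≠ f (g * h⁻¹)) :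
    0 < f h ∧ f (h * (g * h * g⁻¹)) < 2 * f h ∧ f (h * (g * h * g⁻¹)⁻¹) = 2 * f h := by
  have a1 : f (h * g) = f (g * h) := cj hf h (by group)
  have a2 : f (h * g⁻¹) = f (g * h⁻¹) := ci hf 1 (by group)
  have a3 : f (g * h * g⁻¹) = f h := cj hf g rfl
  have b : f (g * h) ≤ f h ∧ f (g * h⁻¹) ≤ f h := by
    rcases iv hf g h rfl rfl with h3 | h3
    · exact absurd h3 h1
    · constructor <;> linarith [h3.1, h3.2]
  have hlt : f (g * h) + f (g * h⁻¹) < 2 * f h := by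
    rcases lt_or_gt_of_ne h1 with h | h <;> linarith [b.1, b.2]
  have hp : 0 < f h := by linarith [nn hf (g * h), nn hf (g * h⁻¹)]
  have e1 : f (h * (g * h * g⁻¹)) < 2 * f h := by
    rcases iv hf (h * g) (h * g⁻¹) (w1 := h * (g * h * g⁻¹)) (w2 := g * g)
      (cj hf 1 (by group)) (cj hf h⁻¹ (by group)) with h3 | h3
    · linarith [sq_s2 hf g]
    · linarith [h3.1]
  refine ⟨hp, e1, ?_⟩
  rcases v hf h (g * h * g⁻¹) hp (by linarith) rfl rfl with h3 | h3 | h3 <;>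
    linarith [h3.1, h3.2]

/-- no pair is overlapping for `f` and disjoint for `k` -/
def NoOD (f k : G → ℝ) : Prop := ∀ x y : G, f (x * y) ≠ f (x * y⁻¹) → k (x * y) ≤ k x + k y

/-- incoherent pair, hyperbolic on both sides -/
def Inc (f k : G → ℝ) (g h : G) : Prop := Coh f g h ∧ Coh k g h⁻¹

variable {k : G → ℝ}

lemma Inc.symm (hf : IsLengthFunction f) (hk : IsLengthFunction k) {g h : G}
    (H : Inc f k g h) : Inc f k h g := by
  refine ⟨H.1.symm hf, ?_⟩
  have := (H.2.symm hk).inv_inv hk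
  simpa using this

lemma Inc.pow (hf : IsLengthFunction f) (hk : IsLengthFunction k) {g h : G}
    (H : Inc f k g h) (n : ℕ) : Inc f k (g ^ (n + 1)) h :=
  ⟨H.1.pow hf n, H.2.pow hk n⟩

lemma Inc.powr (hf : IsLengthFunction f) (hk : IsLengthFunction k) {g h : G}
    (H : Inc f k g h) (n : ℕ) : Inc f k g (h ^ (n + 1)) :=
  (((H.symm hf hk).pow hf hk n)).symm hf hk

lemma Inc.flip {g h : G} (H : Inc f k g h) : Inc k f g h⁻¹ :=
  ⟨H.2, by rw [inv_inv]; exact H.1⟩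

lemma Inc.bound' (hf : IsLengthFunction f) (hk : IsLengthFunction k) (hc : NoOD f k) {g h : G}
    (H : Inc f k g h) : k (g * h) ≤ |k g - k h| := by
  by_contra hcon
  push Not at hcon
  obtain ⟨hg, hh, H2⟩ := H.2
  rw [inv_s2 hk] at hh
  have hs := H.2.sum hk
  rw [inv_s2 hk] at hs
  rw [inv_inv] at H2
  have a := lem2 hk hg hh hcon (by linarith)
  have b := hc (g * h) (h * g) (lem1 hf H.1).ne'
  linarith

lemma Inc.bound (hf : IsLengthFunction f) (hk : IsLengthFunction k) (hc : NoOD k f) {g h : G}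
    (H : Inc f k g h) : f (g * h⁻¹) ≤ |f g - f h| := by
  have := H.flip.bound' hk hf hc
  rwa [inv_s2 hf] at this

lemma Inc.exact (hf : IsLengthFunction f) (hk : IsLengthFunction k) (hc : NoOD k f) {g h : G}
    (H : Inc f k g h) (hlt : f h < f g) : f (g * h⁻¹) = f g - f h := by
  have b1 := H.bound hf hk hc
  have b2 := (H.powr hf hk 1).bound hf hk hc
  have hh : 0 < f h := H.1.2.1
  have e : f (h ^ (1 + 1)) = 2 * f h := by
    rw [LF.pow hf hh]; push_cast; ring
  rw [e] at b2
  rw [abs_of_pos (by linarith)] at b1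
  have b3 : f (g * (h ^ (1 + 1))⁻¹) < f g := lt_of_le_of_lt b2 (by rw [abs_lt]; constructor <;> linarith)
  rcases iv hf (g * h⁻¹) h (w1 := g) (w2 := g * (h ^ (1 + 1))⁻¹) (cj hf 1 (by group))
    (cj hf 1 (by group)) with h3 | h3
  · linarith
  · linarith [h3.1]

lemma big (hf : IsLengthFunction f) {g h w : G} {c : ℝ} (hc : 0 < c) (hh : 0 < f h)
    (h1 : f (g * w) = f g + c) (h2 : f (g * h) = f g + f h) (h3 : f (g * h⁻¹) = f g - f h)
    (h4 : f h < f g) (h5 : f w < f g) (h6 : f (w * h) < f g) (h7 : f (w * h⁻¹) < f g) :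
    f (g * w * g) = 2 * f g + c ∧ f (g * w * g * h) = 2 * f g + c + f h ∧
      f (g * w * g * h⁻¹) = 2 * f g + c - f h := by
  have hg : 0 < f g := by linarith
  refine ⟨?_, ?_, ?_⟩
  · rcases v hf g (g * w) (w1 := g * w * g) (w2 := w) hg (by linarith)
      (cj hf g⁻¹ (by group)) (ci hf g⁻¹ (by group)) with a | a | a <;> linarith [a.1, a.2]
  · rcases v hf (g * w) (g * h) (w1 := g * w * g * h) (w2 := w * h⁻¹) (by linarith) (by linarith)
      (cj hf 1 (by group)) (cj hf g⁻¹ (by group)) with a | a | a <;> linarith [a.1, a.2]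
  · rcases v hf (g * w) (g * h⁻¹) (w1 := g * w * g * h⁻¹) (w2 := w * h) (by linarith)
      (by linarith)
      (cj hf 1 (by group)) (cj hf g⁻¹ (by group)) with a | a | a <;> linarith [a.1, a.2]

lemma Inc.perturb (hf : IsLengthFunction f) (hk : IsLengthFunction k)
    (hc1 : NoOD f k) (hc2 : NoOD k f) {g h w : G} (H : Inc f k g h) {c d : ℝ} (hc : 0 < c)
    (hd : 0 < d) (h1 : f (g * w) = f g + c) (h1' : k (g * w) = k g + d)
    (h4 : f h < f g) (h5 : f w < f g) (h6 : f (w * h) < f g) (h7 : f (w * h⁻¹) < f g)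
    (h4' : k h < k g) (h5' : k w < k g) (h6' : k (w * h) < k g) (h7' : k (w * h⁻¹) < k g) :
    f (g * w * g) = 2 * f g + c ∧ Inc f k (g * w * g) h := by
  have hh := H.1.2.1
  have hh' := H.2.2.1
  have e1 := H.1.sum hf
  have e2 := H.exact hf hk hc2 h4
  have e1' := H.2.sum hk
  have e2' := H.flip.exact hk hf hc1 (by rwa [inv_s2 hk])
  obtain ⟨a1, a2, a3⟩ := big hf hc hh h1 e1 e2 h4 h5 h6 h7
  obtain ⟨b1, b2, b3⟩ := big hk hd hh' h1' e1' e2' (by rwa [inv_s2 hk]) h5' h7' (by rwa [inv_inv])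
  have hg2 : 0 < k g := H.2.1
  refine ⟨a1, ⟨by linarith, hh, by linarith⟩, ⟨by linarith, hh', by linarith⟩⟩

lemma Inc.core (hf : IsLengthFunction f) (hk : IsLengthFunction k)
    (hc1 : NoOD f k) (hc2 : NoOD k f) {g h w : G} (H : Inc f k g h) {c d : ℝ} (hc : 0 < c)
    (hd : 0 < d) (hw : 0 < f w)
    (h1 : f (g * w) = f g + c) (h1' : k (g * w) = k g + d)
    (h2 : f (g * w⁻¹) = f g + c) (h2' : k (g * w⁻¹) = k g + d)
    (h4 : f h < f g) (h5 : f w < f g) (h6 : f (w * h) < f g) (h7 : f (w * h⁻¹) < f g)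
    (h8 : f (w⁻¹ * h) < f g) (h9 : f (w⁻¹ * h⁻¹) < f g)
    (h4' : k h < k g) (h5' : k w < k g) (h6' : k (w * h) < k g) (h7' : k (w * h⁻¹) < k g)
    (h8' : k (w⁻¹ * h) < k g) (h9' : k (w⁻¹ * h⁻¹) < k g) : False := by
  obtain ⟨a1, a2⟩ := H.perturb hf hk hc1 hc2 hc hd h1 h1' h4 h5 h6 h7 h4' h5' h6' h7'
  obtain ⟨b1, b2⟩ := H.perturb hf hk hc1 hc2 hc hd h2 h2' h4 (by rwa [inv_s2 hf]) h8 h9 h4'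
    (by rwa [inv_s2 hk]) h8' h9'
  have hh := H.1.2.1
  have hg := H.1.1
  obtain ⟨n, hn⟩ := exists_nat_gt ((2 * f g + c) / f h)
  have hK : 2 * f g + c < f (h ^ (n + 1)) := by
    rw [LF.pow hf hh]
    rw [div_lt_iff₀ hh] at hn
    linarith
  have A := (a2.powr hf hk n).bound hf hk hc2
  have B := (b2.powr hf hk n).bound hf hk hc2
  rw [abs_of_neg (by linarith)] at A B
  have hsq : f (g ^ (1 + 1)) = 2 * f g := by
    rw [LF.pow hf hg]; push_cast; ring
  have E := (((H.pow hf hk 1).powr hf hk n).symm hf hk).exact hf hk hc2 (by linarith)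
  set x := h ^ (n + 1) with hx
  have e0 : f (g⁻¹ * x * g⁻¹) = f x - 2 * f g := by
    rw [← hsq, ← E]; exact cj hf g⁻¹ (by group)
  rcases v hf (g⁻¹ * x * g⁻¹) w (w1 := g * w⁻¹ * g * x⁻¹) (w2 := g * w * g * x⁻¹)
    (by linarith) hw (ci hf g (by group)) (ci hf g (by group)) with a | a | a <;>
    linarith [a.1, a.2]

end LF

namespace LF

variable {G : Type*} [Group G] {f : G → ℝ}

lemma disj_of (hf : IsLengthFunction f) {γ x : G} (hx : f x ≤ f γ)
    (hs : 2 * f γ < f (γ * x) + f (γ * x⁻¹)) : 2 * f γ < f (γ * (x * γ * x⁻¹)) := by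
  have hg := nn hf γ
  have hp : 0 < f (γ * x) ∧ 0 < f (γ * x⁻¹) := by
    rcases iv hf γ x rfl rfl with h | h
    · constructor <;> linarith
    · constructor <;> linarith [h.1, h.2]
  rcases v hf (γ * x) (γ * x⁻¹) (w1 := γ * (x * γ * x⁻¹)) (w2 := x * x) hp.1 hp.2
    (cj hf 1 (by group)) (cj hf γ⁻¹ (by group)) with h | h | h <;>
    linarith [h.1, h.2, sq_s2 hf x]

lemma ex_aux (hf : IsLengthFunction f) {γ p q : G} {π : ℝ} (hπ : 0 < π)
    (hp : f p = π) (hq : f q = π) (hL : 2 * π < f (p * q)) (hγ : f (p * q) ≤ f γ)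
    (h1 : f (γ * p) = f γ + π) (h2 : f (γ * p⁻¹) ≤ f γ - π)
    (h3 : f (γ * q) = f γ + π) (h4 : f (γ * q⁻¹) ≤ f γ - π) :
    ∃ x, 2 * f γ < f (γ * (x * γ * x⁻¹)) := by
  have hg : 0 < f γ := by linarith
  have eL : f (q * p) = f (p * q) := cj hf q (by group)
  have r1 := v hf (q * γ) p (w1 := γ * (p * q)) (w2 := γ * (p⁻¹ * q))
    (by rw [cj hf q (x := γ * q) (by group)]; linarith) (by linarith)
    (cj hf q⁻¹ (by group)) (cj hf q⁻¹ (by group))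
  have r1' := v hf (p * γ) q (w1 := γ * (q * p)) (w2 := γ * (q⁻¹ * p))
    (by rw [cj hf p (x := γ * p) (by group)]; linarith) (by linarith)
    (cj hf p⁻¹ (by group)) (cj hf p⁻¹ (by group))
  rw [cj hf q (x := γ * q) (y := q * γ) (by group)] at r1
  rw [cj hf p (x := γ * p) (y := p * γ) (by group)] at r1'
  have r2 := iv hf (γ * p⁻¹) q (w1 := γ * (p⁻¹ * q)) (w2 := γ * (q * p)⁻¹)
    (cj hf 1 (by group)) (cj hf 1 (by group))
  have r2' := iv hf (γ * q⁻¹) p (w1 := γ * (q⁻¹ * p)) (w2 := γ * (p * q)⁻¹)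
    (cj hf 1 (by group)) (cj hf 1 (by group))
  have r3 := v hf γ (p * q) hg (by linarith) rfl rfl
  have r3' := v hf γ (q * p) hg (by linarith) rfl rfl
  by_cases c1 : f (γ * (p * q)) < f γ + 2 * π
  · refine ⟨q * p, disj_of hf (by linarith) ?_⟩
    have e1 : f (γ * (p⁻¹ * q)) = f γ + 2 * π := by
      rcases r1 with h | h | h <;> linarith [h.1, h.2]
    have e2 : f (γ * (q * p)⁻¹) = f γ + 2 * π := by
      rcases r2 with h | h
      · linarith
      · linarith [h.1]
    rcases r3' with h | h | h <;> linarith [h.1, h.2]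
  by_cases c2 : f (γ * (q * p)) < f γ + 2 * π
  · refine ⟨p * q, disj_of hf (by linarith) ?_⟩
    have e1 : f (γ * (q⁻¹ * p)) = f γ + 2 * π := by
      rcases r1' with h | h | h <;> linarith [h.1, h.2]
    have e2 : f (γ * (p * q)⁻¹) = f γ + 2 * π := by
      rcases r2' with h | h
      · linarith
      · linarith [h.1]
    rcases r3 with h | h | h <;> linarith [h.1, h.2]
  by_cases c3 : f (γ * (p * q)) < f γ + f (p * q)
  · refine ⟨p * q, disj_of hf (by linarith) ?_⟩
    rcases r3 with h | h | h <;> linarith [h.1, h.2]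
  · refine ⟨q * p, disj_of hf (by linarith) ?_⟩
    have e1 : f (γ * (p⁻¹ * q)) = f (γ * (p * q)) := by
      rcases r1 with h | h | h <;> linarith [h.1, h.2]
    have e2 : f (γ * (q * p)⁻¹) = f (γ * (p * q)) := by
      rcases r2 with h | h
      · linarith
      · linarith [h.1]
    linarith

/-- either conjugating by `p` works, or `γ` and `p` overlap completely -/
lemma ex_step (hf : IsLengthFunction f) {γ p : G} (hp : 0 < f p) (hγ : f p ≤ f γ)
    (hn : ¬ ∃ x, 2 * f γ < f (γ * (x * γ * x⁻¹))) :
    (f (γ * p) = f γ + f p ∧ f (γ * p⁻¹) ≤ f γ - f p) ∨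
    (f (γ * p⁻¹) = f γ + f p ∧ f (γ * p) ≤ f γ - f p) := by
  have hs : f (γ * p) + f (γ * p⁻¹) ≤ 2 * f γ := by
    by_contra hcon
    exact hn ⟨p, disj_of hf hγ (by linarith)⟩
  rcases v hf γ p (by linarith) hp rfl rfl with h | h | h
  · linarith [h.1, h.2]
  · exact Or.inl ⟨h.1, by linarith [h.1]⟩
  · exact Or.inr ⟨h.1, by linarith [h.1]⟩

lemma exists_disj (hf : IsLengthFunction f) {g : G} (hg : 0 < f g) :
    ∃ n : ℕ, ∃ x : G, 2 * f (g ^ (n + 1)) < f (g ^ (n + 1) * (x * g ^ (n + 1) * x⁻¹)) := by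
  obtain ⟨s, t, hst1, hst2⟩ := hf.2.2.2.2.2.2
  have m1 := min_le_left (f s) (f t)
  have m2 := min_le_right (f s) (f t)
  have e0 : f (t⁻¹ * s) = f (s * t⁻¹) := cj hf t⁻¹ (by group)
  have hst3 : |f s - f t⁻¹| < f (s * t⁻¹) := by
    rw [inv_s2 hf, abs_lt]; constructor <;> linarith
  have hL := lem2 hf (g := s) (h := t⁻¹) (by linarith [nn hf t]) (by rw [inv_s2 hf]; linarith) hst3
    (by rw [inv_s2 hf]; linarith)
  have hπ : 0 < f (s * t⁻¹) := lt_of_le_of_lt (abs_nonneg _) hst3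
  generalize s * t⁻¹ = p at *
  generalize t⁻¹ * s = q at *
  have hL2 : f (p * q⁻¹) = f (p * q) := by
    rcases iv hf p q rfl rfl with h | h
    · exact h.symm
    · linarith [h.1]
  have hL3 : f (p⁻¹ * q) = f (p * q) := by
    rw [← hL2]; exact ci hf p⁻¹ (by group)
  have hL4 : f (p⁻¹ * q⁻¹) = f (p * q) := ci hf p⁻¹ (by group)
  obtain ⟨n, hn⟩ := exists_nat_gt (f (p * q) / f g)
  rw [div_lt_iff₀ hg] at hn
  refine ⟨n, ?_⟩
  have hγ : f (p * q) ≤ f (g ^ (n + 1)) := by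
    rw [LF.pow hf hg]; linarith
  generalize g ^ (n + 1) = γ at *
  by_contra hcon
  have ip := inv_s2 hf p
  have iq := inv_s2 hf q
  rcases ex_step hf hπ (by linarith) hcon with hp | hp <;>
  rcases ex_step hf (p := q) (by linarith) (by linarith) hcon with hq | hq
  · exact hcon (ex_aux hf hπ rfl e0 (by linarith) (by linarith) hp.1 hp.2
      (by linarith [hq.1]) (by linarith [hq.2]))
  · exact hcon (ex_aux hf hπ (p := p) (q := q⁻¹) rfl (by linarith) (by linarith) (by linarith)
      hp.1 hp.2 (by linarith [hq.1]) (by rw [inv_inv]; linarith [hq.2]))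
  · exact hcon (ex_aux hf hπ (p := p⁻¹) (q := q) ip e0 (by linarith) (by linarith)
      hp.1 (by rw [inv_inv]; linarith [hp.2]) (by linarith [hq.1]) (by linarith [hq.2]))
  · exact hcon (ex_aux hf hπ (p := p⁻¹) (q := q⁻¹) ip (by linarith) (by linarith) (by linarith)
      hp.1 (by rw [inv_inv]; linarith [hp.2]) (by linarith [hq.1])
      (by rw [inv_inv]; linarith [hq.2]))

variable {k : G → ℝ}

lemma hyp_case (hf : IsLengthFunction f) (hk : IsLengthFunction k)
    (hc1 : NoOD f k) (hc2 : NoOD k f) {g h : G} (H : Inc f k g h) : False := by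
  obtain ⟨n, x, hx⟩ := exists_disj hf H.1.1
  replace H := H.pow hf hk n
  generalize g ^ (n + 1) = γ at *
  have hγ := H.1.1
  have hγ' := H.2.1
  have w1 : f (x * γ * x⁻¹) = f γ := cj hf x rfl
  have w2 : k (x * γ * x⁻¹) = k γ := cj hk x rfl
  generalize x * γ * x⁻¹ = w at *
  have a1 : f (γ * w) = f (γ * w⁻¹) := by
    rcases iv hf γ w rfl rfl with h | h
    · exact h
    · linarith [h.1]
  have a2 : k (γ * w) = k (γ * w⁻¹) := by
    by_contra hne
    linarith [hc2 γ w hne]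
  have a3 : k γ + k w ≤ k (γ * w) := by
    rcases v hk γ w hγ' (by linarith) rfl rfl with h | h | h <;> linarith [h.1, h.2]
  obtain ⟨c, hc⟩ : ∃ c, f (γ * w) = f γ + c := ⟨f (γ * w) - f γ, by ring⟩
  obtain ⟨d, hd⟩ : ∃ d, k (γ * w) = k γ + d := ⟨k (γ * w) - k γ, by ring⟩
  have iw := inv_s2 hf w
  have iw' := inv_s2 hk w
  obtain ⟨N, hN⟩ := exists_nat_gt ((f h + f w + f (w * h) + f (w * h⁻¹) + f (w⁻¹ * h) +
    f (w⁻¹ * h⁻¹)) / f γ)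
  obtain ⟨N', hN'⟩ := exists_nat_gt ((k h + k w + k (w * h) + k (w * h⁻¹) + k (w⁻¹ * h) +
    k (w⁻¹ * h⁻¹)) / k γ)
  rw [div_lt_iff₀ hγ] at hN
  rw [div_lt_iff₀ hγ'] at hN'
  have p1 := LF.pow hf hγ (N + N')
  have p2 := LF.pow hk hγ' (N + N')
  have q1 := powmul hf (x := w) hγ (by linarith) hc (by linarith) (N + N')
  have q2 := powmul hf (x := w⁻¹) hγ (by linarith) (a1.symm.trans hc) (by linarith) (N + N')
  have q3 := powmul hk (x := w) hγ' (by linarith) hd (by linarith) (N + N')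
  have q4 := powmul hk (x := w⁻¹) hγ' (by linarith) (a2.symm.trans hd) (by linarith) (N + N')
  have HH := H.pow hf hk (N + N')
  have z1 : 0 ≤ (N' : ℝ) * f γ := by positivity
  have z2 : 0 ≤ (N : ℝ) * k γ := by positivity
  have s1 := nn hf h
  have s2 := nn hf w
  have s3 := nn hf (w * h)
  have s4 := nn hf (w * h⁻¹)
  have s5 := nn hf (w⁻¹ * h)
  have s6 := nn hf (w⁻¹ * h⁻¹)
  have t1 := nn hk h
  have t2 := nn hk w
  have t3 := nn hk (w * h)
  have t4 := nn hk (w * h⁻¹)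
  have t5 := nn hk (w⁻¹ * h)
  have t6 := nn hk (w⁻¹ * h⁻¹)
  push_cast at p1 p2 q1 q2 q3 q4
  have P1 : f h + f w + f (w * h) + f (w * h⁻¹) + f (w⁻¹ * h) +
    f (w⁻¹ * h⁻¹) < f (γ ^ (N + N' + 1)) := by rw [p1]; linarith
  have P2 : k h + k w + k (w * h) + k (w * h⁻¹) + k (w⁻¹ * h) +
    k (w⁻¹ * h⁻¹) < k (γ ^ (N + N' + 1)) := by rw [p2]; linarith
  exact HH.core hf hk hc1 hc2 (w := w) (c := c) (d := d) (by linarith) (by linarith) (by linarith)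
    (by linarith) (by linarith) (by linarith) (by linarith) (by linarith) (by linarith)
    (by linarith) (by linarith) (by linarith) (by linarith) (by linarith) (by linarith)
    (by linarith) (by linarith) (by linarith) (by linarith)

/-- elliptic case -/
lemma ell_case (hf : IsLengthFunction f) (hk : IsLengthFunction k)
    (hc1 : NoOD f k) (hc2 : NoOD k f) {g h : G} (hg : f g = 0)
    (h1 : f (g * h⁻¹) < f (g * h)) (h2 : k (g * h) < k (g * h⁻¹)) : False := by
  obtain ⟨hh, d1, d2⟩ := lemD hf hg h1.ne'
  have u1 : f (h * g) = f (g * h) := cj hf h (by group)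
  have u2 : f (h * g⁻¹) = f (g * h⁻¹) := ci hf 1 (by group)
  have u3 : f (g * h * g⁻¹) = f h := cj hf g rfl
  have u4 : k (h * g) = k (g * h) := cj hk h (by group)
  have u5 : k (h * g⁻¹) = k (g * h⁻¹) := ci hk 1 (by group)
  have u6 : k (g * h * g⁻¹) = k h := cj hk g rfl
  have n1 := nn hf (g * h⁻¹)
  have b1 : f (h * g) ≤ f h := by
    rcases iv hf g h rfl rfl with h3 | h3
    · linarith
    · linarith [h3.1]
  have b2 : f (h * g * g) ≤ f h := by
    rcases iv hf (h * g) g (w1 := h * g * g) (w2 := h) rfl (by simp) with h3 | h3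
    · linarith
    · linarith [h3.1]
  have g3 : f (g * g * g) = 0 := by
    have := sq_s2 hf g
    rcases iv hf (g * g) g (w1 := g * g * g) (w2 := g) rfl (by simp) with h3 | h3
    · linarith
    · linarith [h3.1, nn hf (g * g * g)]
  have b3 : f (h * g * (g * h * g⁻¹)) < f (h * g) + f h := by
    rcases iv hf (h * g * g) (h * g⁻¹) (w1 := h * g * (g * h * g⁻¹)) (w2 := g * g * g)
      (cj hf 1 (by group)) (cj hf h⁻¹ (by group)) with h3 | h3
    · linarith
    · linarith [h3.1]
  have ov : f (h * g * (g * h * g⁻¹)) ≠ f (h * g * (g * h * g⁻¹)⁻¹) := by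
    intro heq
    rcases v hf (h * g) (g * h * g⁻¹) (by linarith) (by linarith) rfl rfl with h3 | h3 | h3 <;>
      linarith [h3.1, h3.2]
  have no1 := hc1 _ _ ov
  have no2 : k (h * g * (g * h * g⁻¹)⁻¹) ≤ k (h * g) + k h := by
    rcases iv hk (h * g) (g * h * g⁻¹) rfl rfl with h3 | h3
    · linarith
    · linarith [h3.2]
  rw [u6] at no1
  rcases (nn hk g).eq_or_lt with ha | ha
  · have c0 : k (g * h⁻¹) ≤ k h := by
      rcases iv hk g h rfl rfl with h3 | h3
      · linarith
      · linarith [h3.2]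
    have c1 : k (h * g * g) = k h := by
      rcases iv hk (h * g) g (w1 := h * g * g) (w2 := h) rfl (by simp) with h3 | h3
      · exact h3
      · linarith [h3.2]
    have g3' : k (g * g * g) = 0 := by
      have := sq_s2 hk g
      rcases iv hk (g * g) g (w1 := g * g * g) (w2 := g) rfl (by simp) with h3 | h3
      · linarith
      · linarith [h3.1, nn hk (g * g * g)]
    have n2 := nn hk (g * h)
    rcases v hk (h * g * g) (h * g⁻¹) (w1 := h * g * (g * h * g⁻¹)) (w2 := g * g * g)
      (by linarith) (by linarith)
      (cj hk 1 (by group)) (cj hk h⁻¹ (by group)) with h3 | h3 | h3 <;> linarith [h3.1, h3.2]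
  · have u7 : k (h * g * h⁻¹) = k g := cj hk h rfl
    have Z : 0 < k (h * (g * h * g⁻¹)⁻¹) →
        k (h * g * (g * h * g⁻¹)⁻¹) = k g + k (h * (g * h * g⁻¹)⁻¹) := by
      intro hK
      rcases v hk (h * g * h⁻¹) (h * (g * h * g⁻¹)⁻¹) (w1 := h * g * (g * h * g⁻¹)⁻¹) (w2 := g)
        (by linarith) hK (cj hk 1 (by group)) ((cj hk (h * g * h⁻¹) (by group)).symm) with h3 | h3 | h3 <;>
        linarith [h3.1, h3.2]
    rcases (nn hk h).eq_or_lt with hb | hb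
    · have h2' : k (h * g) ≠ k (h * g⁻¹) := by rw [u4, u5]; exact h2.ne
      obtain ⟨_, _, D⟩ := lemD hk hb.symm h2'
      have D' : k (h * (g * h * g⁻¹)⁻¹) = 2 * k g := by
        rw [← D]; exact ci hk 1 (by group)
      have c0 : k (g * h) ≤ k g := by
        rcases iv hk g h rfl rfl with h3 | h3
        · linarith
        · linarith [h3.1]
      linarith [Z (by linarith)]
    · have c0 : k (g * h) < k g + k h := by
        rcases v hk g h ha hb rfl rfl with h3 | h3 | h3 <;> linarith [h3.1, h3.2]
      by_cases hX : k (h * (g * h * g⁻¹)⁻¹) < k (h * (g * h * g⁻¹))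
      · refine hyp_case hf hk hc1 hc2 (g := h) (h := (g * h * g⁻¹)⁻¹) ⟨⟨hh, ?_, ?_⟩, ⟨hb, ?_, ?_⟩⟩
        · rw [inv_s2 hf]; linarith
        · rw [inv_inv]; linarith
        · rw [inv_inv]; linarith
        · simpa only [inv_inv] using hX
      · have K : 2 * k h ≤ k (h * (g * h * g⁻¹)⁻¹) := by
          rcases v hk h (g * h * g⁻¹) hb (by linarith) rfl rfl with h3 | h3 | h3 <;>
            linarith [h3.1, h3.2]
        linarith [Z (by linarith)]

end LF

namespace LF

variable {G : Type*} [Group G] {f k : G → ℝ}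

lemma noOD_of (hk : IsLengthFunction k) (h : OverlapSet f ∩ DisjointSet k = ∅) :
    NoOD f k := by
  intro x y hxy
  by_contra hcon
  push Not at hcon
  have he : k (x * y) = k (x * y⁻¹) := by
    rcases iv hk x y rfl rfl with h3 | h3
    · exact h3
    · linarith [h3.1]
  have hne : x ≠ y := by
    rintro rfl
    rw [mul_inv_cancel, hk.2.1] at he
    linarith [nn hk x]
  have : (x, y) ∈ OverlapSet f ∩ DisjointSet k := ⟨⟨hne, hxy⟩, ⟨hne, he, hcon⟩⟩
  rw [h] at this
  exact this

/-- there is no incoherent pair -/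
lemma no_incoh_s2 (hf : IsLengthFunction f) (hk : IsLengthFunction k)
    (hc1 : NoOD f k) (hc2 : NoOD k f) {g h : G}
    (h1 : f (g * h⁻¹) < f (g * h)) (h2 : k (g * h) < k (g * h⁻¹)) : False := by
  have u1 : f (h * g) = f (g * h) := cj hf h (by group)
  have u2 : f (h * g⁻¹) = f (g * h⁻¹) := ci hf 1 (by group)
  have u4 : k (h * g) = k (g * h) := cj hk h (by group)
  have u5 : k (h * g⁻¹) = k (g * h⁻¹) := ci hk 1 (by group)
  have u6 : k (h⁻¹ * g) = k (g * h⁻¹) := cj hk h⁻¹ (by group)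
  have u7 : k (h⁻¹ * g⁻¹) = k (g * h) := ci hk 1 (by group)
  have u8 : f (h⁻¹ * g) = f (g * h⁻¹) := cj hf h⁻¹ (by group)
  have u9 : f (h⁻¹ * g⁻¹) = f (g * h) := ci hf 1 (by group)
  rcases (nn hf g).eq_or_lt with a | a
  · exact ell_case hf hk hc1 hc2 a.symm h1 h2
  rcases (nn hf h).eq_or_lt with b | b
  · exact ell_case hf hk hc1 hc2 (g := h) (h := g) b.symm (by linarith) (by linarith)
  rcases (nn hk g).eq_or_lt with c | c
  · exact ell_case hk hf hc2 hc1 (g := g) (h := h⁻¹) c.symm (by rwa [inv_inv]) (by rwa [inv_inv])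
  rcases (nn hk h).eq_or_lt with d | d
  · exact ell_case hk hf hc2 hc1 (g := h⁻¹) (h := g) (by rw [inv_s2 hk]; exact d.symm)
      (by linarith) (by linarith)
  exact hyp_case hf hk hc1 hc2 (g := g) (h := h)
    ⟨⟨a, b, h1⟩, ⟨c, by rwa [inv_s2 hk], by rwa [inv_inv]⟩⟩

lemma coh_of (hf : IsLengthFunction f) (hk : IsLengthFunction k)
    (hc1 : NoOD f k) (hc2 : NoOD k f) : CoherentlyOriented f k := by
  rintro ⟨g, h⟩ ⟨⟨_, h1⟩, ⟨_, h2⟩⟩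
  simp only at h1 h2 ⊢
  constructor
  · intro h3
    rcases lt_or_gt_of_ne h2 with h4 | h4
    · exact (no_incoh_s2 hf hk hc1 hc2 h3 h4).elim
    · exact h4
  · intro h3
    rcases lt_or_gt_of_ne h1 with h4 | h4
    · exact (no_incoh_s2 hk hf hc2 hc1 h3 h4).elim
    · exact h4

lemma not_od_hyp (hf : IsLengthFunction f) (hk : IsLengthFunction k)
    (hco : CoherentlyOriented f k) {g h : G} (H : Coh f g h)
    (h1 : k (g * h) = k (g * h⁻¹)) (h2 : k g + k h < k (g * h)) : False := by
  have a := lem1 hf H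
  have b := lemB hk h1 h2
  have hne : g * h ≠ h * g := by
    intro he
    rw [he, mul_inv_cancel, hk.2.1] at b
    linarith [nn hk (h * g * (h * g))]
  have := (hco (g * h, h * g) ⟨⟨hne, a.ne'⟩, ⟨hne, b.ne⟩⟩).1 a
  simp only at this
  linarith

lemma not_od_hyp2 (hf : IsLengthFunction f) (hk : IsLengthFunction k)
    (hco : CoherentlyOriented f k) {g h : G} (hg : 0 < f g) (hh : 0 < f h)
    (h0 : f (g * h) ≠ f (g * h⁻¹))
    (h1 : k (g * h) = k (g * h⁻¹)) (h2 : k g + k h < k (g * h)) : False := by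
  rcases lt_or_gt_of_ne h0 with h3 | h3
  · exact not_od_hyp hf hk hco (g := g) (h := h⁻¹) ⟨hg, by rwa [inv_s2 hf], by rwa [inv_inv]⟩
      (by rw [inv_inv]; exact h1.symm) (by rw [inv_s2 hk]; linarith)
  · exact not_od_hyp hf hk hco ⟨hg, hh, h3⟩ h1 h2

lemma not_od_ell (hf : IsLengthFunction f) (hk : IsLengthFunction k)
    (hco : CoherentlyOriented f k) {g h : G} (hg : f g = 0)
    (h0 : f (g * h) ≠ f (g * h⁻¹))
    (h1 : k (g * h) = k (g * h⁻¹)) (h2 : k g + k h < k (g * h)) : False := by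
  obtain ⟨hh, a, b⟩ := lemD hf hg h0
  obtain ⟨c, d⟩ := lemA hk h1 h2
  have u3 : f (g * h * g⁻¹) = f h := cj hf g rfl
  have u6 : k (g * h * g⁻¹) = k h := cj hk g rfl
  exact not_od_hyp2 hf hk hco hh (by linarith) (by rw [b]; exact a.ne) (by linarith)
    (by linarith [nn hk g])

lemma not_od (hf : IsLengthFunction f) (hk : IsLengthFunction k)
    (hco : CoherentlyOriented f k) {g h : G}
    (h0 : f (g * h) ≠ f (g * h⁻¹))
    (h1 : k (g * h) = k (g * h⁻¹)) (h2 : k g + k h < k (g * h)) : False := by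
  have u1 : f (h * g) = f (g * h) := cj hf h (by group)
  have u2 : f (h * g⁻¹) = f (g * h⁻¹) := ci hf 1 (by group)
  have u4 : k (h * g) = k (g * h) := cj hk h (by group)
  have u5 : k (h * g⁻¹) = k (g * h⁻¹) := ci hk 1 (by group)
  rcases (nn hf g).eq_or_lt with a | a
  · exact not_od_ell hf hk hco a.symm h0 h1 h2
  rcases (nn hf h).eq_or_lt with b | b
  · exact not_od_ell hf hk hco (g := h) (h := g) b.symm (by rwa [u1, u2]) (by linarith)
      (by linarith)
  exact not_od_hyp2 hf hk hco a b h0 h1 h2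

end LF

/-- for axiomatic length functions, compatible combinatorics is
equivalent to coherent orientation. -/
theorem compatibleCombinatorics_iff_coherentlyOriented {G : Type*} [Group G]
    (ℓ m : G → ℝ) (hℓ : IsLengthFunction ℓ) (hm : IsLengthFunction m) :
    CompatibleCombinatorics ℓ m ↔ CoherentlyOriented ℓ m := by
  constructor
  · rintro ⟨h1, h2⟩
    rw [Set.inter_comm] at h2
    exact LF.coh_of hℓ hm (LF.noOD_of hm h1) (LF.noOD_of hℓ h2)
  · intro hco
    have hco' : CoherentlyOriented m ℓ := fun p hp => (hco p ⟨hp.2, hp.1⟩).symm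
    refine ⟨?_, ?_⟩
    · rw [Set.eq_empty_iff_forall_notMem]
      rintro ⟨g, h⟩ ⟨⟨_, h0⟩, ⟨_, h1, h2⟩⟩
      exact LF.not_od hℓ hm hco h0 h1 h2
    · rw [Set.eq_empty_iff_forall_notMem]
      rintro ⟨g, h⟩ ⟨⟨_, h1, h2⟩, ⟨_, h0⟩⟩
      exact LF.not_od hm hℓ hco' h0 h1 h2
end

section
/- Let ℓ be an axiomatic length function on a group G and let (g,h) be a good pair for ℓ. Then g and h freely generate a free subgroup of rank 2 of G (the subgroup ⟨g,h⟩ is free with basis {g,h}), and moreover ℓ(w) > 0 for every nontrivial element w of ⟨g,h⟩. -/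
/-! ### Words in the theta graph

A loop based at one vertex of the theta graph (edges indexed by `Fin 3`) is a list of pairs
`(x, y)`, meaning: traverse the edge `x` and return along the edge `y`. -/

namespace Theta

/-- evaluation of a loop in a group -/
def ev {H : Type*} [Group H] (E : Fin 3 → H) (w : List (Fin 3 × Fin 3)) : H :=
  (w.map fun p => E p.1 * (E p.2)⁻¹).prod

/-- length of a loop -/
def len (L : Fin 3 → ℝ) (w : List (Fin 3 × Fin 3)) : ℝ :=
  (w.map fun p => L p.1 + L p.2).sum

/-- cyclically reduced loops -/
def CR (w : List (Fin 3 × Fin 3)) : Prop :=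
  (∀ p ∈ w, p.1 ≠ p.2) ∧ List.IsChain (fun p q => p.2 ≠ q.1) w ∧
    ∀ p ∈ w.getLast?, ∀ q ∈ w.head?, p.2 ≠ q.1

/-- the reversed loop -/
def winv (w : List (Fin 3 × Fin 3)) : List (Fin 3 × Fin 3) := (w.map Prod.swap).reverse

section
variable {H : Type*} [Group H] (E : Fin 3 → H) (L : Fin 3 → ℝ)

@[simp] lemma ev_nil : ev E [] = 1 := by simp [ev]
@[simp] lemma ev_cons (p w) : ev E (p :: w) = E p.1 * (E p.2)⁻¹ * ev E w := by simp [ev]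
@[simp] lemma ev_append (u v) : ev E (u ++ v) = ev E u * ev E v := by simp [ev]
@[simp] lemma len_nil : len L [] = 0 := by simp [len]
@[simp] lemma len_cons (p w) : len L (p :: w) = L p.1 + L p.2 + len L w := by simp [len]
@[simp] lemma len_append (u v) : len L (u ++ v) = len L u + len L v := by simp [len]
@[simp] lemma winv_nil : winv [] = [] := by simp [winv]
@[simp] lemma winv_cons (p w) : winv (p :: w) = winv w ++ [(p.2, p.1)] := by
  simp [winv, Prod.swap]
@[simp] lemma ev_winv (w) : ev E (winv w) = (ev E w)⁻¹ := by
  induction w with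
  | nil => simp
  | cons p w ih => simp [ih]
@[simp] lemma len_winv (w) : len L (winv w) = len L w := by
  induction w with
  | nil => simp
  | cons p w ih => simp [ih]; ring
@[simp] lemma length_winv (w) : (winv w).length = w.length := by simp [winv]

lemma len_nonneg (hL : ∀ i, 0 < L i) (w) : 0 ≤ len L w := by
  induction w with
  | nil => simp
  | cons p w ih => simp only [len_cons]; linarith [hL p.1, hL p.2]

lemma len_pos (hL : ∀ i, 0 < L i) (w) (hw : w ≠ []) : 0 < len L w := by
  cases w with
  | nil => exact absurd rfl hw
  | cons p w => simp only [len_cons]; linarith [hL p.1, hL p.2, len_nonneg L hL w]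

lemma reduce (hL : ∀ i, 0 < L i) (n : ℕ) : ∀ w : List (Fin 3 × Fin 3), w.length = n →
    ∃ w', CR w' ∧ w'.length ≤ w.length ∧ len L w' ≤ len L w ∧
      ∃ c, c * ev E w * c⁻¹ = ev E w' := by
  induction n using Nat.strong_induction_on with
  | _ n IH =>
  intro w hn
  have key : ∀ v : List (Fin 3 × Fin 3), v.length < w.length → len L v ≤ len L w →
      (∃ c, c * ev E w * c⁻¹ = ev E v) → ∃ w', CR w' ∧ w'.length ≤ w.length ∧
      len L w' ≤ len L w ∧ ∃ c, c * ev E w * c⁻¹ = ev E w' := by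
    rintro v hv hl ⟨c, hc⟩
    obtain ⟨w', h1, h2, h3, d, hd⟩ := IH v.length (hn ▸ hv) v rfl
    refine ⟨w', h1, by omega, by linarith, d * c, ?_⟩
    rw [← hd, ← hc]; group
  by_cases h1 : ∀ p ∈ w, p.1 ≠ p.2
  swap
  · push Not at h1
    obtain ⟨⟨x, y⟩, hp, hxy⟩ := h1
    obtain rfl : x = y := hxy
    obtain ⟨s, t, rfl⟩ := List.append_of_mem hp
    refine key (s ++ t) (by simp) ?_ ⟨1, by simp⟩
    simp; linarith [hL x]
  by_cases h2 : List.IsChain (fun p q : Fin 3 × Fin 3 => p.2 ≠ q.1) w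
  swap
  · rw [List.isChain_iff_forall_rel_of_append_cons_cons] at h2
    push Not at h2
    obtain ⟨⟨a, b⟩, ⟨b', c⟩, s, t, rfl, hb⟩ := h2
    obtain rfl : b = b' := hb
    refine key (s ++ (a, c) :: t) (by simp) ?_ ⟨1, by simp [mul_assoc]⟩
    simp; linarith [hL b]
  by_cases h3 : ∀ p ∈ w.getLast?, ∀ q ∈ w.head?, p.2 ≠ q.1
  · exact ⟨w, ⟨h1, h2, h3⟩, le_rfl, le_rfl, 1, by simp⟩
  push Not at h3
  obtain ⟨⟨a, b⟩, hp, ⟨b', c⟩, hq, hb⟩ := h3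
  obtain rfl : b = b' := hb
  cases w with
  | nil => simp at hq
  | cons q t =>
    simp at hq
    subst hq
    rcases List.eq_nil_or_concat t with rfl | ⟨m, z, rfl⟩
    · simp at hp
      exact absurd hp.2.symm (by simpa using h1)
    · have hz : z = (a, b) := by
        rw [List.concat_eq_append, ← List.cons_append, List.getLast?_append] at hp
        simpa using hp
      subst hz
      refine key ((a, c) :: m) (by simp) ?_ ⟨E a * (E b)⁻¹, ?_⟩
      · simp; linarith [hL b]
      · simp [mul_assoc]

end

lemma CR_rotate (u v) (h : CR (u ++ v)) : CR (v ++ u) := by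
  rcases eq_or_ne u [] with rfl | hu
  · simpa using h
  rcases eq_or_ne v [] with rfl | hv
  · simpa using h
  obtain ⟨h1, h2, h3⟩ := h
  rw [List.isChain_append] at h2
  refine ⟨fun p hp => h1 p (by simp at hp ⊢; tauto), ?_, ?_⟩
  · rw [List.isChain_append]
    refine ⟨h2.2.1, h2.1, fun x hx y hy => h3 x ?_ y ?_⟩
    · rw [List.getLast?_append_of_ne_nil _ hv]; exact hx
    · rw [List.head?_append_of_ne_nil _ hu]; exact hy
  · intro p hp q hq
    rw [List.getLast?_append_of_ne_nil _ hu] at hp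
    rw [List.head?_append_of_ne_nil _ hv] at hq
    exact h2.2.2 p hp q hq

lemma CR_left (u v) (h : CR (u ++ v))
    (hu : ∀ p ∈ u.getLast?, ∀ q ∈ u.head?, p.2 ≠ q.1) : CR u :=
  ⟨fun p hp => h.1 p (by simp [hp]), (List.isChain_append.1 h.2.1).1, hu⟩

section
variable {G : Type*} [Group G] (ℓ : G → ℝ)
  (E : Fin 3 → G) (L : Fin 3 → ℝ)

lemma upper (hℓ : IsLengthFunction ℓ) (hL : ∀ i, 0 < L i) (n : ℕ)
    (IH : ∀ w, w.length < n → CR w → ℓ (ev E w) = len L w)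
    (w) (hw : w.length < n) : ℓ (ev E w) ≤ len L w := by
  obtain ⟨w', h1, h2, h3, c, hc⟩ := reduce E L hL _ w rfl
  rw [← hℓ.2.2.2.1 (ev E w) c, hc, IH w' (by omega) h1]
  exact h3

lemma fin3 (p q p' q' : Fin 3) (h1 : q ≠ p) (h2 : q' ≠ p') (h3 : q ≠ p') (h4 : q' ≠ p) :
    p = p' ∨ q = q' := by
  revert p q p' q'; decide

lemma split (hℓ : IsLengthFunction ℓ) (hL : ∀ i, 0 < L i) (n : ℕ)
    (IH : ∀ w, w.length < n → CR w → ℓ (ev E w) = len L w)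
    (u v : List (Fin 3 × Fin 3)) (hn : (u ++ v).length = n) (hu : u ≠ []) (hv : v ≠ [])
    (hcu : CR u) (hcv : CR v) (h : CR (u ++ v)) :
    ℓ (ev E (u ++ v)) = len L (u ++ v) := by
  have hlu : 0 < u.length := List.length_pos_iff.2 hu
  have hlv : 0 < v.length := List.length_pos_iff.2 hv
  rw [List.length_append] at hn
  have eu := IH u (by omega) hcu
  have ev' := IH v (by omega) hcv
  have pu := len_pos L hL u hu
  have pv := len_pos L hL v hv
  have main : ℓ (ev E u * (ev E v)⁻¹) < len L u + len L v := by
    have hc1 := hcu.2.2 _ (List.getLast?_eq_getLast_of_ne_nil hu) _ (List.head?_eq_some_head hu)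
    have hc2 := hcv.2.2 _ (List.getLast?_eq_getLast_of_ne_nil hv) _ (List.head?_eq_some_head hv)
    have hc3 := (List.isChain_append.1 h.2.1).2.2 _ (List.getLast?_eq_getLast_of_ne_nil hu) _
      (List.head?_eq_some_head hv)
    have hc4 := (List.isChain_append.1 (CR_rotate _ _ h).2.1).2.2 _
      (List.getLast?_eq_getLast_of_ne_nil hv) _ (List.head?_eq_some_head hu)
    rcases fin3 _ _ _ _ hc1 hc2 hc3 hc4 with hh | hh
    · clear hc1 hc2 hc3 hc4
      obtain ⟨⟨x, a⟩, u0, rfl⟩ := List.exists_cons_of_ne_nil hu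
      obtain ⟨⟨x', b⟩, v0, rfl⟩ := List.exists_cons_of_ne_nil hv
      obtain rfl : x = x' := hh
      have := upper ℓ E L hℓ hL n IH (winv v0 ++ (b, a) :: u0) (by simp at hn ⊢; omega)
      rw [← hℓ.2.2.2.1 _ (E x * (E b)⁻¹ * ev E v0)] at this
      simp [mul_assoc] at this ⊢
      linarith [hL x]
    · rcases List.eq_nil_or_concat u with rfl | ⟨u0, ⟨a, y⟩, rfl⟩
      · exact absurd rfl hu
      rcases List.eq_nil_or_concat v with rfl | ⟨v0, ⟨b, y'⟩, rfl⟩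
      · exact absurd rfl hv
      simp at hh
      subst hh
      have := upper ℓ E L hℓ hL n IH (u0 ++ (a, b) :: winv v0) (by simp at hn ⊢; omega)
      simp [mul_assoc] at this ⊢
      linarith [hL y]
  rw [ev_append, len_append]
  rcases hℓ.2.2.2.2.2.1 (ev E u) (ev E v) (by linarith) (by linarith) with ⟨h1, h2⟩ | h1
  · linarith
  · rcases max_choice (ℓ (ev E u * ev E v)) (ℓ (ev E u * (ev E v)⁻¹)) with h2 | h2 <;> linarith

/-- splitting at two arbitrary visits of the base point -/
lemma split3 (hℓ : IsLengthFunction ℓ) (hL : ∀ i, 0 < L i) (n : ℕ)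
    (IH : ∀ w, w.length < n → CR w → ℓ (ev E w) = len L w)
    (s u t : List (Fin 3 × Fin 3)) (hn : (s ++ (u ++ t)).length = n) (hu : u ≠ [])
    (hv : t ++ s ≠ []) (h : CR (s ++ (u ++ t)))
    (h1 : ∀ p ∈ u.getLast?, ∀ q ∈ u.head?, p.2 ≠ q.1)
    (h2 : ∀ p ∈ (t ++ s).getLast?, ∀ q ∈ (t ++ s).head?, p.2 ≠ q.1) :
    ℓ (ev E (s ++ (u ++ t))) = len L (s ++ (u ++ t)) := by
  have hr := CR_rotate _ _ h
  rw [List.append_assoc] at hr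
  have := split ℓ E L hℓ hL n IH u (t ++ s) (by simp at hn ⊢; omega) hu hv
    (CR_left _ _ hr h1) (CR_left _ _ (CR_rotate _ _ hr) h2) hr
  rw [← hℓ.2.2.2.1 _ (ev E s)] at this
  simp [mul_assoc] at this ⊢
  linarith

lemma fin3four : ∀ a b c d a' b' c' d' : Fin 3, a ≠ a' → b ≠ b' → c ≠ c' → d ≠ d' →
    (a' ≠ b ∧ b' ≠ a) ∨ (a' ≠ c ∧ c' ≠ a) ∨ (a' ≠ d ∧ d' ≠ a) ∨ (b' ≠ c ∧ c' ≠ b) ∨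
    (b' ≠ d ∧ d' ≠ b) ∨ (c' ≠ d ∧ d' ≠ c) := by
  intro a b c d a' b' c' d' h1 h2 h3 h4
  omega

lemma main (hℓ : IsLengthFunction ℓ) (hL : ∀ i, 0 < L i)
    (hb : ∀ x y, x ≠ y → ℓ (E x * (E y)⁻¹) = L x + L y) (n : ℕ) :
    ∀ w, w.length = n → CR w → ℓ (ev E w) = len L w := by
  induction n using Nat.strong_induction_on with
  | _ n IH' =>
  have IH : ∀ w, w.length < n → CR w → ℓ (ev E w) = len L w := fun w hw => IH' _ hw w rfl
  clear IH'
  intro w hn h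
  have S := split3 ℓ E L hℓ hL n IH
  match w, hn, h with
  | [], hn, h => simpa using hℓ.2.1
  | [p], hn, h => simpa using hb p.1 p.2 (h.1 p (by simp))
  | [p, q], hn, h =>
    refine S [] [p] [q] hn (by simp) (by simp) h ?_ ?_
    · simpa using (h.1 p (by simp)).symm
    · simpa using (h.1 q (by simp)).symm
  | [p, q, r], hn, h =>
    have three : ∀ p q r : Fin 3 × Fin 3, [p, q, r].length = n → CR [p, q, r] →
        (r.2 ≠ q.1 ∨ p.2 ≠ r.1 ∨ q.2 ≠ p.1) → ℓ (ev E [p, q, r]) = len L [p, q, r] := by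
      intro p q r hn h hh
      have hp := (h.1 p (by simp)).symm
      have hq := (h.1 q (by simp)).symm
      have hr := (h.1 r (by simp)).symm
      rcases hh with hh | hh | hh
      · exact S [] [p] [q, r] hn (by simp) (by simp) h (by simpa using hp) (by simpa using hh)
      · exact S [p] [q] [r] hn (by simp) (by simp) h (by simpa using hq) (by simpa using hh)
      · exact S [] [p, q] [r] hn (by simp) (by simp) h (by simpa using hh) (by simpa using hr)
    by_cases hh : r.2 ≠ q.1 ∨ p.2 ≠ r.1 ∨ q.2 ≠ p.1
    · exact three p q r hn h hh
    · push Not at hh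
      obtain ⟨a, b⟩ := p
      obtain ⟨c, a'⟩ := q
      obtain ⟨b', c'⟩ := r
      simp only at hh
      obtain ⟨rfl, rfl, rfl⟩ := hh
      have hab : a' ≠ b := h.1 (a', b) (by simp)
      have hca : c' ≠ a' := h.1 (c', a') (by simp)
      have hbc : b ≠ c' := h.1 (b, c') (by simp)
      have h3 := three (a', b) (c', b) (a', c') hn
        (by simp [CR, hab, hab.symm, hca, hbc, hbc.symm, hca.symm]) (by simp [hab.symm])
      have e1 := hb a' b hab
      have e2 : ℓ (E c' * (E a')⁻¹ * (E b * (E c')⁻¹)) = L a' + L b := by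
        have := hℓ.2.2.2.1 (E b * (E a')⁻¹) (E c' * (E a')⁻¹)
        rw [hb b a' hab.symm] at this
        simp [mul_assoc] at this ⊢
        linarith
      have pa := hL a'
      have pb := hL b
      have pc := hL c'
      have V := hℓ.2.2.2.2.2.1 (E a' * (E b)⁻¹) (E c' * (E a')⁻¹ * (E b * (E c')⁻¹))
        (by linarith) (by linarith)
      rw [e1, e2] at V
      simp [mul_assoc] at V h3 ⊢
      rcases V with ⟨h1, h2⟩ | h1
      · linarith
      · have := le_max_right (ℓ (E a' * ((E b)⁻¹ * (E c' * ((E a')⁻¹ * (E b * (E c')⁻¹))))))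
          (ℓ (E a' * ((E b)⁻¹ * (E c' * ((E b)⁻¹ * (E a' * (E c')⁻¹))))))
        linarith
  | p :: q :: r :: t :: l, hn, h =>
    obtain ⟨z, hz⟩ : ∃ z, z ∈ (t :: l).getLast? :=
      ⟨_, List.getLast?_eq_getLast_of_ne_nil (by simp)⟩
    have hz1 : z.2 ≠ p.1 := h.2.2 z (by simpa using hz) p (by simp)
    have hc := h.2.1
    simp only [List.isChain_cons_cons] at hc
    obtain ⟨c1, c2, c3, -⟩ := hc
    have hz' : (t :: l).getLast? = some z := hz
    have hzq : (q :: r :: t :: l).getLast? = some z := by simpa using hz'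
    have hzr : (r :: t :: l).getLast? = some z := by simpa using hz'
    rcases fin3four _ _ _ _ _ _ _ _ hz1 c1 c2 c3 with ⟨h1, h2⟩ | ⟨h1, h2⟩ | ⟨h1, h2⟩ | ⟨h1, h2⟩ |
      ⟨h1, h2⟩ | ⟨h1, h2⟩
    · refine S [] [p] (q :: r :: t :: l) hn (by simp) (by simp) h ?_ ?_
      · simpa using h1.symm
      · rw [List.append_nil, hzq]; simpa using h2.symm
    · refine S [] [p, q] (r :: t :: l) hn (by simp) (by simp) h ?_ ?_
      · simpa using h1.symm
      · rw [List.append_nil, hzr]; simpa using h2.symm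
    · refine S [] [p, q, r] (t :: l) hn (by simp) (by simp) h ?_ ?_
      · simpa using h1.symm
      · rw [List.append_nil, hz']; simpa using h2.symm
    · refine S [p] [q] (r :: t :: l) hn (by simp) (by simp) h ?_ ?_
      · simpa using h1.symm
      · rw [List.getLast?_append_of_ne_nil _ (by simp)]; simpa using h2.symm
    · refine S [p] [q, r] (t :: l) hn (by simp) (by simp) h ?_ ?_
      · simpa using h1.symm
      · rw [List.getLast?_append_of_ne_nil _ (by simp)]; simpa using h2.symm
    · refine S [p, q] [r] (t :: l) hn (by simp) (by simp) h ?_ ?_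
      · simpa using h1.symm
      · rw [List.getLast?_append_of_ne_nil _ (by simp)]; simpa using h2.symm

end

end Theta


/-- a good pair for an axiomatic length function freely generates a
free subgroup of rank 2, on which `ℓ` is positive away from the identity. -/
theorem goodPair_free {G : Type*} [Group G] (ℓ : G → ℝ)
    (hℓ : IsLengthFunction ℓ) (g h : G) (hgp : GoodPair ℓ g h) :
    Function.Injective
      (FreeGroup.lift (fun b : Bool => if b then g else h) : FreeGroup Bool →* G) ∧
    ∀ w ∈ Subgroup.closure ({g, h} : Set G), w ≠ 1 → 0 < ℓ w := by
  obtain ⟨hg1, hg2⟩ := hgp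
  have hm1 := min_le_left (ℓ g) (ℓ h)
  have hm2 := min_le_right (ℓ g) (ℓ h)
  let E : Fin 3 → G := ![g, h, 1]
  let L : Fin 3 → ℝ := ![(ℓ g - ℓ h + ℓ (g * h⁻¹)) / 2, (ℓ h - ℓ g + ℓ (g * h⁻¹)) / 2,
    (ℓ g + ℓ h - ℓ (g * h⁻¹)) / 2]
  have hL : ∀ i, 0 < L i := by
    intro i
    fin_cases i <;> simp [L] <;> linarith
  have hinv : ℓ (h * g⁻¹) = ℓ (g * h⁻¹) := by
    rw [hℓ.2.2.1 (g * h⁻¹)]; simp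
  have hb : ∀ x y, x ≠ y → ℓ (E x * (E y)⁻¹) = L x + L y := by
    intro x y hxy
    have i1 := hℓ.2.2.1 g
    have i2 := hℓ.2.2.1 h
    fin_cases x <;> fin_cases y <;> simp [E, L] at hxy ⊢ <;> linarith
  have pos : ∀ w, Theta.CR w → w ≠ [] → 0 < ℓ (Theta.ev E w) := by
    intro w hw hne
    rw [Theta.main ℓ E L hℓ hL hb _ w rfl hw]
    exact Theta.len_pos L hL w hne
  constructor
  · rw [injective_iff_map_eq_one]
    intro x hx
    let F : Fin 3 → FreeGroup Bool := ![FreeGroup.of true, FreeGroup.of false, 1]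
    have hw : ∃ w, Theta.ev F w = x := by
      clear hx
      induction x using FreeGroup.induction_on with
      | C1 => exact ⟨[], by simp⟩
      | of b => cases b
                · exact ⟨[(1, 2)], by simp [F]⟩
                · exact ⟨[(0, 2)], by simp [F]⟩
      | inv_of b _ => cases b
                      · exact ⟨[(2, 1)], by simp [F]⟩
                      · exact ⟨[(2, 0)], by simp [F]⟩
      | mul x y hx hy =>
        obtain ⟨u, rfl⟩ := hx
        obtain ⟨v, rfl⟩ := hy
        exact ⟨u ++ v, by simp⟩
    have hev : ∀ w, FreeGroup.lift (fun b : Bool => if b then g else h) (Theta.ev F w)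
        = Theta.ev E w := by
      intro w
      have hFE : ∀ i, FreeGroup.lift (fun b : Bool => if b then g else h) (F i) = E i := by
        intro i; fin_cases i <;> simp [F, E]
      induction w with
      | nil => simp
      | cons p w ih => simp [ih, hFE]
    obtain ⟨w, rfl⟩ := hw
    obtain ⟨w', h1, -, -, c, hc⟩ := Theta.reduce F L hL _ w rfl
    rcases eq_or_ne w' [] with rfl | hne
    · simpa using hc
    · have := pos w' h1 hne
      rw [← hev, ← hc, map_mul, map_mul, hx] at this
      simp [hℓ.2.1] at this
  · intro x hx hx1
    have hw : ∃ w, Theta.ev E w = x := by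
      clear hx1
      induction hx using Subgroup.closure_induction with
      | mem y hy =>
        rcases hy with rfl | rfl
        · exact ⟨[(0, 2)], by simp [E]⟩
        · exact ⟨[(1, 2)], by simp [E]⟩
      | one => exact ⟨[], by simp⟩
      | mul y z _ _ hy hz =>
        obtain ⟨u, rfl⟩ := hy
        obtain ⟨v, rfl⟩ := hz
        exact ⟨u ++ v, by simp⟩
      | inv y _ hy =>
        obtain ⟨u, rfl⟩ := hy
        exact ⟨Theta.winv u, by simp⟩
    obtain ⟨w, rfl⟩ := hw
    obtain ⟨w', h1, -, -, c, hc⟩ := Theta.reduce E L hL _ w rfl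
    rcases eq_or_ne w' [] with rfl | hne
    · exact absurd (by simpa using hc) hx1
    · have := pos w' h1 hne
      rwa [← hc, hℓ.2.2.2.1] at this
end

section
/- Let G be a group and let A and B be G-trees whose translation length functions ℓ = ℓ_A and m = ℓ_B have compatible combinatorics. Let f, g, h ∈ G be elements that are hyperbolic in both A and B and such that, for T = A and for T = B, the triple intersection C_f^T ∩ C_g^T ∩ C_h^T is a single point ∗^T. Then for every y ∈ G there exists x ∈ {f, g, h} such that, for both T = A and T = B, the segment [∗^T, ∗^T·y] intersects C_x^T in exactly one point. -/
/-- A real tree: a nonempty complete geodesic 0-hyperbolic metric space. -/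
def IsRealTree (T : Type*) [MetricSpace T] : Prop :=
  Nonempty T ∧ CompleteSpace T ∧
  (∀ x y : T, ∃ f : ℝ → T, f 0 = x ∧ f (dist x y) = y ∧
    ∀ s ∈ Set.Icc (0 : ℝ) (dist x y), ∀ t ∈ Set.Icc (0 : ℝ) (dist x y),
      dist (f s) (f t) = |s - t|) ∧
  (∀ x y z w : T, dist x y + dist z w ≤
    max (dist x z + dist y w) (dist x w + dist y z))

/-- `σ : T → G → T` is a right action of `G` on `T` by isometries. -/
def IsIsomRightAction {G : Type*} [Group G] {T : Type*} [MetricSpace T]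
    (σ : T → G → T) : Prop :=
  (∀ p : T, σ p 1 = p) ∧
  (∀ (p : T) (g h : G), σ p (g * h) = σ (σ p g) h) ∧
  (∀ g : G, Isometry (fun p : T => σ p g))

/-- The translation length function of the action `σ`: `ℓ(g) = inf_p d(p, p·g)`. -/
noncomputable def transLen {G : Type*} [Group G] {T : Type*} [MetricSpace T]
    (σ : T → G → T) (g : G) : ℝ :=
  ⨅ p : T, dist p (σ p g)

/-- The characteristic set `C_g = {p : d(p, p·g) = ℓ(g)}` of `g`. -/
def charSet {G : Type*} [Group G] {T : Type*} [MetricSpace T]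
    (σ : T → G → T) (g : G) : Set T :=
  {p : T | dist p (σ p g) = transLen σ g}

/-- The segment `[p,q] = {z : d(p,z) + d(z,q) = d(p,q)}`. -/
def treeSegment {T : Type*} [MetricSpace T] (p q : T) : Set T :=
  {z : T | dist p z + dist z q = dist p q}

namespace SegAxis

/-- Based length function axioms. -/
structure LenFn {G : Type*} [Group G] (L : G → ℝ) : Prop where
  one : L 1 = 0
  inv : ∀ u, L u⁻¹ = L u
  hyp : ∀ u v w, L (u * v⁻¹) + L w ≤ max (L (u * w⁻¹) + L v) (L (v * w⁻¹) + L u)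

/-- `u` and `v` leave the base point in the same direction. -/
def S {G : Type*} [Group G] (L : G → ℝ) (u v : G) : Prop := L (u * v⁻¹) < L u + L v

/-- `u` leaves the base point along the axis of `x`. -/
def K {G : Type*} [Group G] (L : G → ℝ) (u x : G) : Prop := S L u x ∨ S L u x⁻¹

section abstract_part
variable {G : Type*} [Group G] {L : G → ℝ}

lemma LenFn.nonneg (H : LenFn L) (u : G) : 0 ≤ L u := by
  have := H.hyp u u 1
  simp [H.one] at this
  exact this

lemma LenFn.comm (H : LenFn L) (u v : G) : L (u * v⁻¹) = L (v * u⁻¹) := by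
  rw [← H.inv]; simp

lemma LenFn.symm (H : LenFn L) {u v : G} (h : S L u v) : S L v u := by
  unfold S at *
  rw [H.comm]; linarith

lemma LenFn.trans (H : LenFn L) {u v w : G} (h : S L u v) (h' : S L v w) : S L u w := by
  unfold S at *
  have := H.hyp u w v
  rw [H.comm] at h'
  rcases le_max_iff.1 this with h1 | h1 <;> linarith

lemma LenFn.le_add (H : LenFn L) (u v : G) : L (u * v) ≤ L u + L v := by
  have := H.hyp u v⁻¹ 1
  simp only [inv_inv, inv_one, mul_one, H.inv, H.one] at this
  rcases le_max_iff.1 this with h1 | h1 <;> linarith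

lemma LenFn.pos (H : LenFn L) {u v : G} (h : S L u v) : 0 < L u := by
  unfold S at h
  have h1 := H.le_add (v * u⁻¹) u
  rw [← H.comm] at h1
  simp at h1
  linarith

lemma S_self (H : LenFn L) {u : G} (h : 0 < L u) : S L u u := by
  unfold S
  simp [H.one]; exact h

lemma LenFn.concat_len (H : LenFn L) {a b : G} (h : ¬ S L a⁻¹ b) : L (b * a) = L a + L b := by
  unfold S at h
  have h1 := H.inv (b * a)
  have h2 := H.le_add b a
  have h3 := H.inv a
  simp only [mul_inv_rev] at h1
  linarith

lemma LenFn.concat_left (H : LenFn L) {a b : G} (h : ¬ S L a⁻¹ b) (ha : 0 < L a) :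
    S L a (b * a) := by
  unfold S
  rw [H.concat_len h]
  simp [H.inv]; linarith

lemma LenFn.concat_right (H : LenFn L) {a b : G} (h : ¬ S L a⁻¹ b) (hb : 0 < L b) :
    S L (b * a)⁻¹ b⁻¹ := by
  unfold S
  rw [H.inv, H.concat_len h]
  simp [H.inv]; linarith

/-- A triple of hyperbolic elements with axes meeting exactly in the base point. -/
structure Trip (L : G → ℝ) (f g h : G) : Prop where
  nf : ¬ S L f f⁻¹
  ng : ¬ S L g g⁻¹
  nh : ¬ S L h h⁻¹
  pf : 0 < L f
  pg : 0 < L g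
  ph : 0 < L h
  tr : ∀ u, ¬ (K L u f ∧ K L u g ∧ K L u h)

lemma K_inv {u x : G} : K L u x⁻¹ ↔ K L u x := by
  unfold K; rw [inv_inv, or_comm]

lemma ninv (H : LenFn L) {x : G} (h : ¬ S L x x⁻¹) : ¬ S L x⁻¹ x⁻¹⁻¹ := by
  rw [inv_inv]; exact fun k => h (H.symm k)

lemma Trip.invf (H : LenFn L) {f g h : G} (t : Trip L f g h) : Trip L f⁻¹ g h :=
  ⟨ninv H t.nf, t.ng, t.nh, by rw [H.inv]; exact t.pf, t.pg, t.ph, by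
    intro u; rw [K_inv]; exact t.tr u⟩

lemma Trip.rot {f g h : G} (t : Trip L f g h) : Trip L g h f :=
  ⟨t.ng, t.nh, t.nf, t.pg, t.ph, t.pf, fun u k => t.tr u ⟨k.2.2, k.1, k.2.1⟩⟩

lemma Trip.swap {f g h : G} (t : Trip L f g h) : Trip L f h g :=
  ⟨t.nf, t.nh, t.ng, t.pf, t.ph, t.pg, fun u k => t.tr u ⟨k.1, k.2.2, k.2.1⟩⟩

lemma Trip.invg (H : LenFn L) {f g h : G} (t : Trip L f g h) : Trip L f g⁻¹ h :=
  (t.rot.invf H).rot.rot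

variable {M : G → ℝ}

/-- Words starting like `y` and ending with the letter `b`. -/
def P (L M : G → ℝ) (y b : G) : Prop :=
  ∃ v, S L y v ∧ S L v⁻¹ b⁻¹ ∧ S M y v ∧ S M v⁻¹ b⁻¹

lemma P_step (HL : LenFn L) (HM : LenFn M) {y a b : G} (hP : P L M y a)
    (hbL : 0 < L b) (hbM : 0 < M b)
    (h1 : ¬ S L a⁻¹ b) (h2 : ¬ S M a⁻¹ b) : P L M y b := by
  obtain ⟨v, v1, v2, v3, v4⟩ := hP
  have k1 : ¬ S L v⁻¹ b := fun k => h1 (HL.trans (HL.symm v2) k)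
  have k2 : ¬ S M v⁻¹ b := fun k => h2 (HM.trans (HM.symm v4) k)
  exact ⟨b * v, HL.trans v1 (HL.concat_left k1 (HL.pos (HL.symm v1))),
    HL.concat_right k1 hbL, HM.trans v3 (HM.concat_left k2 (HM.pos (HM.symm v3))),
    HM.concat_right k2 hbM⟩

lemma P_start (HL : LenFn L) (HM : LenFn M) {y b : G} (hL : 0 < L y) (hM : 0 < M y)
    (hbL : 0 < L b) (hbM : 0 < M b)
    (h1 : ¬ S L y⁻¹ b) (h2 : ¬ S M y⁻¹ b) : P L M y b :=
  P_step HL HM (a := y) ⟨y, S_self HL hL, S_self HL (by rwa [HL.inv]), S_self HM hM,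
    S_self HM (by rwa [HM.inv])⟩ hbL hbM h1 h2

lemma Trip.no {f g h : G} (t : Trip L f g h) {u : G} (h1 : K L u f) (h2 : K L u g) : ¬ K L u h :=
  fun k => t.tr u ⟨h1, h2, k⟩

lemma P_swap {y b : G} (h : P L M y b) : P M L y b := by
  obtain ⟨v, v1, v2, v3, v4⟩ := h
  exact ⟨v, v3, v4, v1, v2⟩

/-- if neither direction of `g` shares the germ `f⁻¹`, turn around through `g`. -/
lemma turn_easy (HL : LenFn L) (HM : LenFn M) {y f g h : G}
    (tL : Trip L f g h) (tM : Trip M f g h)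
    (hP : P L M y f) (h1 : ¬ K L f⁻¹ g) (h2 : ¬ K M f⁻¹ g) : P L M y f⁻¹ := by
  have hg : P L M y g := P_step HL HM hP tL.pg tM.pg (fun k => h1 (Or.inl k)) (fun k => h2 (Or.inl k))
  exact P_step HL HM hg (by rw [HL.inv]; exact tL.pf) (by rw [HM.inv]; exact tM.pf)
    (fun k => h1 (Or.inr (HL.symm k))) (fun k => h2 (Or.inr (HM.symm k)))

lemma turn_hard1 (HL : LenFn L) (HM : LenFn M) {y f g h : G}
    (tL : Trip L f g h) (tM : Trip M f g h)
    (hP : P L M y f) (h1 : S L f⁻¹ g⁻¹) (h2 : S M f⁻¹ h⁻¹) : P L M y f⁻¹ := by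
  have nLh : ¬ K L f⁻¹ h := fun k => tL.tr f⁻¹
    ⟨Or.inr (S_self HL (by rw [HL.inv]; exact tL.pf)), Or.inr h1, k⟩
  have nMg : ¬ K M f⁻¹ g := fun k => tM.tr f⁻¹
    ⟨Or.inr (S_self HM (by rw [HM.inv]; exact tM.pf)), k, Or.inr h2⟩
  have hg : P L M y g := P_step HL HM hP tL.pg tM.pg
    (fun k => tL.ng (HL.trans (HL.symm k) h1)) (fun k => nMg (Or.inl k))
  have hh : P L M y h⁻¹ := P_step HL HM hg (by rw [HL.inv]; exact tL.ph)
    (by rw [HM.inv]; exact tM.ph)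
    (fun k => nLh (Or.inr (HL.trans h1 k)))
    (fun k => nMg (Or.inr (HM.trans h2 (HM.symm k))))
  exact P_step HL HM hh (by rw [HL.inv]; exact tL.pf) (by rw [HM.inv]; exact tM.pf)
    (fun k => nLh (Or.inl (by rw [inv_inv] at k; exact HL.symm k)))
    (fun k => tM.nh (by rw [inv_inv] at k; exact HM.trans k h2))

lemma turn_hard (HL : LenFn L) (HM : LenFn M) {y f g h : G}
    (tL : Trip L f g h) (tM : Trip M f g h)
    (hP : P L M y f) (h1 : K L f⁻¹ g) (h2 : K M f⁻¹ h) : P L M y f⁻¹ := by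
  have aux : ∀ g h : G, Trip L f g h → Trip M f g h → S L f⁻¹ g⁻¹ → K M f⁻¹ h → P L M y f⁻¹ := by
    intro g h tL tM h1 h2
    rcases h2 with h2 | h2
    · exact turn_hard1 HL HM (tL.swap.invg HL).swap (tM.swap.invg HM).swap hP h1
        (by rwa [inv_inv])
    · exact turn_hard1 HL HM tL tM hP h1 h2
  rcases h1 with h1 | h1
  · exact aux g⁻¹ h (tL.invg HL) (tM.invg HM) (by rwa [inv_inv]) h2
  · exact aux g h tL tM h1 h2

lemma turn (HL : LenFn L) (HM : LenFn M) {y f g h : G}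
    (tL : Trip L f g h) (tM : Trip M f g h) (hP : P L M y f) : P L M y f⁻¹ := by
  have nL := tL.tr f⁻¹
  have nM := tM.tr f⁻¹
  have kL : K L f⁻¹ f := Or.inr (S_self HL (by rw [HL.inv]; exact tL.pf))
  have kM : K M f⁻¹ f := Or.inr (S_self HM (by rw [HM.inv]; exact tM.pf))
  by_cases a : K L f⁻¹ g
  · by_cases b : K M f⁻¹ h
    · exact turn_hard HL HM tL tM hP a b
    · exact turn_easy HL HM tL.swap tM.swap hP (fun k => nL ⟨kL, a, k⟩) b
  · by_cases b : K M f⁻¹ g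
    · by_cases c : K L f⁻¹ h
      · exact turn_hard HL HM tL.swap tM.swap hP c b
      · exact turn_easy HL HM tL.swap tM.swap hP c (fun k => nM ⟨kM, b, k⟩)
    · exact turn_easy HL HM tL tM hP a b

/-- going from `g` to `f⁻¹` when blocked in `L` for `f⁻¹` and in `M` for `f`. -/
lemma cross_hard (HL : LenFn L) (HM : LenFn M) {y f g h : G}
    (tL : Trip L f g h) (tM : Trip M f g h)
    (hP : P L M y g) (h1 : S L g⁻¹ f⁻¹) (h2 : S M g⁻¹ f) : P L M y f⁻¹ := by
  have aux : ∀ h : G, Trip L f g h → Trip M f g h → ¬ S M h⁻¹ f⁻¹ → P L M y f⁻¹ := by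
    intro h tL tM h3
    have kL : K L g⁻¹ g := Or.inr (S_self HL (by rw [HL.inv]; exact tL.pg))
    have kM : K M g⁻¹ g := Or.inr (S_self HM (by rw [HM.inv]; exact tM.pg))
    have nL : ¬ K L g⁻¹ h := fun k => tL.tr _ ⟨Or.inr h1, kL, k⟩
    have nM : ¬ K M g⁻¹ h := fun k => tM.tr _ ⟨Or.inl h2, kM, k⟩
    have hh : P L M y h := P_step HL HM hP tL.ph tM.ph
      (fun k => nL (Or.inl k)) (fun k => nM (Or.inl k))
    exact P_step HL HM hh (by rw [HL.inv]; exact tL.pf) (by rw [HM.inv]; exact tM.pf)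
      (fun k => nL (Or.inr (HL.trans h1 (HL.symm k)))) h3
  by_cases h3 : S M h⁻¹ f⁻¹
  · exact aux h⁻¹ (tL.swap.invg HL).swap (tM.swap.invg HM).swap
      (fun k => tM.nh (by rw [inv_inv] at k; exact HM.trans k (HM.symm h3)))
  · exact aux h tL tM h3

lemma cross (HL : LenFn L) (HM : LenFn M) {y f g h : G}
    (tL : Trip L f g h) (tM : Trip M f g h)
    (hP : P L M y g) : P L M y f⁻¹ := by
  by_cases a : ¬ S L g⁻¹ f⁻¹ ∧ ¬ S M g⁻¹ f⁻¹
  · exact P_step HL HM hP (by rw [HL.inv]; exact tL.pf) (by rw [HM.inv]; exact tM.pf) a.1 a.2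
  by_cases b : ¬ S L g⁻¹ f ∧ ¬ S M g⁻¹ f
  · exact turn HL HM tL tM (P_step HL HM hP tL.pf tM.pf b.1 b.2)
  have nL : ¬ (S L g⁻¹ f⁻¹ ∧ S L g⁻¹ f) := fun k => tL.nf (HL.trans (HL.symm k.2) k.1)
  have nM : ¬ (S M g⁻¹ f⁻¹ ∧ S M g⁻¹ f) := fun k => tM.nf (HM.trans (HM.symm k.2) k.1)
  by_cases c : S L g⁻¹ f⁻¹
  · exact cross_hard HL HM tL tM hP c (by tauto)
  · exact P_swap (cross_hard HM HL tM tL (P_swap hP) (by tauto) (by tauto))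

lemma reach (HL : LenFn L) (HM : LenFn M) {y f g h : G}
    (tL : Trip L f g h) (tM : Trip M f g h) (hL : 0 < L y) (hM : 0 < M y) :
    P L M y f⁻¹ := by
  have st : ∀ x : G, ¬ K L y⁻¹ x → 0 < L x → 0 < M x → ¬ S M x x⁻¹ →
      P L M y x ∨ P L M y x⁻¹ := by
    intro x hx h1 h2 h3
    by_cases k : S M y⁻¹ x
    · right
      exact P_start HL HM hL hM (by rwa [HL.inv]) (by rwa [HM.inv]) (fun k => hx (Or.inr k))
        (fun k' => h3 (HM.trans (HM.symm k) k'))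
    · left
      exact P_start HL HM hL hM h1 h2 (fun k => hx (Or.inl k)) k
  by_cases a : K L y⁻¹ f
  · by_cases b : K L y⁻¹ g
    · have c : ¬ K L y⁻¹ h := fun c => tL.tr _ ⟨a, b, c⟩
      rcases st h c tL.ph tM.ph tM.nh with k | k
      · exact cross HL HM tL.swap tM.swap k
      · exact cross HL HM (tL.swap.invg HL) (tM.swap.invg HM) k
    · rcases st g b tL.pg tM.pg tM.ng with k | k
      · exact cross HL HM tL tM k
      · exact cross HL HM (tL.invg HL) (tM.invg HM) k
  · rcases st f a tL.pf tM.pf tM.nf with k | k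
    · exact turn HL HM tL tM k
    · exact k

end abstract_part

section tree_part
variable {G : Type*} [Group G] {T : Type*} [MetricSpace T] {σ : T → G → T}

/-- The based length function. -/
noncomputable def len (σ : T → G → T) (p : T) (u : G) : ℝ := dist p (σ p u)

lemma dist_act (hσ : IsIsomRightAction σ) (p q : T) (g : G) : dist (σ p g) (σ q g) = dist p q :=
  (hσ.2.2 g).dist_eq p q

lemma dist_orb (hσ : IsIsomRightAction σ) (p q : T) (u v : G) :
    dist (σ p u) (σ q v) = dist (σ p (u * v⁻¹)) q := by
  rw [← dist_act hσ _ q v, ← hσ.2.1]; simp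

lemma lenFn (hT : IsRealTree T) (hσ : IsIsomRightAction σ) (p : T) : LenFn (len σ p) := by
  refine ⟨by simp [len, hσ.1], fun u => ?_, fun u v w => ?_⟩
  · have := dist_orb hσ p p 1 u
    rw [hσ.1, one_mul] at this
    unfold len
    rw [this, dist_comm]
  · have := hT.2.2.2 (σ p u) (σ p v) (σ p w) p
    rw [dist_orb hσ p p u v, dist_orb hσ p p u w, dist_orb hσ p p v w] at this
    unfold len
    simp only [dist_comm p]
    rw [add_comm (dist (σ p (v * w⁻¹)) p)]
    exact this

lemma transLen_le (p : T) (u : G) : transLen σ u ≤ dist p (σ p u) :=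
  ciInf_le ⟨0, by rintro _ ⟨q, rfl⟩; exact dist_nonneg⟩ p

lemma le_transLen (hT : IsRealTree T) (hσ : IsIsomRightAction σ) (p : T) (u : G) :
    len σ p (u * u) - len σ p u ≤ transLen σ u := by
  haveI := hT.1
  refine le_ciInf fun q => ?_
  have h1 := hT.2.2.2 p (σ p (u * u)) (σ q u) (σ p u)
  have e1 := dist_act hσ q p u
  have e2 : dist (σ p (u * u)) (σ p u) = dist p (σ p u) := by
    rw [hσ.2.1, dist_act hσ, dist_comm]
  have e3 : dist (σ p (u * u)) (σ q u) = dist (σ p u) q := by rw [hσ.2.1, dist_act hσ]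
  have t1 := dist_triangle p q (σ q u)
  have t2 := dist_triangle (σ p u) (σ q u) q
  have e4 := dist_act hσ p q u
  have e5 := dist_comm p q
  have e6 := dist_comm q (σ q u)
  unfold len
  rcases le_max_iff.1 h1 with h | h <;> linarith

/-- point at given distance on a segment. -/
lemma exists_pt (hT : IsRealTree T) (x y : T) (c : ℝ) (h0 : 0 ≤ c) (h1 : c ≤ dist x y) :
    ∃ q, dist x q = c ∧ dist q y = dist x y - c := by
  obtain ⟨φ, a, b, hφ⟩ := hT.2.2.1 x y
  refine ⟨φ c, ?_, ?_⟩
  · have := hφ 0 ⟨le_rfl, dist_nonneg⟩ c ⟨h0, h1⟩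
    rw [a] at this
    rw [this, zero_sub, abs_neg, abs_of_nonneg h0]
  · have := hφ c ⟨h0, h1⟩ (dist x y) ⟨dist_nonneg, le_rfl⟩
    rw [b] at this
    rw [this, abs_sub_comm, abs_of_nonneg (by linarith)]

lemma transLen_lt (hT : IsRealTree T) (hσ : IsIsomRightAction σ) (p : T) (v : G)
    (h : S (len σ p) v v⁻¹) : transLen σ v < len σ p v := by
  have H := lenFn hT hσ p
  have hpos := H.pos h
  unfold S at h
  rw [inv_inv, H.inv] at h
  obtain ⟨c, c0, c1, c2⟩ : ∃ c, 0 < c ∧ c < len σ p v ∧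
      2 * c ≤ len σ p v + len σ p v - len σ p (v * v) := by
    refine ⟨min (len σ p v / 2) ((len σ p v + len σ p v - len σ p (v * v)) / 2), ?_, ?_, ?_⟩
    · apply lt_min <;> linarith
    · exact lt_of_le_of_lt (min_le_left _ _) (by linarith)
    · have := min_le_right (len σ p v / 2) ((len σ p v + len σ p v - len σ p (v * v)) / 2)
      linarith
  obtain ⟨q, q1, q2⟩ := exists_pt hT p (σ p v) c c0.le c1.le
  refine lt_of_le_of_lt (transLen_le q v) ?_
  have i1 := hT.2.2.2 q (σ p v⁻¹) p (σ p v)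
  have i2 := hT.2.2.2 q (σ q v) p (σ p v)
  have e1 : dist (σ p v⁻¹) (σ p v) = len σ p (v * v) := by
    rw [dist_comm, dist_orb hσ, inv_inv, dist_comm]; rfl
  have e2 : dist (σ p v⁻¹) p = len σ p v := by
    rw [dist_comm]; exact H.inv v
  have e3 : dist (σ q v) p = dist q (σ p v⁻¹) := by
    have := dist_orb hσ q p 1 v⁻¹
    simpa [hσ.1] using this.symm
  have e4 := dist_act hσ q p v
  have e5 := dist_comm p q
  have e6 : dist p (σ p v) = len σ p v := rfl
  have k : dist q (σ p v⁻¹) ≤ len σ p v - c := by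
    rcases le_max_iff.1 i1 with h | h <;> linarith
  rcases le_max_iff.1 i2 with h | h <;> linarith

lemma not_S_of_mem (hT : IsRealTree T) (hσ : IsIsomRightAction σ) {p : T} {x : G}
    (h : p ∈ charSet σ x) : ¬ S (len σ p) x x⁻¹ := by
  intro k
  have := transLen_lt hT hσ p x k
  have h' : len σ p x = transLen σ x := h
  linarith

lemma transLen_inv (hT : IsRealTree T) (hσ : IsIsomRightAction σ) (x : G) :
    transLen σ x⁻¹ = transLen σ x := by
  unfold transLen
  exact congrArg iInf (funext fun p => (lenFn hT hσ p).inv x)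

lemma charSet_inv (hT : IsRealTree T) (hσ : IsIsomRightAction σ) (x : G) :
    charSet σ x⁻¹ = charSet σ x := by
  ext p
  simp only [charSet, Set.mem_setOf_eq, transLen_inv hT hσ]
  rw [show dist p (σ p x⁻¹) = dist p (σ p x) from (lenFn hT hσ p).inv x]

/-- germ of points on `[p, p y]` lie on the axis of `x`. -/
lemma S_near (hT : IsRealTree T) (hσ : IsIsomRightAction σ) {p : T} {x y : G}
    (hx : p ∈ charSet σ x) (h : S (len σ p) y x) :
    ∃ ε > 0, ∀ q, dist p q ≤ ε → dist p q + dist q (σ p y) = dist p (σ p y) →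
      q ∈ charSet σ x := by
  unfold S at h
  refine ⟨(len σ p y + len σ p x - len σ p (y * x⁻¹)) / 2, by linarith, fun q h1 h2 => ?_⟩
  have i1 := hT.2.2.2 q (σ p x) p (σ p y)
  have e1 : dist (σ p x) (σ p y) = len σ p (y * x⁻¹) := by
    rw [dist_comm, dist_orb hσ, dist_comm]; rfl
  have e2 : len σ p x = transLen σ x := hx
  have e3 := dist_comm p q
  have e4 := dist_act hσ p q x
  have e5 : dist p (σ p y) = len σ p y := rfl
  have e6 : dist p (σ p x) = len σ p x := rfl
  have e7 := dist_comm p (σ p x)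
  have t := dist_triangle q (σ p x) (σ q x)
  have t2 := transLen_le (σ := σ) q x
  show dist q (σ q x) = transLen σ x
  rcases le_max_iff.1 i1 with h | h <;> linarith

lemma K_near (hT : IsRealTree T) (hσ : IsIsomRightAction σ) {p : T} {x y : G}
    (hx : p ∈ charSet σ x) (h : K (len σ p) y x) :
    ∃ ε > 0, ∀ q, dist p q ≤ ε → dist p q + dist q (σ p y) = dist p (σ p y) →
      q ∈ charSet σ x := by
  rcases h with h | h
  · exact S_near hT hσ hx h
  · rw [← charSet_inv hT hσ x] at hx ⊢
    exact S_near hT hσ hx h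

lemma trip (hT : IsRealTree T) (hσ : IsIsomRightAction σ) {p : T} {f g h : G}
    (hyp : ∀ x ∈ ({f, g, h} : Set G), 0 < transLen σ x)
    (hp : charSet σ f ∩ charSet σ g ∩ charSet σ h = {p}) : Trip (len σ p) f g h := by
  have hm : p ∈ charSet σ f ∩ charSet σ g ∩ charSet σ h := by rw [hp]; rfl
  obtain ⟨⟨mf, mg⟩, mh⟩ := hm
  have pp : ∀ x, p ∈ charSet σ x → 0 < transLen σ x → 0 < len σ p x := by
    intro x h1 h2
    have h1' : len σ p x = transLen σ x := h1
    linarith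
  refine ⟨not_S_of_mem hT hσ mf, not_S_of_mem hT hσ mg, not_S_of_mem hT hσ mh,
    pp f mf (hyp f (by simp)), pp g mg (hyp g (by simp)), pp h mh (hyp h (by simp)), ?_⟩
  rintro u ⟨kf, kg, kh⟩
  have hu : 0 < len σ p u := by
    rcases kf with k | k <;> exact (lenFn hT hσ p).pos k
  obtain ⟨a, a0, ha⟩ := K_near hT hσ mf kf
  obtain ⟨b, b0, hb⟩ := K_near hT hσ mg kg
  obtain ⟨c, c0, hc⟩ := K_near hT hσ mh kh
  obtain ⟨ε, e0, ea, eb, ec, eu⟩ : ∃ ε, 0 < ε ∧ ε ≤ a ∧ ε ≤ b ∧ ε ≤ c ∧ ε ≤ len σ p u :=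
    ⟨min (min a b) (min c (len σ p u)), by simp [*], by simp, by simp, by simp, by simp⟩
  obtain ⟨q, q1, q2⟩ := exists_pt hT p (σ p u) ε e0.le eu
  have q3 : dist p q + dist q (σ p u) = dist p (σ p u) := by linarith
  have : q ∈ charSet σ f ∩ charSet σ g ∩ charSet σ h :=
    ⟨⟨ha q (by linarith) q3, hb q (by linarith) q3⟩, hc q (by linarith) q3⟩
  rw [hp] at this
  have hq : q = p := this
  rw [hq, dist_self] at q1
  linarith

lemma unique_of_not_K (hT : IsRealTree T) (hσ : IsIsomRightAction σ) {p : T} {x y : G}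
    (hx : p ∈ charSet σ x) (hpos : 0 < transLen σ x) (h : ¬ K (len σ p) y x) :
    ∃! w, w ∈ treeSegment p (σ p y) ∩ charSet σ x := by
  refine ⟨p, ⟨by simp [treeSegment], hx⟩, ?_⟩
  rintro w ⟨w1, w2⟩
  by_contra hne
  have hr : 0 < dist p w := dist_pos.2 (Ne.symm hne)
  have w1' : dist p w + dist w (σ p y) = dist p (σ p y) := w1
  have w2' : dist w (σ w x) = transLen σ x := w2
  have hx' : len σ p x = transLen σ x := hx
  have H := lenFn hT hσ p
  have n1 : ¬ S (len σ p) y x := fun k => h (Or.inl k)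
  have n2 : ¬ S (len σ p) y x⁻¹ := fun k => h (Or.inr k)
  unfold S at n1 n2
  have key : ∀ z : G, len σ p (y * z⁻¹) ≤ dist (σ p y) w + dist w (σ p z) := by
    intro z
    have := dist_triangle (σ p y) w (σ p z)
    rw [dist_orb hσ p p y z, dist_comm _ p] at this
    exact this
  have k1 := key x
  have k2 := key x⁻¹
  have hi := H.inv x
  have e1 : dist w (σ p x⁻¹) = dist (σ w x) p := by
    have := dist_orb hσ w p 1 x⁻¹
    simpa [hσ.1] using this
  have i := hT.2.2.2 w (σ p x) p (σ w x)
  have e2 := dist_act hσ p w x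
  have e3 := dist_comm p w
  have e4 := dist_comm (σ p y) w
  have e5 := dist_comm p (σ w x)
  have e6 : dist p (σ p x) = len σ p x := rfl
  have e7 := dist_comm p (σ p x)
  have e8 : dist p (σ p y) = len σ p y := rfl
  rcases le_max_iff.1 i with h | h <;> linarith

lemma transLen_eq (hT : IsRealTree T) (hσ : IsIsomRightAction σ) {p : T} {x : G}
    (h : ¬ S (len σ p) x⁻¹ x) : transLen σ x = len σ p x := by
  have h1 := (lenFn hT hσ p).concat_len h
  have h2 := le_transLen hT hσ p x
  have h3 : transLen σ x ≤ len σ p x := transLen_le p x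
  linarith

/-- translation length of a cyclically reduced product. -/
lemma transLen_mul (hT : IsRealTree T) (hσ : IsIsomRightAction σ) {p : T} {a b : G}
    (ha : 0 < len σ p a) (hb : 0 < len σ p b)
    (h : ¬ S (len σ p) a⁻¹ b) (h' : ¬ S (len σ p) b⁻¹ a) :
    transLen σ (b * a) = len σ p b + len σ p a := by
  have H := lenFn hT hσ p
  rw [transLen_eq hT hσ (p := p), H.concat_len h, add_comm]
  intro k
  exact h' (H.trans (H.symm (H.concat_right h hb)) (H.trans k (H.symm (H.concat_left h ha))))

end tree_part

lemma core {G : Type*} [Group G]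
    {A : Type*} [MetricSpace A] {B : Type*} [MetricSpace B]
    {σA : A → G → A} {σB : B → G → B}
    (hA : IsRealTree A) (hB : IsRealTree B)
    (hσA : IsIsomRightAction σA) (hσB : IsIsomRightAction σB)
    (hcc : CompatibleCombinatorics (transLen σA) (transLen σB))
    {f g h : G} {pA : A} {pB : B}
    (tA : Trip (len σA pA) f g h) (tB : Trip (len σB pB) f g h) {y : G}
    (h1 : S (len σA pA) y f) (h2 : ¬ K (len σB pB) y f)
    (h3 : S (len σB pB) y h) (h4 : ¬ K (len σA pA) y h) : False := by
  have HA := lenFn hA hσA pA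
  have HB := lenFn hB hσB pB
  obtain ⟨v, a1, a2, b1, b2⟩ := reach HA HB tA tB (HA.pos h1) (HB.pos h3)
  rw [inv_inv] at a2 b2
  have vA : 0 < len σA pA v := HA.pos (HA.symm a1)
  have vB : 0 < len σB pB v := HB.pos (HB.symm b1)
  -- in A
  have cA : S (len σA pA) v v⁻¹ := HA.trans (HA.trans (HA.symm a1) h1) (HA.symm a2)
  have ltA := transLen_lt hA hσA pA v cA
  have nA : ¬ S (len σA pA) v h := fun k => h4 (Or.inl (HA.trans a1 k))
  have nA' : ¬ S (len σA pA) v h⁻¹ := fun k => h4 (Or.inr (HA.trans a1 k))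
  have eA : transLen σA (h * v) = len σA pA h + len σA pA v :=
    transLen_mul hA hσA vA tA.ph (fun k => nA (HA.trans cA k)) (fun k => nA' (HA.symm k))
  have eA' : transLen σA (h * v⁻¹) = len σA pA h + len σA pA v := by
    rw [transLen_mul hA hσA (p := pA) (by rwa [HA.inv]) tA.ph (by rwa [inv_inv])
      (fun k => nA' (HA.trans cA (HA.symm k))), HA.inv]
  have hhA : transLen σA h ≤ len σA pA h := transLen_le pA h
  -- in B
  have nB : ¬ S (len σB pB) v⁻¹ h := fun k =>
    h2 (Or.inl (HB.trans h3 (HB.trans (HB.symm k) b2)))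
  have eB : transLen σB (h * v) = len σB pB h + len σB pB v :=
    transLen_mul hB hσB vB tB.ph nB
      (fun k => tB.nh (HB.symm (HB.trans k (HB.trans (HB.symm b1) h3))))
  have eB' : transLen σB (h * v⁻¹) ≤ len σB pB (h * v⁻¹) := transLen_le pB _
  have sB : len σB pB (h * v⁻¹) < len σB pB h + len σB pB v :=
    HB.trans (HB.symm h3) b1
  have hne : h ≠ v := by
    rintro rfl
    exact nA (S_self HA vA)
  have : (h, v) ∈ DisjointSet (transLen σA) ∩ OverlapSet (transLen σB) :=
    ⟨⟨hne, by show transLen σA (h * v) = transLen σA (h * v⁻¹); rw [eA, eA'],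
      by show transLen σA h + transLen σA v < transLen σA (h * v); rw [eA]; linarith⟩,
      hne, by show transLen σB (h * v) ≠ transLen σB (h * v⁻¹); linarith⟩
  rw [hcc.2] at this
  exact this

lemma core' {G : Type*} [Group G]
    {A : Type*} [MetricSpace A] {B : Type*} [MetricSpace B]
    {σA : A → G → A} {σB : B → G → B}
    (hA : IsRealTree A) (hB : IsRealTree B)
    (hσA : IsIsomRightAction σA) (hσB : IsIsomRightAction σB)
    (hcc : CompatibleCombinatorics (transLen σA) (transLen σB))
    {f g h : G} {pA : A} {pB : B}
    (tA : Trip (len σA pA) f g h) (tB : Trip (len σB pB) f g h) {y : G}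
    (h1 : K (len σA pA) y f) (h2 : ¬ K (len σB pB) y f)
    (h3 : K (len σB pB) y h) (h4 : ¬ K (len σA pA) y h) : False := by
  have HA := lenFn hA hσA pA
  have HB := lenFn hB hσB pB
  have aux : ∀ f h, Trip (len σA pA) f g h → Trip (len σB pB) f g h →
      S (len σA pA) y f → ¬ K (len σB pB) y f → K (len σB pB) y h →
      ¬ K (len σA pA) y h → False := by
    intro f h tA tB h1 h2 h3 h4
    rcases h3 with h3 | h3
    · exact core hA hB hσA hσB hcc tA tB h1 h2 h3 h4
    · exact core hA hB hσA hσB hcc (tA.swap.invg HA).swap (tB.swap.invg HB).swap h1 h2 h3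
        (by rwa [K_inv])
  rcases h1 with h1 | h1
  · exact aux f h tA tB h1 h2 h3 h4
  · exact aux f⁻¹ h (tA.invf HA) (tB.invf HB) h1 (by rwa [K_inv]) h3 h4

end SegAxis

open SegAxis

/-- for compatible trees `A`, `B` and elements `f, g, h` hyperbolic
in both whose characteristic sets meet in a single point `∗^T` in each tree,
for every `y` some `x ∈ {f,g,h}` has `[∗^T, ∗^T·y] ∩ C_x^T` a single point in
both trees. -/
theorem segment_meets_axis_in_point {G : Type*} [Group G]
    {A : Type*} [MetricSpace A] {B : Type*} [MetricSpace B]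
    (σA : A → G → A) (σB : B → G → B)
    (hA : IsRealTree A) (hB : IsRealTree B)
    (hσA : IsIsomRightAction σA) (hσB : IsIsomRightAction σB)
    (hcc : CompatibleCombinatorics (transLen σA) (transLen σB))
    (f g h : G)
    (hhypA : ∀ x ∈ ({f, g, h} : Set G), 0 < transLen σA x)
    (hhypB : ∀ x ∈ ({f, g, h} : Set G), 0 < transLen σB x)
    (pA : A) (pB : B)
    (hpA : charSet σA f ∩ charSet σA g ∩ charSet σA h = {pA})
    (hpB : charSet σB f ∩ charSet σB g ∩ charSet σB h = {pB}) :
    ∀ y : G, ∃ x ∈ ({f, g, h} : Set G),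
      (∃! w, w ∈ treeSegment pA (σA pA y) ∩ charSet σA x) ∧
      (∃! w, w ∈ treeSegment pB (σB pB y) ∩ charSet σB x) := by
  intro y
  have tA := trip hA hσA hhypA hpA
  have tB := trip hB hσB hhypB hpB
  have mA : pA ∈ charSet σA f ∩ charSet σA g ∩ charSet σA h := by rw [hpA]; rfl
  have mB : pB ∈ charSet σB f ∩ charSet σB g ∩ charSet σB h := by rw [hpB]; rfl
  obtain ⟨⟨mAf, mAg⟩, mAh⟩ := mA
  obtain ⟨⟨mBf, mBg⟩, mBh⟩ := mB
  have fin : ∀ x ∈ ({f, g, h} : Set G), pA ∈ charSet σA x → pB ∈ charSet σB x →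
      ¬ K (len σA pA) y x → ¬ K (len σB pB) y x → ∃ x ∈ ({f, g, h} : Set G),
      (∃! w, w ∈ treeSegment pA (σA pA y) ∩ charSet σA x) ∧
      (∃! w, w ∈ treeSegment pB (σB pB y) ∩ charSet σB x) := fun x hx a b c d =>
    ⟨x, hx, unique_of_not_K hA hσA a (hhypA x hx) c, unique_of_not_K hB hσB b (hhypB x hx) d⟩
  by_contra hcon
  have Ff : K (len σA pA) y f ∨ K (len σB pB) y f := by
    by_contra k; push Not at k
    exact hcon (fin f (by simp) mAf mBf k.1 k.2)
  have Fg : K (len σA pA) y g ∨ K (len σB pB) y g := by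
    by_contra k; push Not at k
    exact hcon (fin g (by simp) mAg mBg k.1 k.2)
  have Fh : K (len σA pA) y h ∨ K (len σB pB) y h := by
    by_contra k; push Not at k
    exact hcon (fin h (by simp) mAh mBh k.1 k.2)
  have nA := tA.tr y
  have nB := tB.tr y
  have c1 := core' hA hB hσA hσB hcc tA tB (y := y)
  have c2 := core' hA hB hσA hσB hcc tA.swap tB.swap (y := y)
  have c3 := core' hA hB hσA hσB hcc tA.rot tB.rot (y := y)
  have c4 := core' hA hB hσA hσB hcc tA.rot.swap tB.rot.swap (y := y)
  have c5 := core' hA hB hσA hσB hcc tA.rot.rot tB.rot.rot (y := y)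
  have c6 := core' hA hB hσA hσB hcc tA.rot.rot.swap tB.rot.rot.swap (y := y)
  clear fin hcon
  generalize K (len σA pA) y f = a1 at *
  generalize K (len σA pA) y g = a2 at *
  generalize K (len σA pA) y h = a3 at *
  generalize K (len σB pB) y f = b1 at *
  generalize K (len σB pB) y g = b2 at *
  generalize K (len σB pB) y h = b3 at *
  clear tA tB mAf mAg mAh mBf mBg mBh hpA hpB hhypA hhypB hcc
  by_cases a1 <;> by_cases a2 <;> by_cases a3 <;> by_cases b1 <;> by_cases b2 <;>
    by_cases b3 <;> simp_all only [not_true_eq_false, not_false_eq_true, and_true, and_false,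
      true_and, false_and, or_self, or_true, true_or, forall_const, imp_false, implies_true]
end

section
/- Let G be a group and let A and B be G-trees whose translation length functions ℓ = ℓ_A and m = ℓ_B have compatible combinatorics. Let f, g, h ∈ G be elements that are hyperbolic in both A and B and such that, for T = A and for T = B, the triple intersection C_f^T ∩ C_g^T ∩ C_h^T is a single point ∗^T. Then for every z ∈ G there exist x ∈ {f, g, h} and y ∈ {z⁻¹fz, z⁻¹gz, z⁻¹hz} such that, for both T = A and T = B, the segment [∗^T, ∗^T·z] intersects C_x^T in exactly one point and intersects C_y^T in exactly one point. -/
/-- `x` and `y` lie in the same direction from `p`. -/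
def Sh {T : Type*} [MetricSpace T] (p x y : T) : Prop :=
  dist x y < dist p x + dist p y

structure TreeAct {G : Type*} [Group G] {T : Type*} [MetricSpace T]
    (σ : T → G → T) : Prop where
  ne : Nonempty T
  four : ∀ x y z w : T, dist x y + dist z w ≤
    max (dist x z + dist y w) (dist x w + dist y z)
  geo : ∀ (x y : T) (s : ℝ), 0 ≤ s → s ≤ dist x y →
    ∃ w, dist x w = s ∧ dist w y = dist x y - s
  one : ∀ p : T, σ p 1 = p
  mul : ∀ (p : T) (g h : G), σ p (g * h) = σ (σ p g) h
  iso : ∀ (g : G) (p q : T), dist (σ p g) (σ q g) = dist p q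

/-- `p` lies on the axis of the hyperbolic element `g`. -/
def Ax {G : Type*} [Group G] {T : Type*} [MetricSpace T]
    (σ : T → G → T) (p : T) (g : G) : Prop :=
  p ≠ σ p g ∧ ¬ Sh p (σ p g⁻¹) (σ p g)

theorem treeAct_of {G : Type*} [Group G] {T : Type*} [MetricSpace T]
    {σ : T → G → T} (hT : IsRealTree T) (hσ : IsIsomRightAction σ) : TreeAct σ where
  ne := hT.1
  four := hT.2.2.2
  geo := by
    intro x y s h0 h1
    obtain ⟨f, f0, f1, hf⟩ := hT.2.2.1 x y
    refine ⟨f s, ?_, ?_⟩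
    · have := hf 0 ⟨le_refl _, dist_nonneg⟩ s ⟨h0, h1⟩
      rw [f0] at this
      rw [this, zero_sub, abs_neg, abs_of_nonneg h0]
    · have := hf s ⟨h0, h1⟩ (dist x y) ⟨dist_nonneg, le_refl _⟩
      rw [f1] at this
      rw [this, abs_sub_comm, abs_of_nonneg (by linarith)]
  one := hσ.1
  mul := hσ.2.1
  iso := fun g p q => (hσ.2.2 g).dist_eq p q

section basic
variable {G : Type*} [Group G] {T : Type*} [MetricSpace T] {σ : T → G → T}

theorem Sh.symm {p x y : T} (h : Sh p x y) : Sh p y x := by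
  unfold Sh at *; rw [dist_comm y x]; linarith

theorem not_sh_symm {p x y : T} (h : ¬ Sh p x y) : ¬ Sh p y x := fun h' => h h'.symm

theorem not_sh_left {p x : T} : ¬ Sh p p x := by
  unfold Sh; simp

theorem not_sh_right {p x : T} : ¬ Sh p x p := fun h => not_sh_left h.symm

theorem not_sh_iff {p x y : T} : ¬ Sh p x y ↔ dist x y = dist p x + dist p y := by
  unfold Sh
  constructor
  · intro h
    have := dist_triangle x p y
    rw [dist_comm x p] at this
    linarith
  · intro h; linarith

theorem Sh.trans (H : TreeAct σ) {p x y z : T} (h : Sh p x y) (h' : Sh p y z) : Sh p x z := by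
  unfold Sh at *
  have := H.four x z p y
  rw [dist_comm x p, dist_comm z p, dist_comm z y] at this
  rcases le_max_iff.1 this with h1 | h1 <;> linarith

theorem sh_of_btw {p w x : T} (h : ¬ Sh w p x) (hne : w ≠ p) : Sh p w x := by
  rw [not_sh_iff] at h
  unfold Sh
  have := dist_pos.2 hne
  rw [dist_comm p w]
  linarith

theorem sh_congr_right (H : TreeAct σ) {p x y z : T} (h : Sh p y z) (h' : ¬ Sh p x y) :
    ¬ Sh p x z := fun h1 => h' (Sh.trans H h1 h.symm)

theorem sh_congr_left (H : TreeAct σ) {p x y z : T} (h : Sh p x z) (h' : ¬ Sh p x y) :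
    ¬ Sh p z y := fun h1 => h' (Sh.trans H h h1)

theorem chain1 (H : TreeAct σ) {a b c d : T} (h1 : ¬ Sh b a c) (h2 : ¬ Sh c b d) (hne : b ≠ c) :
    ¬ Sh b a d :=
  sh_congr_right H (sh_of_btw h2 hne.symm) h1

theorem chain2 (H : TreeAct σ) {a b c d : T} (h1 : ¬ Sh b a c) (h2 : ¬ Sh c b d) (hne : b ≠ c) :
    ¬ Sh c a d :=
  not_sh_symm (chain1 H (not_sh_symm h2) (not_sh_symm h1) hne.symm)

theorem sh_act (H : TreeAct σ) (g : G) {p x y : T} :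
    Sh (σ p g) (σ x g) (σ y g) ↔ Sh p x y := by
  unfold Sh; simp only [H.iso]

theorem act_inv (H : TreeAct σ) (g : G) (p : T) : σ (σ p g) g⁻¹ = p := by
  rw [← H.mul, mul_inv_cancel, H.one]

theorem inv_act (H : TreeAct σ) (g : G) (p : T) : σ (σ p g⁻¹) g = p := by
  rw [← H.mul, inv_mul_cancel, H.one]

theorem act_inj (H : TreeAct σ) (g : G) {p q : T} : σ p g = σ q g ↔ p = q := by
  rw [← dist_eq_zero, H.iso, dist_eq_zero]

theorem dist_inv_act (H : TreeAct σ) (g : G) (p : T) : dist p (σ p g⁻¹) = dist p (σ p g) := by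
  rw [← H.iso g p, inv_act H, dist_comm]

theorem Ax.inv (H : TreeAct σ) {p : T} {g : G} (h : Ax σ p g) : Ax σ p g⁻¹ := by
  refine ⟨?_, ?_⟩
  · rw [← dist_pos, dist_inv_act H, dist_pos]; exact h.1
  · rw [inv_inv]; exact not_sh_symm h.2

theorem ax_conj (H : TreeAct σ) {p : T} {g : G} (k : G) :
    Ax σ (σ p k) (k⁻¹ * g * k) ↔ Ax σ p g := by
  unfold Ax
  have e1 : σ (σ p k) (k⁻¹ * g * k) = σ (σ p g) k := by
    simp only [← H.mul]; congr 1; group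
  have e2 : σ (σ p k) (k⁻¹ * g * k)⁻¹ = σ (σ p g⁻¹) k := by
    simp only [← H.mul]; congr 1; group
  rw [e1, e2, sh_act H, ne_eq, act_inj H]

theorem Ax.pow_btw (H : TreeAct σ) {p : T} {g : G} (h : Ax σ p g) (n : ℕ) :
    ¬ Sh (σ p (g ^ n)) p (σ p (g ^ (n + 1))) := by
  induction n with
  | zero => simp only [pow_zero, H.one]; exact not_sh_left
  | succ n ih =>
    refine chain2 H ih ?_ ?_
    · have := (not_congr (sh_act H (g ^ (n + 1)) (p := p) (x := σ p g⁻¹) (y := σ p g))).2 h.2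
      simp only [← H.mul] at this
      have e1 : g⁻¹ * g ^ (n + 1) = g ^ n := by rw [pow_succ']; group
      have e2 : g * g ^ (n + 1) = g ^ (n + 1 + 1) := (pow_succ' _ _).symm
      rwa [e1, e2] at this
    · rw [pow_succ', H.mul, ne_eq, act_inj H]; exact h.1

theorem dist_pow_succ (H : TreeAct σ) (p : T) (g : G) (n : ℕ) :
    dist (σ p (g ^ n)) (σ p (g ^ (n + 1))) = dist p (σ p g) := by
  rw [pow_succ', H.mul, H.iso]

theorem Ax.dist_pow (H : TreeAct σ) {p : T} {g : G} (h : Ax σ p g) (n : ℕ) :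
    dist p (σ p (g ^ n)) = n * dist p (σ p g) := by
  induction n with
  | zero => simp [H.one]
  | succ n ih =>
    have := not_sh_iff.1 (h.pow_btw H n)
    rw [this, dist_pow_succ H, dist_comm, ih]; push_cast; ring

theorem dist_pow_le (H : TreeAct σ) (p : T) (g : G) (n : ℕ) :
    dist p (σ p (g ^ n)) ≤ n * dist p (σ p g) := by
  induction n with
  | zero => simp [H.one]
  | succ n ih =>
    have := dist_triangle p (σ p (g ^ n)) (σ p (g ^ (n + 1)))
    rw [dist_pow_succ H] at this
    push_cast; linarith

theorem transLen_le (p : T) (g : G) : transLen σ g ≤ dist p (σ p g) :=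
  ciInf_le ⟨0, by rintro _ ⟨q, rfl⟩; exact dist_nonneg⟩ p

theorem Ax.transLen (H : TreeAct σ) {p : T} {g : G} (h : Ax σ p g) :
    transLen σ g = dist p (σ p g) := by
  refine le_antisymm (transLen_le p g) ?_
  haveI := H.ne
  refine le_ciInf fun q => ?_
  by_contra hlt
  push Not at hlt
  obtain ⟨n, hn⟩ := exists_nat_gt (2 * dist p q / (dist p (σ p g) - dist q (σ q g)))
  rw [div_lt_iff₀ (by linarith)] at hn
  have h1 := dist_pow_le H q g n
  have h2 := h.dist_pow H n
  have h3 := dist_triangle4 p q (σ q (g ^ n)) (σ p (g ^ n))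
  rw [H.iso, dist_comm q p] at h3
  nlinarith

theorem Ax.pos (H : TreeAct σ) {p : T} {g : G} (h : Ax σ p g) : 0 < _root_.transLen σ g := by
  rw [h.transLen H]; exact dist_pos.2 h.1

theorem Ax.mem (H : TreeAct σ) {p : T} {g : G} (h : Ax σ p g) : p ∈ charSet σ g :=
  (h.transLen H).symm

theorem common (H : TreeAct σ) {p x y w : T} (s : ℝ)
    (hs : 2 * s ≤ dist p x + dist p y - dist x y)
    (h1 : dist p w = s) (h2 : dist w x = dist p x - s) : dist w y ≤ dist p y - s := by
  have := H.four w y p x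
  rw [dist_comm w p, dist_comm y x, dist_comm y p] at this
  rcases le_max_iff.1 this with h | h <;> linarith

theorem ax_of_mem (H : TreeAct σ) {p : T} {g : G} (hpos : 0 < transLen σ g)
    (h : p ∈ charSet σ g) : Ax σ p g := by
  have hL : dist p (σ p g) = transLen σ g := h
  refine ⟨dist_pos.1 (hL ▸ hpos), fun hs => ?_⟩
  rw [← sh_act H g, inv_act H] at hs
  unfold Sh at hs
  set q := σ p g with hq
  have e1 : dist q p = transLen σ g := by rw [dist_comm, hL]
  have e2 : dist q (σ q g) = transLen σ g := by rw [hq, H.iso]; exact hL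
  set L := transLen σ g with hLdef
  set c := (dist q p + dist q (σ q g) - dist p (σ q g)) / 2 with hc
  have hcpos : 0 < c := by rw [hc]; linarith
  set s := min c (L / 2) with hsdef
  have hs0 : 0 < s := lt_min hcpos (by linarith)
  have hsc : s ≤ c := min_le_left _ _
  have hsL : s ≤ L / 2 := min_le_right _ _
  obtain ⟨w, hw1, hw2⟩ := H.geo q p s hs0.le (by linarith)
  have hw3 := common H (y := σ q g) s (by linarith) hw1 hw2
  have hmin := transLen_le (σ := σ) w g
  have f1 : dist (σ w g) (σ q g) = s := by rw [H.iso, dist_comm, hw1]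
  have f2 : dist (σ w g) q = L - s := by rw [hq, H.iso, hw2, e1]
  have := H.four w (σ w g) q (σ q g)
  rw [dist_comm w q] at this
  rcases le_max_iff.1 this with h | h <;> linarith

theorem exists_median (H : TreeAct σ) (p x y : T) :
    ∃ m, ¬ Sh m p x ∧ ¬ Sh m p y ∧ ¬ Sh m x y := by
  have t1 := dist_triangle x p y
  have t2 := dist_triangle p x y
  have t3 := dist_triangle p y x
  have c1 := dist_comm x p
  have c2 := dist_comm y x
  obtain ⟨m, h1, h2⟩ := H.geo p x ((dist p x + dist p y - dist x y) / 2) (by linarith)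
    (by linarith)
  have h3 := common H (y := y) _ (by linarith) h1 h2
  have t4 := dist_triangle p m y
  have c3 := dist_comm p m
  refine ⟨m, ?_, ?_, ?_⟩ <;> rw [not_sh_iff] <;> linarith

theorem Ax.dichotomy (H : TreeAct σ) {p q : T} {g : G} (hp : Ax σ p g) (hq : Ax σ q g)
    (hne : p ≠ q) : Sh p q (σ p g) ∨ Sh p q (σ p g⁻¹) := by
  by_contra hcon
  push Not at hcon
  obtain ⟨h1, h2⟩ := hcon
  have h3 : ¬ Sh (σ p g) p (σ q g) := by
    rw [← sh_act H g, inv_act H] at h2; exact not_sh_symm h2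
  have h4 := chain2 H h1 h3 hp.1
  rw [not_sh_iff] at h1 h4
  have e := hp.transLen H
  rw [hq.transLen H] at e
  have c := H.iso g p q
  have c2 := dist_comm (σ p g) q
  have := dist_pos.2 hne
  linarith

theorem Ax.convex (H : TreeAct σ) {p q w : T} {g : G} (hp : Ax σ p g) (hq : Ax σ q g)
    (hw : ¬ Sh w p q) : Ax σ w g := by
  refine ax_of_mem H (hp.pos H) ?_
  refine le_antisymm ?_ (transLen_le w g)
  have ep := hp.transLen H
  have eq := hq.transLen H
  have key : ∀ a b u y : T, dist a b = dist u a + dist u b →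
      dist u y ≤ max (dist a y - dist u a) (dist b y - dist u b) := by
    intro a b u y h
    have := H.four u y a b
    rw [dist_comm y a, dist_comm y b] at this
    rcases le_max_iff.1 this with h | h
    · exact le_max_of_le_right (by linarith)
    · exact le_max_of_le_left (by linarith)
  rw [not_sh_iff] at hw
  have hwg : dist (σ p g) (σ q g) = dist (σ w g) (σ p g) + dist (σ w g) (σ q g) := by
    simp only [H.iso]; exact hw
  have k1 := key p q w (σ w g) hw
  have k2 := key _ _ _ p hwg
  have k3 := key _ _ _ q hwg
  have t1 := dist_triangle p q (σ q g)
  have t2 := dist_triangle q p (σ p g)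
  simp only [H.iso] at k2 k3
  have c1 := dist_comm p (σ w g)
  have c2 := dist_comm q (σ w g)
  have c3 := dist_comm p (σ p g)
  have c4 := dist_comm q (σ q g)
  have c5 := dist_comm p (σ q g)
  have c6 := dist_comm q (σ p g)
  have c7 := dist_comm p q
  have n1 := dist_nonneg (x := w) (y := p)
  have n2 := dist_nonneg (x := w) (y := q)
  rcases le_max_iff.1 k1 with h | h
  · rcases le_max_iff.1 k2 with h' | h' <;> linarith
  · rcases le_max_iff.1 k3 with h' | h' <;> linarith

theorem Ax.act (H : TreeAct σ) {p : T} {g : G} (h : Ax σ p g) (n : ℕ) : Ax σ (σ p (g ^ n)) g := by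
  have := (ax_conj H (g ^ n)).2 h
  have e : (g ^ n)⁻¹ * g * g ^ n = g := by
    rw [mul_assoc, ← pow_succ', pow_succ, inv_mul_cancel_left]
  rwa [e] at this

theorem Ax.sh_pow (H : TreeAct σ) {p : T} {g : G} (h : Ax σ p g) (n : ℕ) :
    Sh p (σ p g) (σ p (g ^ (n + 1))) := by
  induction n with
  | zero =>
    rw [zero_add, pow_one]; unfold Sh
    have := dist_pos.2 h.1
    rw [dist_self]; linarith
  | succ n ih =>
    refine ih.trans H (sh_of_btw (h.pow_btw H (n + 1)) ?_)
    intro e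
    have h1 := h.dist_pow H (n + 1)
    rw [e, dist_self] at h1
    have := dist_pos.2 h.1
    have : (0 : ℝ) < ((n + 1 : ℕ) : ℝ) * dist p (σ p g) := by positivity
    linarith

theorem Ax.proj (H : TreeAct σ) {p x : T} {g : G} (hp : Ax σ p g) (hx : Sh p x (σ p g)) :
    ∃ m, Ax σ m g ∧ m ≠ p ∧ ¬ Sh m p x ∧ ∃ a, (a = g ∨ a = g⁻¹) ∧ Sh m p (σ m a) ∧
      ¬ Sh m x (σ m a) ∧ ¬ Sh m x (σ m a⁻¹) := by
  have hpos := dist_pos.2 hp.1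
  obtain ⟨n, hn⟩ := exists_nat_gt (dist p x / dist p (σ p g))
  rw [div_lt_iff₀ hpos] at hn
  have he := hp.act H (n + 1)
  have hd := hp.dist_pow H (n + 1)
  have hs := hx.trans H (hp.sh_pow H n)
  set e := σ p (g ^ (n + 1)) with hedef
  obtain ⟨m, m1, m2, m3⟩ := exists_median H p x e
  have hm : Ax σ m g := hp.convex H he m2
  have hmp : m ≠ p := by rintro rfl; exact m3 hs
  have hme : m ≠ e := by
    intro h
    rw [not_sh_iff, h, dist_comm e p, hd] at m1
    push_cast at m1
    have := dist_nonneg (x := e) (y := x)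
    linarith
  refine ⟨m, hm, hmp, m1, ?_⟩
  rcases hm.dichotomy H hp hmp with h1 | h1 <;> rcases hm.dichotomy H he hme with h2 | h2
  · exact absurd (h1.trans H h2.symm) m2
  · exact ⟨g, Or.inl rfl, h1, sh_congr_right H h1 (not_sh_symm m1), sh_congr_right H h2 m3⟩
  · refine ⟨g⁻¹, Or.inr rfl, h1, sh_congr_right H h1 (not_sh_symm m1), ?_⟩
    rw [inv_inv]; exact sh_congr_right H h2 m3
  · exact absurd (h1.trans H h2.symm) m2

/-- Disjoint axes. -/
theorem prod_disj (H : TreeAct σ) {p q : T} {a b : G} (hp : Ax σ p a) (hq : Ax σ q b)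
    (hne : p ≠ q) (h1 : ¬ Sh p q (σ p a)) (h2 : ¬ Sh p q (σ p a⁻¹))
    (h3 : ¬ Sh q p (σ q b)) (h4 : ¬ Sh q p (σ q b⁻¹)) :
    Ax σ p (a * b) ∧ Sh p q (σ p (a * b)) ∧ Sh p (σ p a⁻¹) (σ p (a * b)⁻¹) ∧
      transLen σ (a * b) = transLen σ a + transLen σ b + 2 * dist p q := by
  have k1 : ¬ Sh (σ q b) q (σ p b) := by
    rw [← sh_act H b, inv_act H] at h4; exact not_sh_symm h4
  have k2 : ¬ Sh (σ p b) (σ q b) (σ p (a * b)) := by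
    rw [← sh_act H b, ← H.mul] at h1; exact h1
  have r1 : ¬ Sh (σ q b) q (σ p (a * b)) :=
    chain1 H k1 k2 (by rw [ne_eq, act_inj H]; exact hne.symm)
  have r1' : ¬ Sh (σ p b) q (σ p (a * b)) :=
    chain2 H k1 k2 (by rw [ne_eq, act_inj H]; exact hne.symm)
  have r2 : ¬ Sh q p (σ p (a * b)) := chain1 H h3 r1 hq.1
  have s1 : Sh p q (σ p (a * b)) := sh_of_btw r2 hne.symm
  have hai : σ p a⁻¹ ≠ p := (hp.inv H).1.symm
  have e : σ p (a * b)⁻¹ = σ (σ p b⁻¹) a⁻¹ := by rw [mul_inv_rev, H.mul]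
  -- backward direction
  have l1 : ¬ Sh q p (σ p b⁻¹) := by
    have l0 : ¬ Sh (σ q b⁻¹) q (σ p b⁻¹) := by
      rw [← sh_act H b⁻¹, act_inv H] at h3; exact not_sh_symm h3
    exact chain1 H h4 l0 (hq.inv H).1
  have l2 : Sh p q (σ p b⁻¹) := sh_of_btw l1 hne.symm
  have l3 : ¬ Sh p (σ p a) (σ p b⁻¹) := sh_congr_right H l2 (not_sh_symm h1)
  have s2 : Sh p (σ p a⁻¹) (σ p (a * b)⁻¹) := by
    rw [← sh_act H a⁻¹, act_inv H, ← e] at l3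
    exact sh_of_btw l3 hai
  have dd : dist p (σ p (a * b)) = dist p (σ p a) + dist q (σ q b) + 2 * dist p q := by
    rw [not_sh_iff] at r2 r1' k1
    rw [dist_comm (σ q b) q, H.iso] at k1
    have c1 : dist (σ p b) (σ p (a * b)) = dist p (σ p a) := by rw [H.mul, H.iso]
    have c2 := dist_comm (σ p b) q
    have c3 := dist_comm q p
    linarith
  have hax : Ax σ p (a * b) := by
    refine ⟨?_, ?_⟩
    · rw [← dist_pos, dd]
      have := dist_pos.2 hp.1
      positivity
    · exact sh_congr_right H s1 (sh_congr_left H s2 (not_sh_symm h2))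
  refine ⟨hax, s1, s2, ?_⟩
  rw [hax.transLen H, hp.transLen H, hq.transLen H, dd]

/-- Axes meeting coherently. -/
theorem prod_meet (H : TreeAct σ) {p : T} {a b : G} (ha : Ax σ p a) (hb : Ax σ p b)
    (h1 : ¬ Sh p (σ p a⁻¹) (σ p b)) (h2 : ¬ Sh p (σ p a) (σ p b⁻¹)) :
    Ax σ p (a * b) ∧ Sh p (σ p b) (σ p (a * b)) ∧ Sh p (σ p a⁻¹) (σ p (a * b)⁻¹) ∧
      transLen σ (a * b) = transLen σ a + transLen σ b := by
  have k1 : ¬ Sh (σ p b) p (σ p (a * b)) := by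
    have := h2
    rw [← sh_act H b, inv_act H, ← H.mul] at this; exact not_sh_symm this
  have k2 : ¬ Sh (σ p a⁻¹) p (σ p (a * b)⁻¹) := by
    rw [mul_inv_rev, H.mul]
    have := h2
    rw [← sh_act H a⁻¹, act_inv H] at this; exact this
  have s1 := sh_of_btw k1 hb.1.symm
  have s2 := sh_of_btw k2 (ha.inv H).1.symm
  have dd : dist p (σ p (a * b)) = dist p (σ p a) + dist p (σ p b) := by
    rw [not_sh_iff] at k1
    have c1 : dist (σ p b) (σ p (a * b)) = dist p (σ p a) := by rw [H.mul, H.iso]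
    rw [k1, c1, dist_comm]; ring
  have hax : Ax σ p (a * b) := by
    refine ⟨?_, ?_⟩
    · rw [← dist_pos, dd]
      have := dist_pos.2 ha.1
      positivity
    · exact sh_congr_right H s1 (sh_congr_left H s2 h1)
  refine ⟨hax, s1, s2, ?_⟩
  rw [hax.transLen H, ha.transLen H, hb.transLen H, dd]

theorem overlap_lt (H : TreeAct σ) {p : T} {a b : G} (ha : Ax σ p a) (hb : Ax σ p b)
    (h : Sh p (σ p a) (σ p b)) : transLen σ (a * b⁻¹) < transLen σ (a * b) := by
  have h1 := (prod_meet H ha hb (sh_congr_right H h ha.2)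
    (sh_congr_left H h.symm (not_sh_symm hb.2))).2.2.2
  have h2 := transLen_le (σ := σ) p (a * b⁻¹)
  rw [← H.iso b, H.mul, inv_act H, dist_comm] at h2
  unfold Sh at h
  rw [h1, ha.transLen H, hb.transLen H]
  linarith

theorem overlap_ne (H : TreeAct σ) {p : T} {a b : G} (ha : Ax σ p a) (hb : Ax σ p b)
    (h : Sh p (σ p a) (σ p b) ∨ Sh p (σ p a) (σ p b⁻¹)) :
    transLen σ (a * b) ≠ transLen σ (a * b⁻¹) := by
  rcases h with h | h
  · exact (overlap_lt H ha hb h).ne'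
  · have := overlap_lt H ha (hb.inv H) h
    rw [inv_inv] at this
    exact this.ne

end basic

section claims
variable {G : Type*} [Group G] {T : Type*} [MetricSpace T] {σ : T → G → T}

/-- The axis of `x` through `p` contains the initial direction of `[p, p·z]`. -/
def InS (σ : T → G → T) (p : T) (z x : G) : Prop :=
  Sh p (σ p z) (σ p x) ∨ Sh p (σ p z) (σ p x⁻¹)

/-- The axis of `u` projects to `p` on the segment `[p, p·ζ]`. -/
def GoodAt (σ : T → G → T) (p : T) (ζ u : G) : Prop :=
  ∃ c, Ax σ c u ∧ ¬ Sh c (σ p ζ) (σ c u) ∧ ¬ Sh c (σ p ζ) (σ c u⁻¹) ∧ ¬ Sh p c (σ p ζ)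

/-- The axis of `b` projects to `p·z` on the segment `[p, p·z]`. -/
def GoodEnd (σ : T → G → T) (p : T) (z b : G) : Prop :=
  ∃ c, Ax σ c b ∧ ¬ Sh c p (σ c b) ∧ ¬ Sh c p (σ c b⁻¹) ∧ ¬ Sh (σ p z) p c

theorem ax_act_self (H : TreeAct σ) {p : T} {g : G} (h : Ax σ p g) : Ax σ (σ p g) g := by
  have := h.act H 1
  rwa [pow_one] at this

theorem ax_inv_iff (H : TreeAct σ) {p : T} {g : G} : Ax σ p g⁻¹ ↔ Ax σ p g :=
  ⟨fun h => by have := h.inv H; rwa [inv_inv] at this, fun h => h.inv H⟩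

theorem near (H : TreeAct σ) {p : T} {z x : G} (hx : Ax σ p x) (hs : InS σ p z x) :
    ∃ c > 0, ∀ s ≤ c, ∀ w, dist p w = s → dist w (σ p z) = dist p (σ p z) - s → Ax σ w x := by
  have key : ∀ x', Ax σ p x' → Sh p (σ p z) (σ p x') →
      ∃ c > 0, ∀ s ≤ c, ∀ w, dist p w = s → dist w (σ p z) = dist p (σ p z) - s → Ax σ w x' := by
    intro x' hx' hsh
    unfold Sh at hsh
    refine ⟨(dist p (σ p z) + dist p (σ p x') - dist (σ p z) (σ p x')) / 2, by linarith, ?_⟩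
    intro s hs w h1 h2
    have h3 := common H (y := σ p x') s (by linarith) h1 h2
    refine hx'.convex H (ax_act_self H hx') ?_
    rw [not_sh_iff]
    have := dist_triangle p w (σ p x')
    rw [dist_comm w p]
    linarith
  rcases hs with h | h
  · exact key x hx h
  · obtain ⟨c, hc, hh⟩ := key x⁻¹ (hx.inv H) h
    exact ⟨c, hc, fun s hs w h1 h2 => (ax_inv_iff H).1 (hh s hs w h1 h2)⟩

theorem not_all (H : TreeAct σ) {p : T} {f g h : G} (z : G)
    (hf : Ax σ p f) (hg : Ax σ p g) (hh : Ax σ p h)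
    (hp : charSet σ f ∩ charSet σ g ∩ charSet σ h = {p}) :
    ∃ x, (x = f ∨ x = g ∨ x = h) ∧ ¬ InS σ p z x := by
  by_contra hcon
  push Not at hcon
  have sf := hcon f (by simp)
  obtain ⟨c1, p1, k1⟩ := near H hf sf
  obtain ⟨c2, p2, k2⟩ := near H hg (hcon g (by simp))
  obtain ⟨c3, p3, k3⟩ := near H hh (hcon h (by simp))
  have hz : p ≠ σ p z := by
    intro e
    unfold InS at sf
    rw [← e] at sf
    rcases sf with h | h <;> exact not_sh_left h
  have hd := dist_pos.2 hz
  set s := min (min c1 c2) (min c3 (dist p (σ p z))) with hs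
  have s1 : s ≤ c1 := (min_le_left _ _).trans (min_le_left _ _)
  have s2 : s ≤ c2 := (min_le_left _ _).trans (min_le_right _ _)
  have s3 : s ≤ c3 := (min_le_right _ _).trans (min_le_left _ _)
  have s4 : s ≤ dist p (σ p z) := (min_le_right _ _).trans (min_le_right _ _)
  have s0 : 0 < s := lt_min (lt_min p1 p2) (lt_min p3 hd)
  obtain ⟨w, w1, w2⟩ := H.geo p (σ p z) s s0.le s4
  have : w ∈ charSet σ f ∩ charSet σ g ∩ charSet σ h :=
    ⟨⟨(k1 s s1 w w1 w2).mem H, (k2 s s2 w w1 w2).mem H⟩, (k3 s s3 w w1 w2).mem H⟩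
  rw [hp] at this
  have e : w = p := this
  rw [e, dist_self] at w1
  linarith

theorem single (H : TreeAct σ) {p : T} {z x : G} (hx : Ax σ p x) (hs : ¬ InS σ p z x)
    {w : T} (hw : ¬ Sh w p (σ p z)) (hwx : Ax σ w x) : w = p := by
  by_contra hne
  have h1 := sh_of_btw hw hne
  rcases hx.dichotomy H hwx (Ne.symm hne) with h | h
  · exact hs (Or.inl (h1.symm.trans H h))
  · exact hs (Or.inr (h1.symm.trans H h))

theorem goodAt_inv {p : T} {ζ u : G} (H : TreeAct σ) (h : GoodAt σ p ζ u) :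
    GoodAt σ p ζ u⁻¹ := by
  obtain ⟨c, h1, h2, h3, h4⟩ := h
  exact ⟨c, h1.inv H, h3, by rwa [inv_inv], h4⟩

theorem goodEnd_inv {p : T} {ζ u : G} (H : TreeAct σ) (h : GoodEnd σ p ζ u) :
    GoodEnd σ p ζ u⁻¹ := by
  obtain ⟨c, h1, h2, h3, h4⟩ := h
  exact ⟨c, h1.inv H, h3, by rwa [inv_inv], h4⟩

theorem goodAt_of_not (H : TreeAct σ) {p : T} {ζ k : G} (hk : Ax σ p k)
    (hs : ¬ InS σ p ζ k) : GoodAt σ p ζ k :=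
  ⟨p, hk, fun h => hs (Or.inl h), fun h => hs (Or.inr h), not_sh_left⟩

theorem goodEnd_of (H : TreeAct σ) {p : T} {z u : G} (h : GoodAt σ p z⁻¹ u) :
    GoodEnd σ p z (z⁻¹ * u * z) := by
  obtain ⟨c, h1, h2, h3, h4⟩ := h
  have e1 : σ (σ c z) (z⁻¹ * u * z) = σ (σ c u) z := by
    simp only [← H.mul]; congr 1; group
  have e2 : σ (σ c z) (z⁻¹ * u * z)⁻¹ = σ (σ c u⁻¹) z := by
    simp only [← H.mul]; congr 1; group
  rw [← sh_act H z, inv_act H] at h2 h3 h4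
  exact ⟨σ c z, (ax_conj H z).2 h1, by rwa [e1], by rwa [e2], not_sh_symm h4⟩

/-- Transport: a good point for `k⁻¹yk`. -/
theorem goodAt_conj (H : TreeAct σ) {p m : T} {ζ y k : G} (hm : Ax σ m y)
    (h1 : ¬ Sh m (σ (σ p ζ) k⁻¹) (σ m y)) (h2 : ¬ Sh m (σ (σ p ζ) k⁻¹) (σ m y⁻¹))
    (h3 : ¬ Sh (σ p k⁻¹) m (σ (σ p ζ) k⁻¹)) : GoodAt σ p ζ (k⁻¹ * y * k) := by
  have e1 : σ (σ m k) (k⁻¹ * y * k) = σ (σ m y) k := by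
    simp only [← H.mul]; congr 1; group
  have e2 : σ (σ m k) (k⁻¹ * y * k)⁻¹ = σ (σ m y⁻¹) k := by
    simp only [← H.mul]; congr 1; group
  rw [← sh_act H k, inv_act H] at h1 h2
  rw [← sh_act H k, inv_act H, inv_act H] at h3
  exact ⟨σ m k, (ax_conj H k).2 hm, by rwa [e1], by rwa [e2], h3⟩

theorem back_btw (H : TreeAct σ) {p : T} {ζ k : G} (h : ¬ Sh p (σ p ζ) (σ p k)) :
    ¬ Sh (σ p k⁻¹) p (σ (σ p ζ) k⁻¹) := by
  rw [← sh_act H k⁻¹, act_inv H] at h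
  exact not_sh_symm h

theorem goodAt_simple (H : TreeAct σ) {p : T} {ζ y k : G} (hy : Ax σ p y)
    (h : ¬ Sh p (σ p ζ) (σ p k)) (hk : p ≠ σ p k⁻¹)
    (h1 : ¬ Sh p (σ p k⁻¹) (σ p y)) (h2 : ¬ Sh p (σ p k⁻¹) (σ p y⁻¹)) :
    GoodAt σ p ζ (k⁻¹ * y * k) := by
  have hb := back_btw H h
  have hs := sh_of_btw hb hk.symm
  exact goodAt_conj H hy (sh_congr_left H hs h1) (sh_congr_left H hs h2) hb

theorem goodAt_far (H : TreeAct σ) {p : T} {ζ y k : G} (hy : Ax σ p y)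
    (h : ¬ Sh p (σ p ζ) (σ p k)) (h1 : Sh p (σ p k⁻¹) (σ p y⁻¹))
    (h2 : ¬ Ax σ (σ p k⁻¹) y) : GoodAt σ p ζ (k⁻¹ * y * k) := by
  obtain ⟨m, hm, hmp, hb, a, ha, -, k1, k2⟩ := (hy.inv H).proj H h1
  have hm' := (ax_inv_iff H).1 hm
  have hne : m ≠ σ p k⁻¹ := by rintro rfl; exact h2 hm'
  have hback := back_btw H h
  have hs : Sh (σ p k⁻¹) p m := (sh_of_btw (not_sh_symm hb) hne).symm
  have h3 : ¬ Sh (σ p k⁻¹) m (σ (σ p ζ) k⁻¹) := sh_congr_left H hs hback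
  have h4 : Sh m (σ p k⁻¹) (σ (σ p ζ) k⁻¹) := sh_of_btw h3 hne.symm
  have : ¬ Sh m (σ p k⁻¹) (σ m y) ∧ ¬ Sh m (σ p k⁻¹) (σ m y⁻¹) := by
    rcases ha with rfl | rfl
    · rw [inv_inv] at k2; exact ⟨k2, k1⟩
    · simp only [inv_inv] at k1 k2; exact ⟨k1, k2⟩
  exact goodAt_conj H hm' (sh_congr_left H h4 this.1) (sh_congr_left H h4 this.2) h3

theorem sh_sq (H : TreeAct σ) {p : T} {j : G} (hj : Ax σ p j) :
    Sh p (σ p j) (σ p (j * j)) := by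
  have := hj.sh_pow H 1
  rwa [one_add_one_eq_two, pow_two] at this

theorem sh_sq_inv (H : TreeAct σ) {p : T} {j : G} (hj : Ax σ p j) :
    Sh p (σ p j⁻¹) (σ p (j * j)⁻¹) := by
  have := sh_sq H (hj.inv H)
  rwa [← mul_inv_rev] at this

theorem goodAt_first (H : TreeAct σ) {p : T} {ζ y j : G} (hy : Ax σ p y) (hj : Ax σ p j)
    (hs : ¬ InS σ p ζ j) (hz : Sh p (σ p ζ) (σ p y)) :
    GoodAt σ p ζ (j⁻¹ * y * j) ∨ GoodAt σ p ζ ((j * j)⁻¹ * y * (j * j)) := by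
  have z1 : ¬ Sh p (σ p ζ) (σ p j) := fun h => hs (Or.inl h)
  have z2 : ¬ Sh p (σ p ζ) (σ p j⁻¹) := fun h => hs (Or.inr h)
  by_cases h1 : Sh p (σ p j⁻¹) (σ p y⁻¹)
  · by_cases a1 : Ax σ (σ p j⁻¹) y
    · by_cases a2 : Ax σ (σ p (j * j)⁻¹) y
      · left
        have b0 : Ax σ p (j⁻¹ * y * j) := by
          have := (ax_conj H j).2 a1; rwa [inv_act H] at this
        have b1 : Ax σ (σ p j) (j⁻¹ * y * j) := (ax_conj H j).2 hy
        have b2 : Ax σ (σ p j⁻¹) (j⁻¹ * y * j) := by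
          have := (ax_conj H j).2 a2
          rwa [mul_inv_rev, H.mul, inv_act H] at this
        refine goodAt_of_not H b0 ?_
        rintro (h | h) <;> rcases b0.dichotomy H b1 hj.1 with c1 | c1 <;>
          rcases b0.dichotomy H b2 (hj.inv H).1 with c2 | c2 <;>
          first
          | exact z1 (h.trans H c1.symm)
          | exact z2 (h.trans H c2.symm)
          | exact hj.2 (c2.trans H c1.symm)
      · right
        refine goodAt_far H hy ?_ ((sh_sq_inv H hj).symm.trans H h1) a2
        exact sh_congr_right H (sh_sq H hj) z1
    · left
      exact goodAt_far H hy z1 h1 a1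
  · left
    refine goodAt_simple H hy z1 (hj.inv H).1 ?_ h1
    exact not_sh_symm (sh_congr_left H hz z2)

theorem goodAt_A (H : TreeAct σ) {p : T} {ζ y j : G} (hy : Ax σ p y) (hj : Ax σ p j)
    (hs : ¬ InS σ p ζ j) (hz : InS σ p ζ y) :
    GoodAt σ p ζ (j⁻¹ * y * j) ∨ GoodAt σ p ζ ((j * j)⁻¹ * y * (j * j)) := by
  rcases hz with hz | hz
  · exact goodAt_first H hy hj hs hz
  · rcases goodAt_first H (hy.inv H) hj hs hz with h | h
    · left; have := goodAt_inv H h; convert this using 1; group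
    · right; have := goodAt_inv H h; convert this using 1; simp [mul_assoc]

theorem goodAt_B (H : TreeAct σ) {p : T} {ζ y k : G} (hy : Ax σ p y)
    (hs : ¬ InS σ p ζ y) (h1 : Sh p (σ p ζ) (σ p k⁻¹)) (h2 : ¬ Sh p (σ p ζ) (σ p k)) :
    GoodAt σ p ζ (k⁻¹ * y * k) := by
  refine goodAt_simple H hy h2 ?_ (sh_congr_left H h1 fun h => hs (Or.inl h))
    (sh_congr_left H h1 fun h => hs (Or.inr h))
  intro e
  rw [← e] at h1
  exact not_sh_right h1

theorem final_B (H : TreeAct σ) {p : T} {z a b h : G} (ha : Ax σ p a) (hh : Ax σ p h)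
    (hs : ¬ InS σ p z a) (hhs : InS σ p z h) (hb : GoodEnd σ p z b) :
    transLen σ (a * b * h) ≠ transLen σ (a * b * h⁻¹) := by
  obtain ⟨c, c1, c2, c3, c4⟩ := hb
  have hz : σ p z ≠ p := by
    intro e
    unfold InS at hhs
    rw [e] at hhs
    rcases hhs with h | h <;> exact not_sh_left h
  have s1 : Sh p (σ p z) c := sh_of_btw c4 hz
  have hpc : p ≠ c := by rintro rfl; exact not_sh_right s1
  obtain ⟨r1, r2, -, -⟩ := prod_disj H ha c1 hpc (sh_congr_left H s1 fun h => hs (Or.inl h))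
    (sh_congr_left H s1 fun h => hs (Or.inr h)) c2 c3
  have s2 := (s1.trans H r2).symm
  refine overlap_ne H r1 hh ?_
  rcases hhs with h | h
  · exact Or.inl (s2.trans H h)
  · exact Or.inr (s2.trans H h)

theorem disj_D (H : TreeAct σ) {p q : T} {a b : G} (hp : Ax σ p a) (hq : Ax σ q b)
    (hne : p ≠ q) (h1 : ¬ Sh p q (σ p a)) (h2 : ¬ Sh p q (σ p a⁻¹))
    (h3 : ¬ Sh q p (σ q b)) (h4 : ¬ Sh q p (σ q b⁻¹)) :
    transLen σ (a * b) = transLen σ (a * b⁻¹) ∧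
      transLen σ a + transLen σ b < transLen σ (a * b) := by
  have e1 := (prod_disj H hp hq hne h1 h2 h3 h4).2.2.2
  have e2 := (prod_disj H hp (hq.inv H) hne h1 h2 h4 (by rwa [inv_inv])).2.2.2
  have e3 : transLen σ b⁻¹ = transLen σ b := by
    rw [hq.transLen H, (hq.inv H).transLen H, dist_inv_act H]
  have := dist_pos.2 hne
  rw [e1, e2, e3]
  exact ⟨rfl, by linarith⟩

theorem final_A_aux (H : TreeAct σ) {p : T} {z f b h : G} (hf : Ax σ p f) (hh : Ax σ p h)
    (hs : ¬ InS σ p z h) (hfs : Sh p (σ p z) (σ p f)) (hb : GoodEnd σ p z b) :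
    ∃ a b', (a = f ∨ a = f⁻¹) ∧ (b' = b ∨ b' = b⁻¹) ∧
      transLen σ (a * b' * h) = transLen σ (a * b' * h⁻¹) ∧
      transLen σ (a * b') + transLen σ h < transLen σ (a * b' * h) := by
  obtain ⟨c, c1, c2, c3, c4⟩ := hb
  have hz : σ p z ≠ p := by
    intro e
    rw [e] at hfs
    exact not_sh_left hfs
  have s1 : Sh p (σ p z) c := sh_of_btw c4 hz
  obtain ⟨m, hm, hmp, hbt, a, ha, t1, t2, t3⟩ := hf.proj H (s1.symm.trans H hfs)
  have hma : Ax σ m a := by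
    rcases ha with rfl | rfl
    · exact hm
    · exact hm.inv H
  have s2 : Sh p (σ p z) m := s1.trans H (sh_of_btw hbt hmp).symm
  have n1 : ¬ Sh p m (σ p h) := sh_congr_left H s2 fun h => hs (Or.inl h)
  have n2 : ¬ Sh p m (σ p h⁻¹) := sh_congr_left H s2 fun h => hs (Or.inr h)
  have pa : ¬ Sh m p (σ m a⁻¹) := fun h => hma.2 (h.symm.trans H t1)
  -- it suffices to have the axis of the product through `m` avoiding the direction of `p`
  have fin : ∀ b', Ax σ m (a * b') → ¬ Sh m p (σ m (a * b')) → ¬ Sh m p (σ m (a * b')⁻¹) →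
      transLen σ (a * b' * h) = transLen σ (a * b' * h⁻¹) ∧
      transLen σ (a * b') + transLen σ h < transLen σ (a * b' * h) := by
    intro b' h1 h2 h3
    exact disj_D H h1 hh hmp h2 h3 n1 n2
  by_cases hmc : m = c
  · subst hmc
    have meet : ∀ b', Ax σ m b' → ¬ Sh m (σ m a⁻¹) (σ m b') → ¬ Sh m p (σ m b') →
        ¬ Sh m p (σ m b'⁻¹) →
        transLen σ (a * b' * h) = transLen σ (a * b' * h⁻¹) ∧
        transLen σ (a * b') + transLen σ h < transLen σ (a * b' * h) := by
      intro b' h1 h2 h3 h4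
      obtain ⟨r1, r2, r3, -⟩ := prod_meet H hma h1 h2 (sh_congr_left H t1 h4)
      exact fin b' r1 (sh_congr_right H r2 h3) (sh_congr_right H r3 pa)
    by_cases hsh : Sh m (σ m a⁻¹) (σ m b)
    · refine ⟨a, b⁻¹, ha, Or.inr rfl, meet _ (c1.inv H) ?_ c3 (by rwa [inv_inv])⟩
      exact sh_congr_left H hsh.symm (not_sh_symm c1.2)
    · exact ⟨a, b, ha, Or.inl rfl, meet _ c1 hsh c2 c3⟩
  · have s3 : Sh c m p := sh_of_btw (not_sh_symm hbt) hmc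
    obtain ⟨r1, r2, r3, -⟩ := prod_disj H hma c1 hmc t2 t3
      (sh_congr_left H s3.symm c2) (sh_congr_left H s3.symm c3)
    exact ⟨a, b, ha, Or.inl rfl, fin b r1 (sh_congr_right H r2 hbt) (sh_congr_right H r3 pa)⟩

theorem final_A (H : TreeAct σ) {p : T} {z f b h : G} (hf : Ax σ p f) (hh : Ax σ p h)
    (hs : ¬ InS σ p z h) (hfs : InS σ p z f) (hb : GoodEnd σ p z b) :
    ∃ a b', (a = f ∨ a = f⁻¹) ∧ (b' = b ∨ b' = b⁻¹) ∧
      transLen σ (a * b' * h) = transLen σ (a * b' * h⁻¹) ∧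
      transLen σ (a * b') + transLen σ h < transLen σ (a * b' * h) := by
  rcases hfs with h1 | h1
  · exact final_A_aux H hf hh hs h1 hb
  · obtain ⟨a, b', h2, h3⟩ := final_A_aux H (hf.inv H) hh hs h1 hb
    refine ⟨a, b', ?_, h3⟩
    rw [inv_inv] at h2; exact h2.symm

end claims

section two
variable {G : Type*} [Group G] {A : Type*} [MetricSpace A] {B : Type*} [MetricSpace B]
  {σA : A → G → A} {σB : B → G → B}

theorem inS_inv_iff {T : Type*} [MetricSpace T] {σ : T → G → T} {p : T} {z x : G} :
    InS σ p z x⁻¹ ↔ InS σ p z x := by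
  unfold InS; rw [inv_inv, or_comm]

theorem exists_goodAt (HA : TreeAct σA) (HB : TreeAct σB) {pA : A} {pB : B} {ζ y j : G}
    (yA : Ax σA pA y) (yB : Ax σB pB y) (jA : Ax σA pA j) (jB : Ax σB pB j)
    (h1 : InS σA pA ζ y) (h2 : ¬ InS σB pB ζ y) (h3 : InS σB pB ζ j) (h4 : ¬ InS σA pA ζ j) :
    ∃ u, GoodAt σA pA ζ u ∧ GoodAt σB pB ζ u := by
  have main : ∀ j : G, Ax σA pA j → Ax σB pB j → Sh pB (σB pB ζ) (σB pB j⁻¹) →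
      ¬ InS σA pA ζ j → ∃ u, GoodAt σA pA ζ u ∧ GoodAt σB pB ζ u := by
    intro j jA jB h3 h4
    have h5 : ¬ Sh pB (σB pB ζ) (σB pB j) := sh_congr_left HB h3.symm jB.2
    rcases goodAt_A HA yA jA h4 h1 with h | h
    · exact ⟨_, h, goodAt_B HB yB h2 h3 h5⟩
    · exact ⟨_, h, goodAt_B HB yB h2 (h3.trans HB (sh_sq_inv HB jB))
        (sh_congr_right HB (sh_sq HB jB) h5)⟩
  rcases h3 with h3 | h3
  · exact main j⁻¹ (jA.inv HA) (jB.inv HB) (by rwa [inv_inv]) (fun h => h4 (inS_inv_iff.1 h))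
  · exact main j jA jB h3 h4

theorem exists_common (HA : TreeAct σA) (HB : TreeAct σB)
    (hcc : CompatibleCombinatorics (transLen σA) (transLen σB))
    {pA : A} {pB : B} {f g h : G}
    (hAx : ∀ x, (x = f ∨ x = g ∨ x = h) → Ax σA pA x ∧ Ax σB pB x)
    (hpA : charSet σA f ∩ charSet σA g ∩ charSet σA h = {pA})
    (hpB : charSet σB f ∩ charSet σB g ∩ charSet σB h = {pB}) (z : G) :
    ∃ x, (x = f ∨ x = g ∨ x = h) ∧ ¬ InS σA pA z x ∧ ¬ InS σB pB z x := by
  have hf := hAx f (by simp)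
  have hg := hAx g (by simp)
  have hh := hAx h (by simp)
  have exA := fun z => not_all HA z hf.1 hg.1 hh.1 hpA
  have exB := fun z => not_all HB z hf.2 hg.2 hh.2 hpB
  have good : ∃ u, GoodAt σA pA z⁻¹ u ∧ GoodAt σB pB z⁻¹ u := by
    obtain ⟨j, j1, j2⟩ := exA z⁻¹
    obtain ⟨y, y1, y2⟩ := exB z⁻¹
    by_cases j3 : InS σB pB z⁻¹ j
    · by_cases y3 : InS σA pA z⁻¹ y
      · exact exists_goodAt HA HB (hAx y y1).1 (hAx y y1).2 (hAx j j1).1 (hAx j j1).2 y3 y2 j3 j2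
      · exact ⟨y, goodAt_of_not HA (hAx y y1).1 y3, goodAt_of_not HB (hAx y y1).2 y2⟩
    · exact ⟨j, goodAt_of_not HA (hAx j j1).1 j2, goodAt_of_not HB (hAx j j1).2 j3⟩
  obtain ⟨u, uA, uB⟩ := good
  have eA := goodEnd_of HA uA
  have eB := goodEnd_of HB uB
  by_contra hcon
  push Not at hcon
  obtain ⟨k, k1, k2⟩ := exA z
  obtain ⟨x, x1, x2⟩ := exB z
  have k3 := hcon k k1 k2
  have x3 : InS σA pA z x := by
    by_contra h; exact x2 (hcon x x1 h)
  obtain ⟨a, b, ha, hb, d1, d2⟩ := final_A HA (hAx x x1).1 (hAx k k1).1 k2 x3 eA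
  have aB : Ax σB pB a ∧ ¬ InS σB pB z a := by
    rcases ha with rfl | rfl
    · exact ⟨(hAx a x1).2, x2⟩
    · exact ⟨(hAx x x1).2.inv HB, fun h => x2 (inS_inv_iff.1 h)⟩
  have bB : GoodEnd σB pB z b := by
    rcases hb with rfl | rfl
    · exact eB
    · exact goodEnd_inv HB eB
  have o := final_B HB aB.1 (hAx k k1).2 aB.2 k3 bB
  have hne : a * b ≠ k := by
    intro e
    rw [e, mul_inv_cancel] at d1
    rw [e] at d2
    have l1 := transLen_le (σ := σA) pA 1
    rw [HA.one, dist_self] at l1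
    have := (hAx k k1).1.pos HA
    linarith
  have : ((a * b, k) : G × G) ∈ DisjointSet (transLen σA) ∩ OverlapSet (transLen σB) :=
    ⟨⟨hne, d1, d2⟩, ⟨hne, o⟩⟩
  rw [hcc.2] at this
  exact this

end two

section finish
variable {G : Type*} [Group G] {T : Type*} [MetricSpace T] {σ : T → G → T}

theorem mem_seg {p q w : T} : w ∈ treeSegment p q ↔ ¬ Sh w p q := by
  rw [not_sh_iff, treeSegment, Set.mem_setOf_eq, dist_comm p w, eq_comm]

theorem unique_start (H : TreeAct σ) {p : T} {z x : G} (hx : Ax σ p x) (hs : ¬ InS σ p z x) :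
    ∃! w, w ∈ treeSegment p (σ p z) ∩ charSet σ x := by
  refine ⟨p, ⟨mem_seg.2 not_sh_left, hx.mem H⟩, ?_⟩
  rintro w ⟨w1, w2⟩
  exact single H hx hs (mem_seg.1 w1) (ax_of_mem H (hx.pos H) w2)

theorem unique_end (H : TreeAct σ) {p : T} {z x : G} (hx : Ax σ p x) (hs : ¬ InS σ p z⁻¹ x) :
    ∃! w, w ∈ treeSegment p (σ p z) ∩ charSet σ (z⁻¹ * x * z) := by
  have hy : Ax σ (σ p z) (z⁻¹ * x * z) := (ax_conj H z).2 hx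
  refine ⟨σ p z, ⟨mem_seg.2 not_sh_right, hy.mem H⟩, ?_⟩
  rintro w ⟨w1, w2⟩
  have hw := ax_of_mem H (hy.pos H) w2
  rw [mem_seg, ← sh_act H z⁻¹, act_inv H] at w1
  rw [← inv_act H z w, ax_conj H z] at hw
  have := single H hx hs (not_sh_symm w1) hw
  rw [← this, inv_act H]

end finish

/-- with `f, g, h` as in the triple-point lemma, for every `z`
there are `x ∈ {f,g,h}` and `y ∈ {z⁻¹fz, z⁻¹gz, z⁻¹hz}` such that in both trees
the segment `[∗^T, ∗^T·z]` meets `C_x^T` and `C_y^T` each in a single point. -/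
theorem segment_meets_axes_in_points {G : Type*} [Group G]
    {A : Type*} [MetricSpace A] {B : Type*} [MetricSpace B]
    (σA : A → G → A) (σB : B → G → B)
    (hA : IsRealTree A) (hB : IsRealTree B)
    (hσA : IsIsomRightAction σA) (hσB : IsIsomRightAction σB)
    (hcc : CompatibleCombinatorics (transLen σA) (transLen σB))
    (f g h : G)
    (hhypA : ∀ x ∈ ({f, g, h} : Set G), 0 < transLen σA x)
    (hhypB : ∀ x ∈ ({f, g, h} : Set G), 0 < transLen σB x)
    (pA : A) (pB : B)
    (hpA : charSet σA f ∩ charSet σA g ∩ charSet σA h = {pA})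
    (hpB : charSet σB f ∩ charSet σB g ∩ charSet σB h = {pB}) :
    ∀ z : G, ∃ x ∈ ({f, g, h} : Set G),
      ∃ y ∈ ({z⁻¹ * f * z, z⁻¹ * g * z, z⁻¹ * h * z} : Set G),
        (∃! w, w ∈ treeSegment pA (σA pA z) ∩ charSet σA x) ∧
        (∃! w, w ∈ treeSegment pA (σA pA z) ∩ charSet σA y) ∧
        (∃! w, w ∈ treeSegment pB (σB pB z) ∩ charSet σB x) ∧
        (∃! w, w ∈ treeSegment pB (σB pB z) ∩ charSet σB y) := by
  have HA := treeAct_of hA hσA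
  have HB := treeAct_of hB hσB
  have hmA : pA ∈ charSet σA f ∩ charSet σA g ∩ charSet σA h := by rw [hpA]; rfl
  have hmB : pB ∈ charSet σB f ∩ charSet σB g ∩ charSet σB h := by rw [hpB]; rfl
  have hAx : ∀ x, (x = f ∨ x = g ∨ x = h) → Ax σA pA x ∧ Ax σB pB x := by
    intro x hx
    refine ⟨ax_of_mem HA (hhypA x hx) ?_, ax_of_mem HB (hhypB x hx) ?_⟩
    · rcases hx with rfl | rfl | rfl
      exacts [hmA.1.1, hmA.1.2, hmA.2]
    · rcases hx with rfl | rfl | rfl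
      exacts [hmB.1.1, hmB.1.2, hmB.2]
  intro z
  obtain ⟨x, hx, xA, xB⟩ := exists_common HA HB hcc hAx hpA hpB z
  obtain ⟨y, hy, yA, yB⟩ := exists_common HA HB hcc hAx hpA hpB z⁻¹
  refine ⟨x, hx, z⁻¹ * y * z, ?_, unique_start HA (hAx x hx).1 xA,
    unique_end HA (hAx y hy).1 yA, unique_start HB (hAx x hx).2 xB,
    unique_end HB (hAx y hy).2 yB⟩
  rcases hy with rfl | rfl | rfl
  exacts [Or.inl rfl, Or.inr (Or.inl rfl), Or.inr (Or.inr rfl)]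
end
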